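/- arXiv:1607.01765 — 10 statements merged into one kernel-verified Lean document; each statement's English description precedes it below -/
import Mathlib

section
/- For every positive integer n, in the ring of formal power series ℤ[[q,u,v]] one has ∑_{λ ∈ L_n} q^{|λ|} u^{|⌈λ⌉|} v^{o(⌈λ⌉)} · ∏_{i=1}^{n} (1 − u² q^{n+i}) = ∏_{i=1}^{n} (1 + u v q^{i}). -/
open MvPowerSeries

/-- `lam` (0-based) is a lecture hall partition in `L_n`. -/
def IsLectureHall (n : ℕ) (lam : Fin n → ℕ) : Prop :=
  ∀ i j : Fin n, (j : ℕ) = (i : ℕ) + 1 →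
    lam i * ((j : ℕ) + 1) ≤ lam j * ((i : ℕ) + 1)

/-- Ceiling division of naturals: `⌈a / b⌉`. -/
def cdiv (a b : ℕ) : ℕ := (a + b - 1) / b

/-- The generating function `∑_{λ ∈ L_n} q^{|λ|} u^{|⌈λ⌉|} v^{o(⌈λ⌉)}` in
`ℤ[[q, u, v]]` (variables `0 = q`, `1 = u`, `2 = v`): the coefficient of
`q^{d 0} u^{d 1} v^{d 2}` is the number of `λ ∈ L_n` with `|λ| = d 0`,
`|⌈λ⌉| = d 1` and `o(⌈λ⌉) = d 2`, where `⌈λ⌉ᵢ = ⌈λᵢ/i⌉` and `o` counts odd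
entries. -/
noncomputable def refinedLgf (n : ℕ) : MvPowerSeries (Fin 3) ℤ := fun d =>
  (Nat.card {lam : Fin n → ℕ // IsLectureHall n lam ∧
      (∑ i, lam i) = d 0 ∧
      (∑ i : Fin n, cdiv (lam i) ((i : ℕ) + 1)) = d 1 ∧
      (Finset.univ.filter fun i : Fin n => Odd (cdiv (lam i) ((i : ℕ) + 1))).card
        = d 2} : ℤ)

section LH
open Finset

variable {R : Type*} [CommRing R]

/-- Gaussian binomial `[i+j choose i]`. -/
def gb (q : R) : ℕ → ℕ → R
  | 0, _ => 1
  | _ + 1, 0 => 1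
  | i + 1, j + 1 => gb q (i + 1) j + q ^ (j + 1) * gb q i (j + 1)
termination_by i j => i + j

theorem gb_zero_left (q : R) (j : ℕ) : gb q 0 j = 1 := by simp [gb]
theorem gb_zero_right (q : R) (i : ℕ) : gb q i 0 = 1 := by cases i <;> simp [gb]
theorem gb_succ (q : R) (i j : ℕ) :
    gb q (i + 1) (j + 1) = gb q (i + 1) j + q ^ (j + 1) * gb q i (j + 1) := by rw [gb]

def qn (q : R) (n : ℕ) : R := ∑ i ∈ range n, q ^ i
def qf (q : R) (n : ℕ) : R := ∏ i ∈ range n, qn q (i + 1)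

theorem qn_add (q : R) (m n : ℕ) : qn q (m + n) = qn q m + q ^ m * qn q n := by
  simp [qn, sum_range_add, mul_sum, pow_add]

theorem qf_succ (q : R) (n : ℕ) : qf q (n + 1) = qf q n * qn q (n + 1) := by
  simp [qf, prod_range_succ]

theorem gb_qf (q : R) : ∀ s i j : ℕ, i + j = s → gb q i j * (qf q i * qf q j) = qf q (i + j) := by
  intro s
  induction s with
  | zero =>
    intro i j h
    obtain ⟨rfl, rfl⟩ : i = 0 ∧ j = 0 := by omega
    simp [gb_zero_left, qf]
  | succ s ih =>
    intro i j h
    rcases i with _ | i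
    · simp [gb_zero_left, qf]
    rcases j with _ | j
    · simp [gb_zero_right, qf]
    have h1 := ih (i + 1) j (by omega)
    have h2 := ih i (j + 1) (by omega)
    rw [gb_succ, show i + 1 + (j + 1) = (i + j + 1) + 1 by ring, qf_succ q (i + j + 1),
      show i + j + 1 + 1 = (j + 1) + (i + 1) by ring, qn_add]
    rw [show i + 1 + j = i + j + 1 by ring, qf_succ] at h1
    rw [show i + (j + 1) = i + j + 1 by ring, qf_succ q j] at h2
    rw [qf_succ q i, qf_succ q j]
    linear_combination qn q (j+1) * h1 + q ^ (j+1) * qn q (i+1) * h2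

theorem gb_tri [IsDomain R] (q : R) (hq : ∀ n, qn q (n + 1) ≠ 0) (m a p : ℕ) :
    gb q m (a + p) * gb q a p = gb q a (m + p) * gb q m p := by
  have hf : ∀ n, qf q n ≠ 0 := fun n => prod_ne_zero_iff.2 fun i _ => hq i
  have h1 := gb_qf q _ m (a + p) rfl
  have h2 := gb_qf q _ a p rfl
  have h3 := gb_qf q _ a (m + p) rfl
  have h4 := gb_qf q _ m p rfl
  have hne : qf q m * qf q a * qf q p ≠ 0 := mul_ne_zero (mul_ne_zero (hf _) (hf _)) (hf _)
  apply mul_right_cancel₀ hne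
  rw [show a + (m + p) = m + (a + p) by ring, ← h1] at h3
  rw [← h2, ← h4] at h3
  linear_combination -h3

theorem gb_symm [IsDomain R] (q : R) (hq : ∀ n, qn q (n + 1) ≠ 0) (a p : ℕ) :
    gb q a p = gb q p a := by
  have := gb_tri q hq p a 0
  simpa [gb_zero_right] using this.symm

theorem pascal_sum (q : R) (n : ℕ) (φ : ℕ → ℕ → R) :
    ∑ x ∈ antidiagonal (n + 1), gb q x.1 x.2 * φ x.1 x.2 =
    ∑ x ∈ antidiagonal n, gb q x.1 x.2 * (φ x.1 (x.2 + 1) + q ^ x.2 * φ (x.1 + 1) x.2) := by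
  rcases n with _ | n
  · simp [Nat.antidiagonal_succ, gb_zero_left, gb_zero_right]
  · simp only [mul_add, sum_add_distrib]
    rw [Nat.sum_antidiagonal_succ, Nat.sum_antidiagonal_succ', Nat.sum_antidiagonal_succ,
      Nat.sum_antidiagonal_succ' (n := n)]
    simp only [gb_succ, gb_zero_left, gb_zero_right, add_mul, sum_add_distrib]
    simp only [pow_zero, one_mul, mul_assoc, mul_left_comm (q ^ _)]
    ring

/-- triangular numbers -/
def tg : ℕ → ℕ
  | 0 => 0
  | n + 1 => tg n + n + 1

theorem tg_two (m : ℕ) : 2 * tg m = m * m + m := by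
  induction m with
  | zero => rfl
  | succ m ih => simp only [tg]; linarith

theorem tg_add (m p : ℕ) : tg (m + p) = tg m + tg p + m * p := by
  have h1 := tg_two m
  have h2 := tg_two p
  have h3 := tg_two (m + p)
  nlinarith

theorem key_one (q : R) (n : ℕ) : ∀ y : R,
    ∑ x ∈ antidiagonal n, gb q x.1 x.2 * (y ^ x.2 * ∏ i ∈ range x.1, (1 - y * q ^ i)) = 1 := by
  induction n with
  | zero => intro y; simp [gb_zero_left]
  | succ n ih =>
    intro y
    rw [pascal_sum q n (fun a p => y ^ p * ∏ i ∈ range a, (1 - y * q ^ i))]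
    have h1 := ih y
    have h2 := ih (y * q)
    have : ∀ x ∈ antidiagonal n, gb q x.1 x.2 * (y ^ (x.2 + 1) * ∏ i ∈ range x.1, (1 - y * q ^ i)
        + q ^ x.2 * (y ^ x.2 * ∏ i ∈ range (x.1 + 1), (1 - y * q ^ i))) =
        y * (gb q x.1 x.2 * (y ^ x.2 * ∏ i ∈ range x.1, (1 - y * q ^ i))) +
        (1 - y) * (gb q x.1 x.2 * ((y * q) ^ x.2 * ∏ i ∈ range x.1, (1 - (y * q) * q ^ i))) := by
      intro x _
      rw [prod_range_succ']
      have : ∀ i, 1 - y * q ^ (i + 1) = 1 - (y * q) * q ^ i := fun i => by ring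
      simp only [this]
      ring
    rw [sum_congr rfl this, sum_add_distrib, ← mul_sum, ← mul_sum, h1, h2]
    ring

/-- weight -/
def wt (q u v : R) (i l : ℕ) : R :=
  q ^ l * u ^ cdiv l (i + 1) * v ^ (cdiv l (i + 1) % 2)

def LF : (n : ℕ) → ℕ → Finset (Fin n → ℕ)
  | 0, _ => {fun _ => 0}
  | n + 1, t => (range (t + 1)).biUnion fun s =>
      (LF n (n * s / (n + 1))).image fun l => Fin.snoc (α := fun _ => ℕ) l s

theorem mem_LF (n : ℕ) : ∀ (t : ℕ) (l : Fin n → ℕ), l ∈ LF n t ↔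
    IsLectureHall n l ∧ ∀ i : Fin n, (i : ℕ) + 1 = n → l i ≤ t := by
  induction n with
  | zero =>
    intro t l
    simp only [LF, mem_singleton]
    constructor
    · intro _; exact ⟨fun i => i.elim0, fun i => i.elim0⟩
    · intro _; exact Subsingleton.elim _ _
  | succ n ih =>
    intro t l
    simp only [LF, mem_biUnion, mem_image, mem_range, ih]
    constructor
    · rintro ⟨s, hs, l, ⟨h1, h2⟩, rfl⟩
      refine ⟨?_, ?_⟩
      · intro i j hij
        induction i using Fin.lastCases with
        | last => have := j.2; simp at hij; omega
        | cast i =>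
          induction j using Fin.lastCases with
          | last =>
            simp only [Fin.snoc_castSucc, Fin.snoc_last, Fin.val_last, Fin.val_castSucc] at hij ⊢
            have := h2 i hij.symm
            rw [Nat.le_div_iff_mul_le (by omega)] at this
            rw [← hij, mul_comm s]; exact this
          | cast j =>
            simp only [Fin.snoc_castSucc, Fin.val_castSucc] at hij ⊢
            exact h1 i j hij
      · intro i hi
        have : i = Fin.last n := by ext; simp; omega
        subst this
        simp; omega
    · rintro ⟨h1, h2⟩
      refine ⟨l (Fin.last n), ?_, Fin.init l, ⟨?_, ?_⟩, Fin.snoc_init_self l⟩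
      · have := h2 (Fin.last n) (by simp); omega
      · intro i j hij
        exact h1 i.castSucc j.castSucc (by simpa using hij)
      · intro i hi
        rw [Nat.le_div_iff_mul_le (by omega)]
        have := h1 i.castSucc (Fin.last n) (by simp [hi])
        simp only [Fin.val_last, Fin.val_castSucc, hi] at this
        rw [mul_comm n]; exact this

def ff (q u v : R) (n t : ℕ) : R := ∑ l ∈ LF n t, ∏ i : Fin n, wt q u v i (l i)

theorem ff_zero (q u v : R) (t : ℕ) : ff q u v 0 t = 1 := by simp [ff, LF]

theorem ff_succ (q u v : R) (n t : ℕ) : ff q u v (n + 1) t =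
    ∑ s ∈ range (t + 1), wt q u v n s * ff q u v n (n * s / (n + 1)) := by
  rw [ff, LF, sum_biUnion]
  · refine sum_congr rfl fun s _ => ?_
    rw [sum_image, ff, mul_sum]
    · refine sum_congr rfl fun l _ => ?_
      rw [Fin.prod_univ_castSucc]
      simp [mul_comm]
    · intro a _ b _ h
      exact (Fin.snoc_inj.1 h).1
  · intro a _ b _ hab
    simp only [Function.onFun]
    rw [disjoint_left]
    intro l h1 h2
    simp only [mem_image] at h1 h2
    obtain ⟨x, _, rfl⟩ := h1
    obtain ⟨y, _, h⟩ := h2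
    exact hab (Fin.snoc_inj.1 h).2.symm

theorem ff_zero_right (q u v : R) (n : ℕ) : ff q u v n 0 = 1 := by
  induction n with
  | zero => exact ff_zero ..
  | succ n ih => 
    have : n / (n + 1) = 0 := Nat.div_eq_of_lt (by omega)
    simp [ff_succ, ih, wt, cdiv, this]

theorem ff_step (q u v : R) (n K s : ℕ) (hs : s ≤ n) :
    ff q u v (n + 1) ((n + 1) * K + (s + 1)) = ff q u v (n + 1) ((n + 1) * K + s) +
      q ^ ((n + 1) * K + (s + 1)) * (u ^ (K + 1) * v ^ ((K + 1) % 2)) * ff q u v n (n * K + s) := by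
  rw [ff_succ, ← add_assoc ((n+1)*K), sum_range_succ, ← ff_succ]
  have h1 : n * ((n + 1) * K + s + 1) / (n + 1) = n * K + s := by
    rw [Nat.div_eq_iff (by omega)]
    constructor
    · have : (n * K + s) * (n + 1) + n = n * ((n + 1) * K + s + 1) + s := by ring
      omega
    · have : (n * K + s) * (n + 1) + n = n * ((n + 1) * K + s + 1) + s := by ring
      omega
  have h2 : cdiv ((n + 1) * K + s + 1) (n + 1) = K + 1 := by
    rw [cdiv, Nat.div_eq_iff (by omega)]
    have : (K + 1) * (n + 1) = (n + 1) * K + n + 1 := by ring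
    constructor <;> omega
  rw [h1, wt, h2]
  ring

theorem ff_block (q u v : R) (K s : ℕ) : ∀ d : ℕ,
    ff q u v (s + d) ((s + d) * K + s) = ∑ x ∈ antidiagonal s, gb q x.1 x.2 *
      ((u ^ (K + 1) * v ^ ((K + 1) % 2)) ^ x.1 * q ^ ((K + 1) * tg x.1 + K * x.1 * (x.2 + d)) *
        ff q u v (x.2 + d) ((x.2 + d) * K)) := by
  induction s with
  | zero => intro d; simp [gb_zero_left, tg]
  | succ s ih =>
    intro d
    rw [pascal_sum q s (fun m r => ((u ^ (K + 1) * v ^ ((K + 1) % 2)) ^ m *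
      q ^ ((K + 1) * tg m + K * m * (r + d)) * ff q u v (r + d) ((r + d) * K)))]
    rw [show s + 1 + d = s + d + 1 by ring, ff_step _ _ _ _ _ _ (by omega), ih d,
      show s + d + 1 = s + (d + 1) by ring, ih (d + 1), mul_sum, ← sum_add_distrib]
    refine sum_congr rfl fun x hx => ?_
    rw [HasAntidiagonal.mem_antidiagonal] at hx
    obtain ⟨m, r⟩ := x
    simp only at hx ⊢
    subst hx
    rw [show r + 1 + d = r + (d + 1) by ring]
    simp only [tg]
    ring

def TT (q v : R) (K n : ℕ) (u : R) : R := ff q u v n (n * K)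

theorem TT_zero (q v : R) (n : ℕ) (u : R) : TT q v 0 n u = 1 := by simp [TT, ff_zero_right]
theorem TT_zero' (q v : R) (K : ℕ) (u : R) : TT q v K 0 u = 1 := by simp [TT, ff_zero]

theorem TT_succ (q v : R) (K n : ℕ) (u : R) : TT q v (K + 1) n u =
    ∑ x ∈ antidiagonal n, gb q x.1 x.2 *
      ((u ^ (K + 1) * v ^ ((K + 1) % 2)) ^ x.1 * q ^ ((K + 1) * tg x.1 + K * x.1 * x.2) *
        TT q v K x.2 u) := by
  have := ff_block q u v K n 0
  simpa [TT, mul_add] using this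

theorem TT_one (q v : R) (n : ℕ) (u : R) :
    TT q v 1 n u = ∏ i ∈ range n, (1 + u * v * q ^ (i + 1)) := by
  rw [TT_succ]
  simp only [TT_zero]
  induction n with
  | zero => simp [gb_zero_left, tg]
  | succ n ih =>
    rw [pascal_sum q n (fun m r => ((u ^ (0 + 1) * v ^ ((0 + 1) % 2)) ^ m *
      q ^ ((0 + 1) * tg m + 0 * m * r) * 1)), prod_range_succ, ← ih, sum_mul]
    refine sum_congr rfl fun x hx => ?_
    rw [HasAntidiagonal.mem_antidiagonal] at hx
    obtain ⟨m, r⟩ := x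
    simp only at hx ⊢
    subst hx
    simp only [tg]
    norm_num
    ring

theorem triple_swap (n : ℕ) (f : ℕ → ℕ → ℕ → R) :
    ∑ x ∈ antidiagonal n, ∑ y ∈ antidiagonal x.2, f x.1 y.1 y.2 =
    ∑ x ∈ antidiagonal n, ∑ y ∈ antidiagonal x.2, f y.1 x.1 y.2 := by
  rw [sum_sigma', sum_sigma']
  refine sum_bij' (fun z _ => ⟨(z.2.1, z.1.1 + z.2.2), (z.1.1, z.2.2)⟩)
    (fun z _ => ⟨(z.2.1, z.1.1 + z.2.2), (z.1.1, z.2.2)⟩) ?_ ?_ ?_ ?_ ?_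
  · rintro ⟨⟨a, b⟩, ⟨c, d⟩⟩ h
    simp only [mem_sigma, HasAntidiagonal.mem_antidiagonal, and_true] at h ⊢; omega
  · rintro ⟨⟨a, b⟩, ⟨c, d⟩⟩ h
    simp only [mem_sigma, HasAntidiagonal.mem_antidiagonal, and_true] at h ⊢; omega
  · rintro ⟨⟨a, b⟩, ⟨c, d⟩⟩ h
    simp only [mem_sigma, HasAntidiagonal.mem_antidiagonal] at h ⊢
    obtain ⟨h1, rfl⟩ := h; rfl
  · rintro ⟨⟨a, b⟩, ⟨c, d⟩⟩ h
    simp only [mem_sigma, HasAntidiagonal.mem_antidiagonal] at h ⊢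
    obtain ⟨h1, rfl⟩ := h; rfl
  · rintro ⟨⟨a, b⟩, ⟨c, d⟩⟩ h
    rfl

theorem TT_bottom [IsDomain R] (q v : R) (hq : ∀ n, qn q (n + 1) ≠ 0) (K : ℕ) : ∀ (n : ℕ) (u : R),
    TT q v (K + 2) n u = ∑ x ∈ antidiagonal n, gb q x.1 x.2 *
      (TT q v 1 x.1 u * u ^ (2 * x.2) * q ^ (x.1 * x.2 + 2 * tg x.2) *
        TT q v K x.2 (u * q ^ x.1)) := by
  induction K with
  | zero =>
    intro n u
    rw [TT_succ, ← Nat.sum_antidiagonal_swap]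
    refine sum_congr rfl fun x _ => ?_
    obtain ⟨m, r⟩ := x
    simp only [TT_zero, Prod.swap, zero_add]
    rw [gb_symm q hq r m]
    norm_num
    left
    ring
  | succ K ih =>
    intro n u
    rw [TT_succ]
    simp only [ih]
    simp only [TT_succ q v K, mul_sum]
    have hsw := triple_swap n (fun m a p => gb q m (a+p) * ((u ^ (K + 2 + 1) * v ^ ((K + 2 + 1) % 2)) ^ m *
      q ^ ((K + 2 + 1) * tg m + (K + 2) * m * (a + p)) * (gb q a p *
      (TT q v 1 a u * u ^ (2 * p) * q ^ (a * p + 2 * tg p) *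
        TT q v K p (u * q ^ a)))))
    refine Eq.trans ?_ (hsw.trans ?_)
    rotate_left
    · refine sum_congr rfl fun x _ => sum_congr rfl fun y hy => ?_
      rw [HasAntidiagonal.mem_antidiagonal] at hy
      obtain ⟨a, N⟩ := x
      obtain ⟨m, p⟩ := y
      simp only at hy ⊢
      subst hy
      have := gb_tri q hq m a p
      rw [show (K + 2 + 1) % 2 = (K + 1) % 2 by omega, tg_add]
      linear_combination ((u ^ (K + 2 + 1) * v ^ ((K + 1) % 2)) ^ m *
        q ^ ((K + 2 + 1) * tg m + (K + 2) * m * (a + p)) * (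
        (TT q v 1 a u * u ^ (2 * p) * q ^ (a * p + 2 * tg p) *
        TT q v K p (u * q ^ a)))) * this
    · refine sum_congr rfl fun x _ => sum_congr rfl fun y hy => ?_
      rw [HasAntidiagonal.mem_antidiagonal] at hy
      rw [← hy]

theorem main_dvd [IsDomain R] (q v : R) (hq : ∀ n, qn q (n + 1) ≠ 0) (k : ℕ) : ∀ (n : ℕ) (u : R),
    u ^ k ∣ TT q v (2 * k) n u * ∏ i ∈ range n, (1 - u ^ 2 * q ^ (n + (i + 1))) -
      TT q v 1 n u := by
  induction k with
  | zero => intro n u; simp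
  | succ k ih =>
    intro n u
    have h1 : TT q v 1 n u = ∑ x ∈ antidiagonal n, gb q x.1 x.2 *
      ((u ^ 2 * q ^ (n + 1)) ^ x.2 * ∏ i ∈ range x.1, (1 - (u ^ 2 * q ^ (n + 1)) * q ^ i))
        * TT q v 1 n u := by
      rw [← sum_mul, key_one, one_mul]
    rw [h1, show 2 * (k + 1) = 2 * k + 2 by ring, TT_bottom q v hq, sum_mul, ← sum_sub_distrib]
    refine dvd_sum fun x hx => ?_
    rw [HasAntidiagonal.mem_antidiagonal] at hx
    obtain ⟨a, p⟩ := x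
    simp only at hx ⊢
    subst hx
    have hD : ∏ i ∈ range (a + p), (1 - u ^ 2 * q ^ (a + p + (i + 1))) =
        (∏ i ∈ range a, (1 - (u ^ 2 * q ^ (a + p + 1)) * q ^ i)) *
        ∏ i ∈ range p, (1 - (u * q ^ a) ^ 2 * q ^ (p + (i + 1))) := by
      rw [prod_range_add]
      congr 1 <;> refine prod_congr rfl fun i _ => ?_ <;> ring
    have hN : TT q v 1 (a + p) u = TT q v 1 a u * TT q v 1 p (u * q ^ a) := by
      simp only [TT_one]
      rw [prod_range_add]
      congr 1; refine prod_congr rfl fun i _ => ?_; ring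
    have he : a * p + 2 * tg p = (a + p + 1) * p := by rw [tg_two]; ring
    rw [hD, hN, he]
    obtain ⟨w, hw⟩ := ih p (u * q ^ a)
    rcases p with _ | p
    · simp only [TT_zero', range_zero, prod_empty, mul_zero, pow_zero, mul_one]
      refine ⟨0, ?_⟩
      ring
    · refine ⟨gb q a (p + 1) * TT q v 1 a u * u ^ (2 * p + 1) * q ^ ((a + (p + 1) + 1) * (p + 1)) *
        (∏ i ∈ range a, (1 - (u ^ 2 * q ^ (a + (p + 1) + 1)) * q ^ i)) * (q ^ a) ^ k * w, ?_⟩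
      linear_combination gb q a (p + 1) * TT q v 1 a u * u ^ (2 * (p + 1)) *
        q ^ ((a + (p + 1) + 1) * (p + 1)) *
        (∏ i ∈ range a, (1 - (u ^ 2 * q ^ (a + (p + 1) + 1)) * q ^ i)) * hw

theorem coeff_ff (n t : ℕ) (d : Fin 3 →₀ ℕ) (ht : d 0 ≤ t) :
    coeff d (ff (X 0 : MvPowerSeries (Fin 3) ℤ) (X 1) (X 2) n t) = coeff d (refinedLgf n) := by
  have hw : ∀ l : Fin n → ℕ, ∏ i : Fin n, wt (X 0 : MvPowerSeries (Fin 3) ℤ) (X 1) (X 2) i (l i) =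
      monomial (Finsupp.single 0 (∑ i, l i) +
        Finsupp.single 1 (∑ i : Fin n, cdiv (l i) ((i : ℕ) + 1)) +
        Finsupp.single 2 (univ.filter fun i : Fin n => Odd (cdiv (l i) ((i : ℕ) + 1))).card) 1 := by
    intro l
    simp only [wt, prod_mul_distrib, prod_pow_eq_pow_sum]
    have : ∑ i : Fin n, cdiv (l i) ((i : ℕ) + 1) % 2 =
        (univ.filter fun i : Fin n => Odd (cdiv (l i) ((i : ℕ) + 1))).card := by
      rw [card_filter]
      refine sum_congr rfl fun i _ => ?_
      split_ifs with h
      · exact Nat.odd_iff.1 h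
      · exact Nat.even_iff.1 (Nat.not_odd_iff_even.1 h)
    rw [this]
    simp only [X_pow_eq, monomial_mul_monomial, one_mul]
  have hd : ∀ a b c : ℕ, (d = Finsupp.single 0 a + Finsupp.single 1 b + Finsupp.single 2 c) ↔
      (a = d 0 ∧ b = d 1 ∧ c = d 2) := by
    intro a b c
    rw [Finsupp.ext_iff, Fin.forall_fin_succ, Fin.forall_fin_two]
    simp [Finsupp.single_apply, eq_comm]
  classical
  rw [ff, map_sum]
  simp only [hw, coeff_monomial, hd]
  change _ = ((Nat.card _ : ℕ) : ℤ)
  rw [← Finset.natCast_card_filter]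
  congr 1
  symm
  refine Nat.subtype_card _ fun l => ?_
  simp only [mem_filter, mem_LF]
  constructor
  · rintro ⟨⟨h1, _⟩, h2⟩; exact ⟨h1, h2⟩
  · rintro ⟨h1, h2⟩
    refine ⟨⟨h1, fun i _ => ?_⟩, h2⟩
    have := single_le_sum (f := l) (fun _ _ => Nat.zero_le _) (mem_univ i)
    omega

end LH

/-- **The refined lecture hall theorem** (Bousquet-Mélou–Eriksson): in `ℤ[[q,u,v]]`,
`(∑_{λ ∈ L_n} q^{|λ|} u^{|⌈λ⌉|} v^{o(⌈λ⌉)}) ⬝ ∏_{i=1}^n (1 - u² q^{n+i})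
  = ∏_{i=1}^n (1 + u v q^i)`. -/
theorem refined_lecture_hall_theorem (n : ℕ) (hn : 0 < n) :
    refinedLgf n * ∏ i ∈ Finset.range n,
        (1 - (X 1 : MvPowerSeries (Fin 3) ℤ) ^ 2 * X 0 ^ (n + (i + 1))) =
    ∏ i ∈ Finset.range n,
        (1 + (X 1 : MvPowerSeries (Fin 3) ℤ) * X 2 * X 0 ^ (i + 1)) := by
  classical
  have hq : ∀ n, qn (X 0 : MvPowerSeries (Fin 3) ℤ) (n + 1) ≠ 0 := by
    intro n h
    have := congrArg (constantCoeff (σ := Fin 3) (R := ℤ)) h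
    simp [qn, Finset.sum_range_succ'] at this
  have : Nontrivial (MvPowerSeries (Fin 3) ℤ) := ⟨⟨_, _, hq 0⟩⟩
  have : IsDomain (MvPowerSeries (Fin 3) ℤ) := NoZeroDivisors.to_isDomain _
  ext d
  have hk := main_dvd (X 0 : MvPowerSeries (Fin 3) ℤ) (X 2) hq (d 0 + d 1 + 1) n (X 1)
  rw [X_pow_dvd_iff] at hk
  have h := hk d (by omega)
  rw [map_sub, sub_eq_zero, TT_one] at h
  rw [← h, coeff_mul, coeff_mul]
  refine Finset.sum_congr rfl fun x hx => ?_
  rw [Finset.HasAntidiagonal.mem_antidiagonal] at hx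
  rw [TT, coeff_ff]
  have : x.1 0 ≤ d 0 := by rw [← hx]; simp
  nlinarith
end

section
/- For every positive integer n, in the ring of formal power series ℤ[[q,u,v]] one has ∑_{λ ∈ A_n} q^{|λ|} u^{|⌊λ⌋|} v^{o(⌊λ⌋)} · ∏_{i=1}^{n} (1 − u² q^{i+1}) = ∏_{i=1}^{n} (1 + u v q^{i}). -/
open MvPowerSeries

/-- `lam` (0-based) is an anti-lecture hall composition in `A_n`. -/
def IsAntiLectureHall (n : ℕ) (lam : Fin n → ℕ) : Prop :=
  ∀ i j : Fin n, (j : ℕ) = (i : ℕ) + 1 →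
    lam j * ((i : ℕ) + 1) ≤ lam i * ((j : ℕ) + 1)

/-- The generating function `∑_{λ ∈ A_n} q^{|λ|} u^{|⌊λ⌋|} v^{o(⌊λ⌋)}` in
`ℤ[[q, u, v]]` (variables `0 = q`, `1 = u`, `2 = v`): the coefficient of
`q^{d 0} u^{d 1} v^{d 2}` is the number of `λ ∈ A_n` with `|λ| = d 0`,
`|⌊λ⌋| = d 1` and `o(⌊λ⌋) = d 2`, where `⌊λ⌋ᵢ = ⌊λᵢ/i⌋` and `o` counts odd
entries. -/
noncomputable def refinedAgf (n : ℕ) : MvPowerSeries (Fin 3) ℤ := fun d =>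
  (Nat.card {lam : Fin n → ℕ // IsAntiLectureHall n lam ∧
      (∑ i, lam i) = d 0 ∧
      (∑ i : Fin n, lam i / ((i : ℕ) + 1)) = d 1 ∧
      (Finset.univ.filter fun i : Fin n => Odd (lam i / ((i : ℕ) + 1))).card
        = d 2} : ℤ)

namespace ALH

open Finset

abbrev R := MvPowerSeries (Fin 3) ℤ

noncomputable def gf {α : Type} (w : α → (Fin 3 →₀ ℕ)) : R :=
  fun d => (Nat.card {a // w a = d} : ℤ)

lemma coeff_gf {α : Type} (w : α → (Fin 3 →₀ ℕ)) (d) :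
    MvPowerSeries.coeff d (gf w) = (Nat.card {a // w a = d} : ℤ) := rfl

lemma gf_equiv {α β : Type} (e : α ≃ β) (w : α → (Fin 3 →₀ ℕ)) (w' : β → (Fin 3 →₀ ℕ))
    (h : ∀ a, w' (e a) = w a) : gf w = gf w' := by
  ext d
  rw [coeff_gf, coeff_gf]
  congr 1
  exact Nat.card_congr (e.subtypeEquiv (fun a => by rw [h]))

lemma gf_prod {α β : Type} (w : α → (Fin 3 →₀ ℕ)) (w' : β → (Fin 3 →₀ ℕ))
    (h : ∀ d, Finite {a // w a = d}) (h' : ∀ d, Finite {a // w' a = d}) :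
    gf (fun p : α × β => w p.1 + w' p.2) = gf w * gf w' := by
  classical
  ext d
  rw [MvPowerSeries.coeff_mul, coeff_gf]
  simp only [coeff_gf]
  let e : {p : α × β // w p.1 + w' p.2 = d} ≃
      Σ x : {x // x ∈ antidiagonal d}, {a // w a = x.1.1} × {b // w' b = x.1.2} :=
    { toFun := fun p => ⟨⟨(w p.1.1, w' p.1.2), by simpa using p.2⟩, ⟨p.1.1, rfl⟩, ⟨p.1.2, rfl⟩⟩
      invFun := fun x => ⟨(x.2.1.1, x.2.2.1), by
        have := x.1.2
        rw [HasAntidiagonal.mem_antidiagonal] at this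
        have e1 := x.2.1.2
        have e2 := x.2.2.2
        exact (congrArg₂ (· + ·) e1 e2).trans this⟩
      left_inv := fun p => rfl
      right_inv := by
        rintro ⟨⟨⟨x, y⟩, hx⟩, ⟨a, ha⟩, ⟨b, hb⟩⟩
        simp only at ha hb
        subst ha hb
        rfl }
  rw [Nat.card_congr e, Nat.card_sigma]
  simp only [Nat.card_prod]
  push_cast
  rw [Finset.sum_coe_sort (antidiagonal d)
    (fun x => (Nat.card {a // w a = x.1} : ℤ) * (Nat.card {b // w' b = x.2} : ℤ))]

lemma gf_fiber {α ι : Type} (w : α → (Fin 3 →₀ ℕ)) (hw : ∀ d, Finite {a // w a = d})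
    (s : Finset ι) (P : ι → α → Prop)
    (h : ∀ a, ∃ i ∈ s, P i a) (hu : ∀ a i j, P i a → P j a → i = j) :
    gf w = ∑ i ∈ s, gf (fun a : {a // P i a} => w a.1) := by
  classical
  choose κ hκ hP using h
  ext d
  rw [map_sum, coeff_gf]
  simp only [coeff_gf]
  let e : {a // w a = d} ≃ Σ i : {i // i ∈ s}, {a : {a // P i.1 a} // w a.1 = d} :=
    { toFun := fun a => ⟨⟨κ a.1, hκ _⟩, ⟨a.1, hP _⟩, a.2⟩
      invFun := fun x => ⟨x.2.1.1, x.2.2⟩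
      left_inv := fun p => rfl
      right_inv := by
        rintro ⟨⟨i, hi⟩, ⟨a, ha⟩, h2⟩
        have := hu _ _ _ ha (hP a)
        simp only at this
        subst this
        rfl }
  have : ∀ i : {i // i ∈ s}, Finite {a : {a // P i.1 a} // w a.1 = d} := fun i =>
    Finite.of_injective (β := {a // w a = d}) (fun a => ⟨a.1.1, a.2⟩) (by
      rintro ⟨⟨a, _⟩, _⟩ ⟨⟨b, _⟩, _⟩ hh
      simpa using hh)
  rw [Nat.card_congr e, Nat.card_sigma]
  push_cast
  rw [Finset.sum_coe_sort s
    (fun i => (Nat.card {a : {a // P i a} // w a.1 = d} : ℤ))]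

lemma gf_unique {α : Type} [Unique α] (c : Fin 3 →₀ ℕ) :
    gf (fun _ : α => c) = MvPowerSeries.monomial c 1 := by
  classical
  ext d
  rw [coeff_gf, MvPowerSeries.coeff_monomial]
  by_cases h : d = c
  · subst h; simp
  · have : IsEmpty {a : α // c = d} := ⟨fun x => h x.2.symm⟩
    simp [h]

lemma gf_shift {α : Type} (w : α → (Fin 3 →₀ ℕ)) (c : Fin 3 →₀ ℕ)
    (h : ∀ d, Finite {a // w a = d}) :
    gf (fun a => c + w a) = MvPowerSeries.monomial c 1 * gf w := by
  rw [← gf_unique (α := Unit), ← gf_prod _ _ (fun d => inferInstance) h]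
  exact gf_equiv (Equiv.punitProd α).symm _ _ (fun a => rfl)

noncomputable def mk (a b c : ℕ) : Fin 3 →₀ ℕ :=
  Finsupp.single 0 a + Finsupp.single 1 b + Finsupp.single 2 c

lemma mk_add (a b c a' b' c' : ℕ) : mk a b c + mk a' b' c' = mk (a+a') (b+b') (c+c') := by
  simp only [mk, Finsupp.single_add]; abel

@[simp] lemma mk_0 (a b c : ℕ) : mk a b c 0 = a := by simp [mk]
@[simp] lemma mk_1 (a b c : ℕ) : mk a b c 1 = b := by simp [mk]
@[simp] lemma mk_2 (a b c : ℕ) : mk a b c 2 = c := by simp [mk]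

lemma mk_eq_iff (a b c : ℕ) (d : Fin 3 →₀ ℕ) :
    mk a b c = d ↔ a = d 0 ∧ b = d 1 ∧ c = d 2 := by
  constructor
  · rintro rfl; simp
  · rintro ⟨h0, h1, h2⟩
    ext i; fin_cases i
    · simpa using h0
    · simpa using h1
    · simpa using h2

lemma monomial_mk (a b c : ℕ) : (MvPowerSeries.monomial (mk a b c) (1:ℤ) : R)
    = X 0 ^ a * X 1 ^ b * X 2 ^ c := by
  simp only [MvPowerSeries.X_pow_eq, MvPowerSeries.monomial_mul_monomial, mk, mul_one]

/-! ### combinatorial objects -/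

def IsA (n : ℕ) (l : ℕ → ℕ) : Prop :=
  (∀ i, l (i+1) * (i+1) ≤ l i * (i+2)) ∧ ∀ i, n ≤ i → l i = 0

def IsB (a k : ℕ) (r : ℕ → ℕ) : Prop :=
  (∀ i, r (i+1) ≤ r i) ∧ (∀ i, r i ≤ k) ∧ ∀ i, a ≤ i → r i = 0

noncomputable def wA (p n : ℕ) (l : ℕ → ℕ) : Fin 3 →₀ ℕ :=
  mk (∑ i ∈ range n, l i) (∑ i ∈ range n, l i / (i+1)) (∑ i ∈ range n, (l i / (i+1) + p) % 2)

noncomputable def wB (a : ℕ) (r : ℕ → ℕ) : Fin 3 →₀ ℕ := mk (∑ i ∈ range a, r i) 0 0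

lemma finite_aux (n N : ℕ) : {l : ℕ → ℕ | (∀ i, n ≤ i → l i = 0) ∧ ∑ i ∈ range n, l i = N}.Finite := by
  refine Set.Finite.of_injOn (f := fun l (i : Fin n) => l i)
    (t := {g : Fin n → ℕ | ∀ i, g i ∈ Set.Iic N}) ?_ ?_ (Set.Finite.pi' (fun _ => Set.finite_Iic N))
  · rintro l ⟨h1, h2⟩ i
    simp only [Set.mem_Iic]
    rw [← h2]
    exact Finset.single_le_sum (f := l) (fun _ _ => Nat.zero_le _) (mem_range.2 i.2)
  · rintro l ⟨h1, h2⟩ l' ⟨h1', h2'⟩ h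
    funext i
    by_cases hi : i < n
    · exact congrFun h ⟨i, hi⟩
    · rw [h1 i (by omega), h1' i (by omega)]

lemma finA (p n : ℕ) (d) : Finite {a : {l // IsA n l} // wA p n a.1 = d} := by
  have := (finite_aux n (d 0)).to_subtype
  refine Finite.of_injective (β := {l : ℕ → ℕ | (∀ i, n ≤ i → l i = 0) ∧ ∑ i ∈ range n, l i = d 0})
    (fun a => ⟨a.1.1, a.1.2.2, ?_⟩) ?_
  · have := congrArg (fun f => f 0) a.2
    simpa [wA] using this
  · rintro ⟨⟨a, _⟩, _⟩ ⟨⟨b, _⟩, _⟩ hh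
    simpa using hh

lemma finB (n k : ℕ) (d) : Finite {a : {l // IsB n k l} // wB n a.1 = d} := by
  have := (finite_aux n (d 0)).to_subtype
  refine Finite.of_injective (β := {l : ℕ → ℕ | (∀ i, n ≤ i → l i = 0) ∧ ∑ i ∈ range n, l i = d 0})
    (fun a => ⟨a.1.1, a.1.2.2.2, ?_⟩) ?_
  · have := congrArg (fun f => f 0) a.2
    simpa [wB] using this
  · rintro ⟨⟨a, _⟩, _⟩ ⟨⟨b, _⟩, _⟩ hh
    simpa using hh

noncomputable def F (p n : ℕ) : R := gf (fun l : {l // IsA n l} => wA p n l.1)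
noncomputable def b (a k : ℕ) : R := gf (fun l : {l // IsB a k l} => wB a l.1)

lemma F_add_two (p n : ℕ) : F (p+2) n = F p n := by
  unfold F wA
  simp only [← add_assoc, Nat.add_mod_right]

lemma b_zero_left (k : ℕ) : b 0 k = 1 := by
  have : Unique {l // IsB 0 k l} :=
    { default := ⟨fun _ => 0, by simp [IsB]⟩
      uniq := by
        rintro ⟨l, hl⟩
        ext i
        simpa using hl.2.2 i (Nat.zero_le _) }
  have h := gf_unique (α := {l // IsB 0 k l}) (mk 0 0 0)
  rw [monomial_mk] at h
  simpa [b, wB] using h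

lemma b_zero_right (a : ℕ) : b a 0 = 1 := by
  have : Unique {l // IsB a 0 l} :=
    { default := ⟨fun _ => 0, by simp [IsB]⟩
      uniq := by
        rintro ⟨l, hl⟩
        ext i
        simpa using hl.2.1 i }
  have h := gf_unique (α := {l // IsB a 0 l}) (mk 0 0 0)
  rw [monomial_mk] at h
  have h2 : (fun l : {l // IsB a 0 l} => wB a l.1) = fun _ => mk 0 0 0 := by
    funext l
    have : ∀ i, l.1 i = 0 := fun i => by simpa using l.2.2.1 i
    simp [wB, this]
  rw [b, h2, h]; simp

lemma b_rec (a k : ℕ) : b (a+1) (k+1) = b a (k+1) + X 0 ^ (a+1) * b (a+1) k := by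
  have h := gf_fiber (fun l : {l // IsB (a+1) (k+1) l} => wB (a+1) l.1) (finB _ _)
    (Finset.univ : Finset Bool) (fun t l => (t = true ↔ l.1 a = 0))
    (fun l => by by_cases h : l.1 a = 0
                 · exact ⟨true, by simp, by simp [h]⟩
                 · exact ⟨false, by simp, by simp [h]⟩)
    (fun l i j => by cases i <;> cases j <;> simp)
  rw [b, h, Fintype.sum_bool]
  congr 1
  · have h1 : ∀ l, IsB (a+1) (k+1) l → l a = 0 → IsB a (k+1) l := fun l hl h0 =>
      ⟨hl.1, hl.2.1, fun i hi => by
        rcases Nat.eq_or_lt_of_le hi with h | h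
        · rw [← h]; exact h0
        · exact hl.2.2 i h⟩
    have h2 : ∀ l, IsB a (k+1) l → IsB (a+1) (k+1) l := fun l hl =>
      ⟨hl.1, hl.2.1, fun i hi => hl.2.2 i (by omega)⟩
    refine gf_equiv
      { toFun := fun l => ⟨l.1.1, h1 _ l.1.2 (l.2.1 rfl)⟩
        invFun := fun l => ⟨⟨l.1, h2 _ l.2⟩, by simpa using l.2.2.2 a le_rfl⟩
        left_inv := fun l => rfl
        right_inv := fun l => rfl } _ _ ?_
    intro l
    have := l.2.1 rfl
    simp [wB, sum_range_succ, this]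
  · have h2 : (X 0 : R) ^ (a+1) = MvPowerSeries.monomial (mk (a+1) 0 0) 1 := by
      rw [monomial_mk]; simp
    rw [h2, b, ← gf_shift _ _ (finB _ _)]
    have hpos : ∀ l : {l : {l // IsB (a+1) (k+1) l} // (false = true ↔ l.1 a = 0)},
        ∀ i, i < a + 1 → 1 ≤ l.1.1 i := by
      intro l i hi
      have h0 : l.1.1 a ≠ 0 := fun h => by simpa using l.2.2 h
      have := antitone_nat_of_succ_le l.1.2.1 (show i ≤ a by omega)
      omega
    have h3 : ∀ l, IsB (a+1) (k+1) l → IsB (a+1) k (fun i => l i - 1) := fun l hl =>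
      ⟨fun i => by have := hl.1 i; simp only; omega,
       fun i => by have := hl.2.1 i; simp only; omega,
       fun i hi => by have := hl.2.2 i hi; simp only; omega⟩
    have h4 : ∀ l, IsB (a+1) k l → IsB (a+1) (k+1) (fun i => if i < a+1 then l i + 1 else 0) :=
      fun l hl =>
      ⟨fun i => by have := hl.1 i; simp only; split_ifs <;> omega,
       fun i => by have := hl.2.1 i; simp only; split_ifs <;> omega,
       fun i hi => by simp only; split_ifs <;> omega⟩
    refine gf_equiv
      { toFun := fun l => ⟨_, h3 _ l.1.2⟩
        invFun := fun l => ⟨⟨_, h4 _ l.2⟩, by simp⟩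
        left_inv := ?_
        right_inv := ?_ } _ _ ?_
    · intro l
      refine Subtype.ext (Subtype.ext (funext fun i => ?_))
      simp only
      split_ifs with h
      · have := hpos l i h; omega
      · have := l.1.2.2.2 i (by omega); omega
    · intro l
      refine Subtype.ext (funext fun i => ?_)
      simp only
      split_ifs with h
      · omega
      · have := l.2.2.2 i (by omega); omega
    · intro l
      simp only [Equiv.coe_fn_mk, wB, mk_add]
      congr 1
      have : ∑ i ∈ range (a+1), l.1.1 i = ∑ i ∈ range (a+1), (1 + (l.1.1 i - 1)) :=
        sum_congr rfl (fun i hi => by have := hpos l i (mem_range.1 hi); omega)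
      rw [this, sum_add_distrib]; simp

def Cut (k : ℕ) (l : ℕ → ℕ) : Prop := (∀ i, i < k → i + 1 ≤ l i) ∧ ∀ i, k ≤ i → l i ≤ i

lemma cut_unique (l) (i j) (hi : Cut i l) (hj : Cut j l) : i = j := by
  rcases lt_trichotomy i j with h | h | h
  · have := hj.1 i h; have := hi.2 i le_rfl; omega
  · exact h
  · have := hi.1 j h; have := hj.2 j le_rfl; omega

lemma cut_exists (n : ℕ) (l) (hl : IsA n l) : ∃ k ≤ n, Cut k l := by
  classical
  have hex : ∃ k, l k ≤ k := ⟨n, by rw [hl.2 n le_rfl]; omega⟩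
  refine ⟨Nat.find hex, Nat.find_min' hex (by rw [hl.2 n le_rfl]; omega), fun i hi => ?_, fun i hi => ?_⟩
  · have := Nat.find_min hex hi; omega
  · induction i, hi using Nat.le_induction with
    | base => exact Nat.find_spec hex
    | succ i hi ih =>
      have := hl.1 i
      by_contra! hc
      nlinarith

def T (n : ℕ) : ℕ := ∑ i ∈ range n, (i+1)

lemma piece (p a k : ℕ) :
    gf (fun l : {l : {l // IsA (k+a) l} // Cut k l.1} => wA p (k+a) l.1.1) =
      X 0 ^ (T k) * X 1 ^ k * X 2 ^ (a * (p % 2)) * (F (p+1) k * b a k) := by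
  rw [F, b, ← gf_prod _ _ (finA _ _) (finB _ _), ← monomial_mk, ← gf_shift]
  swap
  · intro d
    have : Finite {l : {l // IsA k l} × {l // IsB a k l} // wA (p+1) k l.1.1 + wB a l.2.1 = d} := by
      have hh := fun d => finA (p+1) k d
      have hh' := fun d => finB a k d
      let f : {l : {l // IsA k l} × {l // IsB a k l} // wA (p+1) k l.1.1 + wB a l.2.1 = d} →
        Σ x : {x // x ∈ antidiagonal d}, {l : {l // IsA k l} // wA (p+1) k l.1 = x.1.1} ×
          {l : {l // IsB a k l} // wB a l.1 = x.1.2} := fun p =>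
         ⟨⟨(_, _), HasAntidiagonal.mem_antidiagonal.2 p.2⟩, ⟨p.1.1, rfl⟩, ⟨p.1.2, rfl⟩⟩
      let g : (Σ x : {x // x ∈ antidiagonal d}, {l : {l // IsA k l} // wA (p+1) k l.1 = x.1.1} ×
          {l : {l // IsB a k l} // wB a l.1 = x.1.2}) → {l // IsA k l} × {l // IsB a k l} :=
        fun x => (x.2.1.1, x.2.2.1)
      refine Finite.of_injective f (fun x y h => ?_)
      have := congrArg g h
      exact Subtype.ext this
    exact this
  have h1 : ∀ l, IsA (k+a) l → Cut k l → IsA k (fun i => if i < k then l i - (i+1) else 0) := by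
    rintro l ⟨hl1, hl2⟩ ⟨hc1, hc2⟩
    refine ⟨fun i => ?_, fun i hi => ?_⟩
    · by_cases h : i + 1 < k
      · have h' : i < k := by omega
        have e1 := hc1 i h'
        have e2 := hc1 (i+1) h
        have := hl1 i
        simp only [h, h', if_true]
        obtain ⟨x, hx⟩ := Nat.exists_eq_add_of_le e1
        obtain ⟨y, hy⟩ := Nat.exists_eq_add_of_le e2
        rw [hx, hy] at this ⊢
        rw [Nat.add_sub_cancel_left, Nat.add_sub_cancel_left]
        nlinarith
      · simp [h]
    · simp only; rw [if_neg (by omega)]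
  have h2 : ∀ l, IsA (k+a) l → Cut k l → IsB a k (fun i => l (k+i)) := by
    rintro l ⟨hl1, hl2⟩ ⟨hc1, hc2⟩
    have hdec : ∀ i, l (k+(i+1)) ≤ l (k+i) := fun i => by
      have := hl1 (k+i)
      have := hc2 (k+i) (by omega)
      rw [← add_assoc]
      by_contra! hc
      nlinarith
    refine ⟨hdec, fun i => ?_, fun i hi => hl2 _ (by omega)⟩
    have := antitone_nat_of_succ_le (f := fun i => l (k+i)) hdec (Nat.zero_le i)
    exact le_trans this (hc2 k le_rfl)
  have h3 : ∀ l r, IsA k l → IsB a k r →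
      IsA (k+a) (fun i => if i < k then l i + (i+1) else r (i-k)) := by
    rintro l r ⟨hl1, hl2⟩ ⟨hr1, hr2, hr3⟩
    refine ⟨fun i => ?_, fun i hi => ?_⟩
    · simp only
      by_cases h : i + 1 < k
      · have h' : i < k := by omega
        have := hl1 i
        simp only [h, h', if_true]
        nlinarith
      · by_cases h' : i < k
        · have hk : k = i + 1 := by omega
          subst hk
          have := hr2 0
          simp
          nlinarith [Nat.zero_le (l i), Nat.zero_le (l i * i)]
        · simp only [h, h', if_false]
          have e1 := hr1 (i - k)
          have e2 := hr2 (i - k)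
          rw [show i + 1 - k = i - k + 1 by omega]
          nlinarith
    · simp only; rw [if_neg (by omega)]; exact hr3 _ (by omega)
  have h4 : ∀ l r, IsA k l → IsB a k r →
      Cut k (fun i => if i < k then l i + (i+1) else r (i-k)) := by
    rintro l r ⟨hl1, hl2⟩ ⟨hr1, hr2, hr3⟩
    refine ⟨fun i hi => ?_, fun i hi => ?_⟩
    · simp only; rw [if_pos hi]; omega
    · simp only; rw [if_neg (by omega)]; have := hr2 (i-k); omega
  refine gf_equiv
    { toFun := fun l => (⟨_, h1 _ l.1.2 l.2⟩, ⟨_, h2 _ l.1.2 l.2⟩)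
      invFun := fun l => ⟨⟨_, h3 _ _ l.1.2 l.2.2⟩, h4 _ _ l.1.2 l.2.2⟩
      left_inv := ?_
      right_inv := ?_ } _ _ ?_
  · intro l
    refine Subtype.ext (Subtype.ext (funext fun i => ?_))
    simp only
    split_ifs with h
    · have := l.2.1 i h; omega
    · rw [show k + (i - k) = i by omega]
  · intro l
    refine Prod.ext (Subtype.ext (funext fun i => ?_)) (Subtype.ext (funext fun i => ?_))
    · simp only
      split_ifs with h
      · omega
      · exact (l.1.2.2 i (by omega)).symm
    · simp
  · rintro ⟨⟨l, hl1, hl2⟩, hc1, hc2⟩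
    change ∀ i, i < k → i + 1 ≤ l i at hc1
    change ∀ i, k ≤ i → l i ≤ i at hc2
    simp only [Equiv.coe_fn_mk, wB, wA, mk_add, sum_range_add, T]
    have hd : ∀ i ∈ range k, l i = (l i - (i+1)) + (i+1) := fun i hi => by
      have := hc1 i (mem_range.1 hi); omega
    have hq : ∀ i ∈ range k, l i / (i+1) = (l i - (i+1)) / (i+1) + 1 := fun i hi => by
      conv_lhs => rw [hd i hi]
      rw [Nat.add_div_right _ (Nat.succ_pos i)]
    have hz : ∀ i ∈ range a, l (k+i) / (k+i+1) = 0 := fun i hi =>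
      Nat.div_eq_of_lt (by have := hc2 (k+i) (by omega); omega)
    have hif : ∀ g : ℕ → ℕ → ℕ, ∑ i ∈ range k, g i (if i < k then l i - (i+1) else 0)
      = ∑ i ∈ range k, g i (l i - (i+1)) := fun g =>
        sum_congr rfl (fun i hi => by rw [if_pos (mem_range.1 hi)])
    congr 1
    · have e : ∑ i ∈ range k, l i = ∑ i ∈ range k, (l i - (i+1)) + ∑ i ∈ range k, (i+1) := by
        rw [← sum_add_distrib]; exact sum_congr rfl hd
      rw [hif (fun i x => x), e]; ring
    · rw [hif (fun i x => x / (i+1)), sum_congr rfl hq, sum_add_distrib, sum_congr rfl hz]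
      simp; ring
    · rw [hif (fun i x => (x / (i+1) + (p+1)) % 2)]
      have e1 : ∑ i ∈ range k, (l i / (i+1) + p) % 2
          = ∑ i ∈ range k, ((l i - (i+1)) / (i+1) + (p+1)) % 2 :=
        sum_congr rfl (fun i hi => by rw [hq i hi]; congr 1; ring)
      have e2 : ∑ i ∈ range a, (l (k+i) / (k+i+1) + p) % 2 = ∑ i ∈ range a, p % 2 :=
        sum_congr rfl (fun i hi => by rw [hz i hi, zero_add])
      rw [e1, e2]
      simp only [sum_const, card_range, smul_eq_mul, add_zero]
      rw [add_comm]

lemma F_rec (p n : ℕ) : F p n = ∑ x ∈ antidiagonal n,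
    X 0 ^ (T x.1) * X 1 ^ x.1 * X 2 ^ (x.2 * (p % 2)) * (F (p+1) x.1 * b x.2 x.1) := by
  rw [F, gf_fiber (fun l : {l // IsA n l} => wA p n l.1) (finA _ _) (antidiagonal n)
    (fun x l => x ∈ antidiagonal n ∧ Cut x.1 l.1)]
  · refine sum_congr rfl (fun x hx => ?_)
    obtain ⟨k, a⟩ := x
    have hx' := hx
    rw [HasAntidiagonal.mem_antidiagonal] at hx
    simp only at hx
    subst hx
    rw [← piece]
    exact gf_equiv (Equiv.subtypeEquivRight (fun l => by simp)) _ _ (fun l => rfl)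
  · intro l
    obtain ⟨k, hk, hc⟩ := cut_exists n l.1 l.2
    have : (k, n-k) ∈ antidiagonal n := by rw [HasAntidiagonal.mem_antidiagonal]; simp; omega
    exact ⟨(k, n-k), this, this, hc⟩
  · rintro l ⟨i, i'⟩ ⟨j, j'⟩ ⟨h1, h2⟩ ⟨h3, h4⟩
    have := cut_unique _ _ _ h2 h4
    simp only [HasAntidiagonal.mem_antidiagonal] at h1 h3 this
    ext <;> simp only <;> omega

lemma F_zero (p : ℕ) : F p 0 = 1 := by
  have : Unique {l // IsA 0 l} :=
    { default := ⟨fun _ => 0, by simp [IsA]⟩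
      uniq := by
        rintro ⟨l, hl⟩
        ext i
        simpa using hl.2 i (Nat.zero_le _) }
  have h := gf_unique (α := {l // IsA 0 l}) (mk 0 0 0)
  rw [monomial_mk] at h
  simpa [F, wA] using h

lemma refined_eq (n : ℕ) : refinedAgf n = F 0 n := by
  ext d
  rw [F, coeff_gf]
  change ((Nat.card _ : ℕ) : ℤ) = _
  congr 1
  have key : ∀ l : ℕ → ℕ, wA 0 n l = d ↔ (∑ i : Fin n, l i) = d 0 ∧
      (∑ i : Fin n, l i / ((i : ℕ) + 1)) = d 1 ∧
      (Finset.univ.filter fun i : Fin n => Odd (l i / ((i : ℕ) + 1))).card = d 2 := by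
    intro l
    rw [wA, mk_eq_iff]
    rw [Finset.sum_range, Finset.sum_range, Finset.sum_range, Finset.card_filter]
    have : ∀ m : ℕ, (m + 0) % 2 = if Odd m then 1 else 0 := by
      intro m; split_ifs with h
      · rw [Nat.odd_iff] at h; omega
      · rw [Nat.odd_iff] at h; omega
    simp only [this]
  have h1 : ∀ l : Fin n → ℕ, IsAntiLectureHall n l →
      IsA n (fun i => if h : i < n then l ⟨i, h⟩ else 0) := by
    intro l hl
    refine ⟨fun i => ?_, fun i hi => ?_⟩
    · by_cases h : i + 1 < n
      · have h' : i < n := by omega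
        simp only [h, h', dif_pos]
        exact hl ⟨i, h'⟩ ⟨i+1, h⟩ rfl
      · simp [h]
    · simp only; rw [dif_neg (by omega)]
  refine Nat.card_congr
    { toFun := fun l => ⟨⟨_, h1 _ l.2.1⟩, (key _).2 (by simpa using l.2.2)⟩
      invFun := fun l => ⟨fun i => l.1.1 i, fun i j hij => by
        have := l.1.2.1 i
        simp only [hij]
        exact this, (key _).1 l.2⟩
      left_inv := ?_
      right_inv := ?_ }
  · intro l; ext i; simp
  · intro l
    refine Subtype.ext (Subtype.ext (funext fun i => ?_))
    simp only
    split_ifs with h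
    · rfl
    · exact (l.1.2.2 i (by omega)).symm

/-! ### algebra -/

noncomputable def qf (n : ℕ) : R := ∏ i ∈ range n, (1 - X 0 ^ (i+1))

lemma one_sub_ne {x : R} (hx : MvPowerSeries.constantCoeff x = 0) : (1 - x : R) ≠ 0 := by
  intro h
  have := congrArg (MvPowerSeries.constantCoeff (σ := Fin 3) (R := ℤ)) h
  simp [hx] at this

lemma qf_ne (n : ℕ) : qf n ≠ 0 := by
  rw [qf, Finset.prod_ne_zero_iff]
  intro i _
  exact one_sub_ne (by simp)

lemma qf_succ (n : ℕ) : qf (n+1) = qf n * (1 - X 0 ^ (n+1)) := prod_range_succ _ _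

lemma b_qf (a k : ℕ) : qf a * qf k * b a k = qf (a+k) := by
  induction a generalizing k with
  | zero => simp [b_zero_left, qf]
  | succ a iha =>
    induction k with
    | zero => simp [b_zero_right, qf]
    | succ k ihk =>
      have h1 := iha (k+1)
      rw [b_rec, show a + 1 + (k+1) = (a + k + 1) + 1 by ring, qf_succ (a+k+1)]
      rw [show a + (k+1) = a + k + 1 by ring] at h1
      rw [show a + 1 + k = a + k + 1 by ring] at ihk
      have e1 := qf_succ a
      have e2 := qf_succ k
      calc _ = (1 - X 0 ^ (a+1)) * (qf a * qf (k+1) * b a (k+1))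
            + X 0 ^ (a+1) * (1 - X 0 ^ (k+1)) * (qf (a+1) * qf k * b (a+1) k) := by
              rw [e1, e2]; ring
        _ = _ := by rw [h1, ihk]; ring

lemma b_comm (a k : ℕ) : b a k = b k a := by
  have h1 := b_qf a k
  have h2 := b_qf k a
  rw [add_comm k a, ← h1] at h2
  have h3 : qf a * qf k ≠ 0 := mul_ne_zero (qf_ne _) (qf_ne _)
  apply mul_left_cancel₀ h3
  rw [← h2]; ring

lemma b_tri (a c j : ℕ) : b a (j+c) * b c j = b (c+a) j * b a c := by
  have h1 := b_qf a (j+c)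
  have h2 := b_qf c j
  have h3 := b_qf (c+a) j
  have h4 := b_qf a c
  rw [add_comm c j] at h2
  rw [add_comm a c] at h4
  rw [show a + (j+c) = c + a + j by ring] at h1
  have h5 : qf a * qf c * qf j ≠ 0 := mul_ne_zero (mul_ne_zero (qf_ne _) (qf_ne _)) (qf_ne _)
  apply mul_left_cancel₀ h5
  calc _ = qf a * (qf c * qf j * b c j) * b a (j+c) := by ring
    _ = qf (c+a+j) := by rw [h2, h1]
    _ = (qf a * qf c * b a c) * qf j * b (c+a) j := by rw [h4, h3]
    _ = _ := by ring

lemma sum_pascal (n : ℕ) (f : ℕ → ℕ → R) :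
    ∑ x ∈ antidiagonal (n+1), b x.1 x.2 * f x.1 x.2 =
    ∑ x ∈ antidiagonal n, b x.1 x.2 * (f (x.1+1) x.2 + X 0 ^ x.1 * f x.1 (x.2+1)) := by
  cases n with
  | zero => simp [Finset.Nat.sum_antidiagonal_succ, b_zero_left, b_zero_right]; ring
  | succ n =>
    rw [Finset.Nat.sum_antidiagonal_succ, Finset.Nat.sum_antidiagonal_succ']
    simp only [mul_add, sum_add_distrib]
    rw [Finset.Nat.sum_antidiagonal_succ' (n := n), Finset.Nat.sum_antidiagonal_succ (n := n)]
    simp only [b_rec, add_mul, sum_add_distrib, b_zero_left, b_zero_right]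
    have : ∀ x : ℕ × ℕ, b (x.1+1) x.2 * (X 0 ^ (x.1+1) * f (x.1+1) (x.2+1)) =
      X 0 ^ (x.1+1) * b (x.1+1) x.2 * f (x.1+1) (x.2+1) := fun x => by ring
    simp only [this]
    ring

lemma T_succ (n : ℕ) : T (n+1) = T n + (n+1) := sum_range_succ _ _

lemma T_two (n : ℕ) : T n + T n = n + n^2 := by
  induction n with
  | zero => simp [T]
  | succ n ih => rw [T_succ]; linarith [ih, show (n+1)^2 = n^2+2*n+1 by ring]

lemma T_add (j c : ℕ) : T (j+c) = T j + T c + j * c := by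
  induction c with
  | zero => simp [T]
  | succ c ih => rw [← add_assoc, T_succ, T_succ, ih]; ring

lemma qbin (m : ℕ) (x : R) : ∑ y ∈ antidiagonal m, b y.1 y.2 * (X 0 ^ (T y.2) * x ^ y.2) =
    ∏ i ∈ range m, (1 + x * X 0 ^ (i+1)) := by
  induction m with
  | zero => simp [b_zero_left, T]
  | succ m ih =>
    rw [sum_pascal m (fun _ k => X 0 ^ (T k) * x ^ k), prod_range_succ, ← ih, sum_mul]
    refine sum_congr rfl (fun y hy => ?_)
    rw [HasAntidiagonal.mem_antidiagonal] at hy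
    rw [T_succ, ← hy]
    ring

lemma durfee (n : ℕ) (z : R) : ∑ y ∈ antidiagonal n, b y.1 y.2 *
    (z ^ y.2 * X 0 ^ (y.2^2) * ∏ i ∈ range y.1, (1 - z * X 0 ^ (y.2 + i + 1))) = 1 := by
  induction n generalizing z with
  | zero => simp [b_zero_left]
  | succ n ih =>
    rw [sum_pascal n (fun a j => z ^ j * X 0 ^ (j^2) * ∏ i ∈ range a, (1 - z * X 0 ^ (j + i + 1)))]
    have h1 := ih z
    have h2 := ih (z * X 0)
    have h3 : ∀ A B : R, A = 1 → B = 1 → (1 - z * X 0 ^ (n+1)) * A + z * X 0 ^ (n+1) * B = 1 := by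
      rintro A B rfl rfl; ring
    refine Eq.trans ?_ (h3 _ _ h1 h2)
    rw [mul_sum, mul_sum, ← sum_add_distrib]
    refine sum_congr rfl (fun y hy => ?_)
    obtain ⟨a, j⟩ := y
    rw [HasAntidiagonal.mem_antidiagonal] at hy
    simp only at hy ⊢
    subst hy
    rw [prod_range_succ]
    have e : ∏ i ∈ range a, (1 - z * X 0 ^ (j + 1 + i + 1))
        = ∏ i ∈ range a, (1 - z * X 0 * X 0 ^ (j + i + 1)) :=
      prod_congr rfl (fun i _ => by ring)
    rw [e]
    generalize ∏ i ∈ range a, (1 - z * X 0 * X 0 ^ (j + i + 1)) = P1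
    generalize ∏ i ∈ range a, (1 - z * X 0 ^ (j + i + 1)) = P2
    ring

lemma triple (n : ℕ) (f : ℕ → ℕ → ℕ → R) :
    ∑ x ∈ antidiagonal n, ∑ y ∈ antidiagonal x.1, f y.1 y.2 x.2 =
    ∑ x ∈ antidiagonal n, ∑ y ∈ antidiagonal x.2, f x.1 y.1 y.2 := by
  rw [sum_sigma', sum_sigma']
  refine sum_nbij' (fun x => ⟨(x.2.1, x.2.2 + x.1.2), (x.2.2, x.1.2)⟩)
    (fun x => ⟨(x.1.1 + x.2.1, x.2.2), (x.1.1, x.2.1)⟩) ?_ ?_ ?_ ?_ ?_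
  · rintro ⟨⟨a, b⟩, ⟨c, d⟩⟩ h
    simp only [mem_sigma, HasAntidiagonal.mem_antidiagonal] at h ⊢
    exact ⟨by omega, by trivial⟩
  · rintro ⟨⟨a, b⟩, ⟨c, d⟩⟩ h
    simp only [mem_sigma, HasAntidiagonal.mem_antidiagonal] at h ⊢
    exact ⟨by omega, by trivial⟩
  · rintro ⟨⟨a, b⟩, ⟨c, d⟩⟩ h
    simp only [mem_sigma, HasAntidiagonal.mem_antidiagonal] at h ⊢
    obtain ⟨h1, rfl⟩ := h
    rfl
  · rintro ⟨⟨a, b⟩, ⟨c, d⟩⟩ h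
    simp only [mem_sigma, HasAntidiagonal.mem_antidiagonal] at h ⊢
    obtain ⟨h1, rfl⟩ := h
    rfl
  · rintro ⟨⟨a, b⟩, ⟨c, d⟩⟩ h
    rfl

noncomputable def N (n : ℕ) : R := ∏ i ∈ range n, (1 + X 1 * X 2 * X 0 ^ (i+1))
noncomputable def D (n : ℕ) : R := ∏ i ∈ range n, (1 - X 1 ^ 2 * X 0 ^ (i+2))
noncomputable def Nt (j m : ℕ) : R := ∏ i ∈ range m, (1 + X 1 * X 2 * X 0 ^ (j+i+1))
noncomputable def Dt (j m : ℕ) : R := ∏ i ∈ range m, (1 - X 1 ^ 2 * X 0 ^ (j+i+2))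

lemma N_add (j m : ℕ) : N (j+m) = N j * Nt j m := prod_range_add _ _ _
lemma D_add (j m : ℕ) : D (j+m) = D j * Dt j m := prod_range_add _ _ _

lemma F_two (n : ℕ) : F 0 n = ∑ x ∈ antidiagonal n,
    F 0 x.1 * (b x.2 x.1 * ((X 1 ^ 2 * X 0) ^ x.1 * X 0 ^ (x.1 ^ 2)) * Nt x.1 x.2) := by
  rw [F_rec]
  have h : ∀ k, F (0+1) k = ∑ x ∈ antidiagonal k,
      X 0 ^ (T x.1) * X 1 ^ x.1 * X 2 ^ x.2 * (F 0 x.1 * b x.2 x.1) := fun k => by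
    rw [F_rec]
    simp only [show 0 + 1 + 1 = 0 + 2 from rfl, F_add_two]
    simp
  simp only [h, sum_mul, mul_sum]
  let f : ℕ → ℕ → ℕ → R := fun j c a => X 0 ^ T (j+c) * X 1 ^ (j+c) *
      (X 0 ^ T j * X 1 ^ j * X 2 ^ c * (F 0 j * b c j) * b a (j+c))
  have e : ∀ x ∈ antidiagonal n, ∀ y ∈ antidiagonal x.1,
     X 0 ^ T x.1 * X 1 ^ x.1 * X 2 ^ (x.2 * (0 % 2)) *
      (X 0 ^ T y.1 * X 1 ^ y.1 * X 2 ^ y.2 * (F 0 y.1 * b y.2 y.1) * b x.2 x.1)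
     = f y.1 y.2 x.2 := by
    intro x hx y hy
    rw [HasAntidiagonal.mem_antidiagonal] at hy
    rw [← hy]; simp [f]
  rw [sum_congr rfl (fun x hx => sum_congr rfl (e x hx)),
    triple n f]
  refine sum_congr rfl (fun x hx => ?_)
  obtain ⟨j, m⟩ := x
  have hN : Nt j m = ∑ y ∈ antidiagonal m, b y.2 y.1 * (X 0 ^ (T y.1) * (X 1 * X 2 * X 0 ^ j) ^ y.1) := by
    rw [← Finset.Nat.sum_antidiagonal_swap]
    simp only [Prod.fst_swap, Prod.snd_swap]
    rw [qbin, Nt]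
    exact prod_congr rfl (fun i _ => by ring)
  rw [hN, mul_sum, mul_sum]
  refine sum_congr rfl (fun y hy => ?_)
  obtain ⟨c, a⟩ := y
  rw [HasAntidiagonal.mem_antidiagonal] at hy
  simp only at hy ⊢
  subst hy
  have h1 := b_tri a c j
  have h2 : (X 0 : R) ^ T j * X 0 ^ T j = X 0 ^ j * X 0 ^ (j^2) := by
    rw [← pow_add, T_two, pow_add]
  simp only [f]
  calc _ = (b a (j+c) * b c j) * (X 0 ^ T j * X 0 ^ T j) * X 0 ^ T c * X 0 ^ (j*c) *
        X 1 ^ (2*j) * X 1 ^ c * X 2 ^ c * F 0 j := by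
        rw [T_add]; ring
    _ = _ := by rw [h1, h2]; ring

lemma main (n : ℕ) : F 0 n * D n = N n := by
  induction n using Nat.strong_induction_on with
  | _ n ih =>
    rcases Nat.eq_zero_or_pos n with h0 | hpos
    · subst h0; simp [F_zero, D, N]
    have h1 : N n = ∑ x ∈ antidiagonal n, N x.1 * (b x.2 x.1 *
        ((X 1 ^ 2 * X 0) ^ x.1 * X 0 ^ (x.1 ^ 2)) * Nt x.1 x.2) * Dt x.1 x.2 := by
      have := durfee n (X 1 ^ 2 * X 0)
      rw [← Finset.Nat.sum_antidiagonal_swap] at this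
      simp only [Prod.fst_swap, Prod.snd_swap] at this
      conv_lhs => rw [← mul_one (N n), ← this, mul_sum]
      refine sum_congr rfl (fun x hx => ?_)
      rw [HasAntidiagonal.mem_antidiagonal] at hx
      have hD : Dt x.1 x.2 = ∏ i ∈ range x.2, (1 - X 1 ^ 2 * X 0 * X 0 ^ (x.1 + i + 1)) :=
        prod_congr rfl (fun i _ => by ring)
      rw [← hD, ← hx, N_add]; ring
    have h2 : F 0 n * D n = ∑ x ∈ antidiagonal n, (F 0 x.1 * D x.1) * (b x.2 x.1 *
        ((X 1 ^ 2 * X 0) ^ x.1 * X 0 ^ (x.1 ^ 2)) * Nt x.1 x.2) * Dt x.1 x.2 := by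
      rw [F_two n, sum_mul]
      refine sum_congr rfl (fun x hx => ?_)
      rw [HasAntidiagonal.mem_antidiagonal] at hx
      rw [← hx, D_add]; ring
    have h3 : F 0 n * D n - N n = (F 0 n * D n - N n) * ((X 1 ^ 2 * X 0) ^ n * X 0 ^ (n^2)) := by
      conv_lhs => rw [h1, h2, ← sum_sub_distrib]
      rw [Finset.sum_eq_single (n, 0)]
      · simp [b_zero_left, Nt, Dt]; ring
      · rintro ⟨j, m⟩ hx hne
        rw [HasAntidiagonal.mem_antidiagonal] at hx
        simp only at hx
        have : m ≠ 0 := by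
          rintro rfl
          exact hne (by simp at hx; rw [hx])
        simp only
        rw [ih j (by omega)]; ring
      · intro h; exact absurd (by simp) h
    have h4 : (1 - (X 1 ^ 2 * X 0) ^ n * X 0 ^ (n^2) : R) ≠ 0 := one_sub_ne (by
      simp; omega)
    have h5 : (F 0 n * D n - N n) * (1 - (X 1 ^ 2 * X 0) ^ n * X 0 ^ (n^2) : R) = 0 := by
      linear_combination h3
    exact sub_eq_zero.1 ((mul_eq_zero.1 h5).resolve_right h4)

end ALH

/-- **The refined anti-lecture hall theorem** (Corteel–Savage): in `ℤ[[q,u,v]]`,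
`(∑_{λ ∈ A_n} q^{|λ|} u^{|⌊λ⌋|} v^{o(⌊λ⌋)}) ⬝ ∏_{i=1}^n (1 - u² q^{i+1})
  = ∏_{i=1}^n (1 + u v q^i)`. -/
theorem refined_anti_lecture_hall_theorem (n : ℕ) (hn : 0 < n) :
    refinedAgf n * ∏ i ∈ Finset.range n,
        (1 - (X 1 : MvPowerSeries (Fin 3) ℤ) ^ 2 * X 0 ^ (i + 2)) =
    ∏ i ∈ Finset.range n,
        (1 + (X 1 : MvPowerSeries (Fin 3) ℤ) * X 2 * X 0 ^ (i + 1)) := by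
  rw [ALH.refined_eq]; exact ALH.main n
end

section
/- For all integers n ≥ 1, t ≥ 0, and 0 ≤ i < n, the number of lecture hall partitions λ ∈ L_n with λ_n ≤ tn + i equals (t+1)^{n−i} (t+2)^{i}. -/
/-- the box-bounded lecture hall condition -/
def LHBox (n m : ℕ) (lam : Fin n → ℕ) : Prop :=
  IsLectureHall n lam ∧ ∀ j : Fin n, (j : ℕ) = n - 1 → lam j ≤ m

def lhCount : ℕ → ℕ → ℕ
  | 0, _ => 1
  | n + 1, m => ∑ k : Fin (m + 1), lhCount n (k * n / (n + 1))

theorem lhBox_snoc (n m k : ℕ) (mu : Fin n → ℕ) :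
    LHBox (n + 1) m (Fin.snoc (α := fun _ => ℕ) mu k) ↔
      k ≤ m ∧ LHBox n (k * n / (n + 1)) mu := by
  constructor
  · rintro ⟨h1, h2⟩
    refine ⟨by simpa using h2 (Fin.last n) (by simp), ?_, ?_⟩
    · intro i j hij
      simpa using h1 i.castSucc j.castSucc (by simpa using hij)
    · intro j hj
      have hjn := j.2
      have h := h1 j.castSucc (Fin.last n) (by simp; omega)
      simp only [Fin.snoc_castSucc, Fin.snoc_last, Fin.val_last, Fin.val_castSucc] at h
      rw [Nat.le_div_iff_mul_le (by omega)]
      have : (j : ℕ) + 1 = n := by omega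
      rwa [this] at h
  · rintro ⟨h0, h1, h2⟩
    refine ⟨?_, ?_⟩
    · intro i j hij
      induction j using Fin.lastCases with
      | last =>
        induction i using Fin.lastCases with
        | last => simp at hij
        | cast i =>
          simp only [Fin.val_last, Fin.val_castSucc] at hij
          have h := h2 i (by omega)
          rw [Nat.le_div_iff_mul_le (by omega)] at h
          simpa [← hij] using h
      | cast j =>
        induction i using Fin.lastCases with
        | last => simp at hij; omega
        | cast i => simpa using h1 i j (by simpa using hij)
    · intro j hj
      have : j = Fin.last n := Fin.ext (by simpa using hj)
      subst this
      simpa using h0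

theorem lhBox_card (n : ℕ) : ∀ m, Finite {lam : Fin n → ℕ // LHBox n m lam} ∧
    Nat.card {lam : Fin n → ℕ // LHBox n m lam} = lhCount n m := by
  induction n with
  | zero =>
    intro m
    refine ⟨inferInstance, ?_⟩
    rw [lhCount, Nat.card_eq_one_iff_unique]
    exact ⟨inferInstance, ⟨⟨fun _ => 0, fun i => i.elim0, fun i => i.elim0⟩⟩⟩
  | succ n ih =>
    intro m
    let F : (Σ k : Fin (m + 1), {mu : Fin n → ℕ // LHBox n (k * n / (n + 1)) mu}) →
        {lam : Fin (n + 1) → ℕ // LHBox (n + 1) m lam} := fun p =>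
      ⟨Fin.snoc (α := fun _ => ℕ) p.2.1 p.1.1,
        (lhBox_snoc n m _ _).2 ⟨Nat.lt_succ_iff.1 p.1.2, p.2.2⟩⟩
    have hF : Function.Bijective F := by
      constructor
      · rintro ⟨k, mu, hmu⟩ ⟨k', mu', hmu'⟩ h
        have h := congrArg Subtype.val h
        simp only [F] at h
        obtain ⟨h1, h2⟩ := Fin.snoc_injective2 h
        have := Fin.ext h2
        subst this
        subst h1
        rfl
      · rintro ⟨lam, hl⟩
        have hs : Fin.snoc (α := fun _ => ℕ) (Fin.init lam) (lam (Fin.last n)) = lam :=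
          Fin.snoc_init_self lam
        have hl' := hl
        rw [← hs, lhBox_snoc] at hl'
        exact ⟨⟨⟨lam (Fin.last n), Nat.lt_succ_iff.2 hl'.1⟩, ⟨Fin.init lam, hl'.2⟩⟩,
          Subtype.ext hs⟩
    have := fun m => (ih m).1
    refine ⟨Finite.of_surjective F hF.2, ?_⟩
    rw [← Nat.card_congr (Equiv.ofBijective F hF), Nat.card_sigma, lhCount]
    exact Finset.sum_congr rfl fun k _ => (ih _).2

theorem lhCount_succ (n m : ℕ) :
    lhCount (n + 1) (m + 1) = lhCount (n + 1) m + lhCount n ((m + 1) * n / (n + 1)) := by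
  rw [lhCount, Fin.sum_univ_castSucc, lhCount]
  simp

theorem lhCount_eq (n : ℕ) : ∀ t i, i ≤ n →
    lhCount n (t * n + i) = (t + 1) ^ (n - i) * (t + 2) ^ i := by
  induction n with
  | zero => intro t i hi; obtain rfl : i = 0 := by omega
            simp [lhCount]
  | succ n ih =>
    have step : ∀ t, lhCount (n + 1) (t * (n + 1)) = (t + 1) ^ (n + 1) → ∀ i, i ≤ n + 1 →
        lhCount (n + 1) (t * (n + 1) + i) = (t + 1) ^ (n + 1 - i) * (t + 2) ^ i := by
      intro t h0 i
      induction i with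
      | zero => intro _; simpa using h0
      | succ i ihi =>
        intro hi
        have hd : (t * (n + 1) + i + 1) * n / (n + 1) = t * n + i := by
          rw [Nat.div_eq_iff (by omega)]
          obtain ⟨d, rfl⟩ : ∃ d, n = i + d := ⟨n - i, by omega⟩
          constructor
          · nlinarith
          · have : (t * (i + d + 1) + i + 1) * (i + d) + i + 1 =
                (t * (i + d) + i) * (i + d + 1) + (i + d) + 1 := by ring
            omega
        rw [← add_assoc, lhCount_succ, ihi (by omega), hd, ih t i (by omega)]
        have e1 : n + 1 - i = (n - i) + 1 := by omega
        have e2 : n + 1 - (i + 1) = n - i := by omega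
        rw [e1, e2]
        ring
    intro t
    apply step
    induction t with
    | zero =>
      have := ih 0 0 (by omega)
      simp at this
      rw [zero_mul, lhCount, Fin.sum_univ_succ]
      simp [this]
    | succ t iht =>
      have := step t iht (n + 1) le_rfl
      rw [add_mul, one_mul, this]
      simp

/-- **Corteel–Lee–Savage**: the number of lecture hall partitions `λ ∈ L_n` with
last part `λ_n ≤ tn + i` is `(t+1)^{n-i} (t+2)^i`, for `0 ≤ i < n`. -/
theorem lecture_hall_box (n t i : ℕ) (hn : 1 ≤ n) (hi : i < n) :
    Nat.card {lam : Fin n → ℕ // IsLectureHall n lam ∧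
        ∀ j : Fin n, (j : ℕ) = n - 1 → lam j ≤ t * n + i} =
    (t + 1) ^ (n - i) * (t + 2) ^ i := by
  rw [← lhCount_eq n t i hi.le]
  exact (lhBox_card n (t * n + i)).2
end

section
/- For every sequence s = (s_1,…,s_n) of positive integers and every integer t ≥ 0, the number of λ ∈ L_n^{(s_1,…,s_n)} with λ_n ≤ t·s_n equals the number of λ ∈ L_n^{(s_n,…,s_1)} with λ_n ≤ t·s_1. -/
/-- `lam` (0-based) is an `s`-lecture hall partition in `L_n^{(s)}`:
`0 ≤ lam₁/s₁ ≤ lam₂/s₂ ≤ ⋯ ≤ lam_n/s_n`. -/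
def IsSLectureHall (n : ℕ) (s : Fin n → ℕ) (lam : Fin n → ℕ) : Prop :=
  ∀ i j : Fin n, (j : ℕ) = (i : ℕ) + 1 → lam i * s j ≤ lam j * s i

theorem slh_bound (n : ℕ) (s : Fin n → ℕ) (hs : ∀ i, 0 < s i) (t : ℕ) (lam : Fin n → ℕ)
    (h : IsSLectureHall n s lam) (hl : ∀ j : Fin n, (j : ℕ) = n - 1 → lam j ≤ t * s j) :
    ∀ i, lam i ≤ t * s i := by
  have key : ∀ k : ℕ, ∀ i : Fin n, (i : ℕ) + k = n - 1 → lam i ≤ t * s i := by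
    intro k
    induction k with
    | zero => intro i hi; exact hl i (by omega)
    | succ k ih =>
      intro i hi
      have hj : (i : ℕ) + 1 < n := by omega
      have h1 := h i ⟨i + 1, hj⟩ rfl
      have h2 := ih ⟨i + 1, hj⟩ (by simp only; omega)
      have h3 := hs ⟨i + 1, hj⟩
      refine Nat.le_of_mul_le_mul_right ?_ h3
      calc _ ≤ _ := h1
        _ ≤ _ := Nat.mul_le_mul_right _ h2
        _ = _ := by ring
  intro i
  exact key (n - 1 - i) i (by have := i.isLt; omega)

theorem slh_flip (n : ℕ) (s : Fin n → ℕ) (hs : ∀ i, 0 < s i) (t : ℕ) (lam : Fin n → ℕ)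
    (h : IsSLectureHall n s lam) (hl : ∀ j : Fin n, (j : ℕ) = n - 1 → lam j ≤ t * s j) :
    IsSLectureHall n (fun i => s i.rev) (fun i => t * s i.rev - lam i.rev) ∧
      ∀ j : Fin n, (j : ℕ) = n - 1 → t * s j.rev - lam j.rev ≤ t * s j.rev := by
  refine ⟨?_, fun j _ => Nat.sub_le _ _⟩
  intro i j hij
  have h1 := h j.rev i.rev (by simp only [Fin.val_rev]; have := j.isLt; omega)
  simp only [Nat.sub_mul]
  have e : t * s i.rev * s j.rev = t * s j.rev * s i.rev := by ring
  omega

/-- **Corteel–Lee–Savage**: for any sequence `s` of positive integers, the number of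
`λ ∈ L_n^{(s₁,…,s_n)}` with `λ_n ≤ t·s_n` equals the number of
`λ ∈ L_n^{(s_n,…,s₁)}` with `λ_n ≤ t·s₁`. -/
theorem reverse_sequence_count (n : ℕ) (hn : 0 < n) (s : Fin n → ℕ)
    (hs : ∀ i, 0 < s i) (t : ℕ) :
    Nat.card {lam : Fin n → ℕ // IsSLectureHall n s lam ∧
        ∀ j : Fin n, (j : ℕ) = n - 1 → lam j ≤ t * s j} =
    Nat.card {lam : Fin n → ℕ // IsSLectureHall n (fun i => s i.rev) lam ∧
        ∀ j : Fin n, (j : ℕ) = n - 1 → lam j ≤ t * s j.rev} := by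
  have hs' : ∀ i : Fin n, 0 < s i.rev := fun i => hs _
  refine Nat.card_congr
    { toFun := fun l => ⟨fun i => t * s i.rev - l.1 i.rev, slh_flip n s hs t l.1 l.2.1 l.2.2⟩
      invFun := fun l => ⟨fun i => t * s i - l.1 i.rev, by
        have := slh_flip n (fun i => s i.rev) hs' t l.1 l.2.1 l.2.2
        simpa only [Fin.rev_rev] using this⟩
      left_inv := ?_
      right_inv := ?_ }
  · intro l
    apply Subtype.ext
    funext i
    have := slh_bound n s hs t l.1 l.2.1 l.2.2 i
    simp only [Fin.rev_rev]
    omega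
  · intro l
    apply Subtype.ext
    funext i
    have := slh_bound n (fun i => s i.rev) hs' t l.1 l.2.1 l.2.2 i
    simp only [Fin.rev_rev] at this ⊢
    omega
end

section
/- For all integers n ≥ 1, t ≥ 0, and 0 ≤ i < n, the following identity holds in the polynomial ring ℤ[u]: ∑_{λ ∈ L_n, λ_n ≤ tn+i} u^{|⌈λ⌉|} = ([t+1]_u)^{n−i} · ([t+2]_u)^{i}. -/
open Polynomial

def lhT : (n : ℕ) → ℕ → Finset (Fin n → ℕ)
  | 0, _ => {Fin.elim0}
  | n + 1, m => (Finset.range (m + 1)).biUnion fun k =>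
      (lhT n (k * n / (n + 1))).image fun l => (Fin.snoc l k : Fin (n + 1) → ℕ)

noncomputable def lhG : ℕ → ℕ → ℤ[X]
  | 0, _ => 1
  | n + 1, m => ∑ k ∈ Finset.range (m + 1), X ^ cdiv k (n + 1) * lhG n (k * n / (n + 1))

theorem lh_succ (n : ℕ) (l : Fin n → ℕ) (k : ℕ) :
    IsLectureHall (n + 1) (Fin.snoc l k : Fin (n + 1) → ℕ) ↔
      IsLectureHall n l ∧ ∀ j : Fin n, (j : ℕ) = n - 1 → l j ≤ k * n / (n + 1) := by
  constructor
  · intro h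
    refine ⟨fun i j hij => ?_, fun j hj => ?_⟩
    · have := h i.castSucc j.castSucc (by simpa using hij)
      simpa using this
    · have h1 : (j : ℕ) + 1 = n := by have := j.2; omega
      have := h j.castSucc (Fin.last n) (by simp [h1])
      simp [h1] at this
      exact (Nat.le_div_iff_mul_le (by omega)).2 this
  · rintro ⟨h1, h2⟩ i j hij
    induction j using Fin.lastCases with
    | last =>
      induction i using Fin.lastCases with
      | last => simp at hij
      | cast i =>
        simp at hij
        have := (Nat.le_div_iff_mul_le (by omega)).1 (h2 i (by omega))
        simpa [← hij] using this
    | cast j =>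
      induction i using Fin.lastCases with
      | last => simp at hij; omega
      | cast i => simpa using h1 i j (by simpa using hij)

theorem lh_mem (n : ℕ) : ∀ (m : ℕ) (l : Fin n → ℕ), l ∈ lhT n m ↔
    IsLectureHall n l ∧ ∀ j : Fin n, (j : ℕ) = n - 1 → l j ≤ m := by
  induction n with
  | zero =>
    intro m l
    simp only [lhT, Finset.mem_singleton]
    exact ⟨fun _ => ⟨fun i => i.elim0, fun i => i.elim0⟩, fun _ => Subsingleton.elim _ _⟩
  | succ n ih =>
    intro m l
    simp only [lhT, Finset.mem_biUnion, Finset.mem_image, Finset.mem_range]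
    constructor
    · rintro ⟨k, hk, a, ha, rfl⟩
      refine ⟨(lh_succ n a k).2 ((ih _ _).1 ha), fun j hj => ?_⟩
      have : j = Fin.last n := Fin.ext (by simpa using hj)
      subst this
      simp; omega
    · rintro ⟨h1, h2⟩
      refine ⟨l (Fin.last n), Nat.lt_succ_of_le (h2 _ (by simp)), Fin.init l, ?_,
        Fin.snoc_init_self l⟩
      rw [ih, ← lh_succ, Fin.snoc_init_self]
      exact h1

theorem lh_sum (n : ℕ) : ∀ m : ℕ,
    ∑ l ∈ lhT n m, (X : ℤ[X]) ^ (∑ k : Fin n, cdiv (l k) ((k : ℕ) + 1)) = lhG n m := by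
  induction n with
  | zero => intro m; simp [lhT, lhG]
  | succ n ih =>
    intro m
    rw [lhT, lhG, Finset.sum_biUnion]
    · refine Finset.sum_congr rfl fun k _ => ?_
      rw [Finset.sum_image]
      · rw [← ih, Finset.mul_sum]
        refine Finset.sum_congr rfl fun l _ => ?_
        rw [Fin.sum_univ_castSucc, pow_add, mul_comm]
        simp
      · intro a _ b _ hab
        have := congrArg Fin.init hab
        simpa using this
    · intro a _ b _ hab
      rw [Function.onFun, Finset.disjoint_left]
      intro l h1 h2
      simp only [Finset.mem_image] at h1 h2
      obtain ⟨x, _, rfl⟩ := h1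
      obtain ⟨y, _, h⟩ := h2
      have := congrFun h (Fin.last n)
      simp at this
      exact hab this.symm

theorem lh_formula (n : ℕ) : ∀ t i : ℕ, i ≤ n → lhG n (t * n + i) =
    (∑ j ∈ Finset.range (t + 1), (X : ℤ[X]) ^ j) ^ (n - i) *
      (∑ j ∈ Finset.range (t + 2), (X : ℤ[X]) ^ j) ^ i := by
  induction n with
  | zero => intro t i hi; obtain rfl : i = 0 := by omega
            simp [lhG]
  | succ n ih =>
    have key : ∀ t, lhG (n + 1) (t * (n + 1)) =
        (∑ j ∈ Finset.range (t + 1), (X : ℤ[X]) ^ j) ^ (n + 1) →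
        ∀ i, i ≤ n + 1 → lhG (n + 1) (t * (n + 1) + i) =
    (∑ j ∈ Finset.range (t + 1), (X : ℤ[X]) ^ j) ^ (n + 1 - i) *
      (∑ j ∈ Finset.range (t + 2), (X : ℤ[X]) ^ j) ^ i := by
      intro t h0 i
      induction i with
      | zero => intro _; simpa using h0
      | succ i ihi =>
        intro hi
        have h1 := ihi (by omega)
        have e1 : (t * (n + 1) + (i + 1)) * n / (n + 1) = t * n + i := by
          apply Nat.div_eq_of_lt_le
          · nlinarith
          · nlinarith
        have e2 : cdiv (t * (n + 1) + (i + 1)) (n + 1) = t + 1 := by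
          unfold cdiv
          apply Nat.div_eq_of_lt_le
          · rw [Nat.le_sub_iff_add_le (by omega)]; nlinarith
          · rw [Nat.sub_lt_iff_lt_add (by omega)]; nlinarith
        have hs : lhG (n + 1) (t * (n + 1) + (i + 1)) = lhG (n + 1) (t * (n + 1) + i) +
            X ^ (t + 1) * lhG n (t * n + i) := by
          rw [lhG, Finset.sum_range_succ, e1, e2, lhG, add_assoc]
        rw [hs, h1, ih t i (by omega)]
        obtain ⟨d, rfl⟩ : ∃ d, n = i + d := ⟨n - i, by omega⟩
        have a1 : i + d + 1 - i = d + 1 := by omega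
        have a2 : i + d - i = d := by omega
        have a3 : i + d + 1 - (i + 1) = d := by omega
        rw [a1, a2, a3, Finset.sum_range_succ _ (t + 1)]
        ring
    have z : ∀ t, lhG (n + 1) (t * (n + 1)) =
        (∑ j ∈ Finset.range (t + 1), (X : ℤ[X]) ^ j) ^ (n + 1) := by
      intro t
      induction t with
      | zero =>
        have := ih 0 0 (by omega)
        simp at this
        simp [lhG, cdiv, this, Nat.div_eq_of_lt (Nat.lt_succ_self n)]
      | succ t iht =>
        have := key t iht (n + 1) le_rfl
        rw [add_mul, one_mul, this]
        simp
    exact fun t => key t (z t)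

theorem lecture_hall_box_u_analog (n t i : ℕ) (hn : 1 ≤ n) (hi : i < n) :
    (∑ᶠ lam ∈ {lam : Fin n → ℕ | IsLectureHall n lam ∧
        ∀ j : Fin n, (j : ℕ) = n - 1 → lam j ≤ t * n + i},
      (X : ℤ[X]) ^ (∑ k : Fin n, cdiv (lam k) ((k : ℕ) + 1))) =
    (∑ j ∈ Finset.range (t + 1), (X : ℤ[X]) ^ j) ^ (n - i) *
      (∑ j ∈ Finset.range (t + 2), (X : ℤ[X]) ^ j) ^ i := by
  have hS : {lam : Fin n → ℕ | IsLectureHall n lam ∧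
      ∀ j : Fin n, (j : ℕ) = n - 1 → lam j ≤ t * n + i} = ↑(lhT n (t * n + i)) := by
    ext l
    rw [Finset.mem_coe, lh_mem]
    rfl
  rw [hS, finsum_mem_coe_finset, lh_sum, lh_formula n t i hi.le]
end

section
/- For every positive integer n, in the ring of formal power series ℤ[[x,u]] one has ∑_{λ ∈ L_n} x^{⌈λ_n/n⌉} u^{|⌈λ⌉|} · ∏_{i=1}^{n} (1 − x u^{i}) = ∑_{π ∈ S_n} x^{des π} u^{maj π}. -/
open MvPowerSeries

/-- The descent set of a permutation `π` of `{1,…,n}` (0-based model: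
`j ∈ descents π` iff the predecessor position `i` with `i + 1 = j` satisfies
`π i > π j`; the corresponding 1-based descent index is `(j : ℕ)`). -/
def descents {n : ℕ} (π : Equiv.Perm (Fin n)) : Finset (Fin n) :=
  Finset.univ.filter fun j => ∃ i : Fin n, (i : ℕ) + 1 = (j : ℕ) ∧ π j < π i

/-- `maj π = ∑_{i ∈ Des π} i`. -/
def maj {n : ℕ} (π : Equiv.Perm (Fin n)) : ℕ := ∑ j ∈ descents π, (j : ℕ)

/-- The generating function `∑_{λ ∈ L_n} x^{⌈λ_n/n⌉} u^{|⌈λ⌉|}` in `ℤ[[x, u]]`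
(variables `0 = x`, `1 = u`). -/
noncomputable def Lxu (n : ℕ) : MvPowerSeries (Fin 2) ℤ := fun d =>
  (Nat.card {lam : Fin n → ℕ // IsLectureHall n lam ∧
      (∀ j : Fin n, (j : ℕ) = n - 1 → cdiv (lam j) n = d 0) ∧
      (∑ i : Fin n, cdiv (lam i) ((i : ℕ) + 1)) = d 1} : ℤ)

namespace LH

/-- weighted sum -/
def W {n : ℕ} (s : Fin n → ℕ) : ℕ := ∑ k : Fin n, (n - (k : ℕ)) * s k

/-- ambient generating function -/
noncomputable def P (n : ℕ) : MvPowerSeries (Fin 2) ℤ := fun d =>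
  (Nat.card {s : Fin n → ℕ // ∑ k, s k = d 0 ∧ W s = d 1} : ℤ)

lemma fin_aux (n a c : ℕ) (Q : (Fin n → ℕ) → Prop) :
    Finite {s : Fin n → ℕ // ∑ k, s k + a = c ∧ Q s} := by
  have : ∀ s : {s : Fin n → ℕ // ∑ k, s k + a = c ∧ Q s}, ∀ k, s.1 k < c + 1 := by
    intro s k
    have h1 := s.2.1
    have h2 : s.1 k ≤ ∑ k, s.1 k := Finset.single_le_sum (fun _ _ => Nat.zero_le _) (Finset.mem_univ k)
    omega
  refine Finite.of_injective (fun s => (fun k => (⟨s.1 k, this s k⟩ : Fin (c+1)))) ?_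
  intro s s' h
  apply Subtype.ext
  funext k
  have := congrFun h k
  simpa using this

lemma fin_aux' (n c : ℕ) (Q : (Fin n → ℕ) → Prop) :
    Finite {s : Fin n → ℕ // ∑ k, s k = c ∧ Q s} := fin_aux n 0 c Q

lemma coeff_shift (n a b : ℕ) (d : Fin 2 →₀ ℕ) :
    coeff d ((X 0 : MvPowerSeries (Fin 2) ℤ) ^ a * X 1 ^ b * P n) =
      (Nat.card {s : Fin n → ℕ // ∑ k, s k + a = d 0 ∧ W s + b = d 1} : ℤ) := by
  have : (X 0 : MvPowerSeries (Fin 2) ℤ) ^ a * X 1 ^ b =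
      monomial (Finsupp.single 0 a + Finsupp.single 1 b) 1 := by
    rw [X_pow_eq, X_pow_eq, monomial_mul_monomial, one_mul]
  rw [this, coeff_monomial_mul]
  have hle : (Finsupp.single 0 a + Finsupp.single 1 b ≤ d) ↔ a ≤ d 0 ∧ b ≤ d 1 := by
    rw [Finsupp.le_def, Fin.forall_fin_two]
    simp
  split_ifs with h
  · rw [hle] at h
    rw [one_mul]
    change (Nat.card {s : Fin n → ℕ // _ ∧ _} : ℤ) = _
    congr 1
    apply Nat.card_congr
    apply Equiv.subtypeEquivRight
    intro s
    simp
    omega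
  · rw [hle] at h
    symm
    rw [Nat.cast_eq_zero, Nat.card_eq_zero]
    left
    constructor
    rintro ⟨s, h1, h2⟩
    apply h
    omega

lemma W_cons (n x : ℕ) (s : Fin n → ℕ) : W (Fin.cons x s : Fin (n+1) → ℕ) = (n+1) * x + W s := by
  simp [W, Fin.sum_univ_succ]

lemma P_succ (n : ℕ) : P (n+1) * (1 - (X 0 : MvPowerSeries (Fin 2) ℤ) * X 1 ^ (n + 1)) = P n := by
  have h : P (n+1) = P n + (X 0 : MvPowerSeries (Fin 2) ℤ)^1 * X 1 ^ (n + 1) * P (n+1) := by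
    ext d
    rw [map_add, coeff_shift]
    change ((Nat.card {s : Fin (n+1) → ℕ // _ ∧ _} : ℕ) : ℤ) =
      ((Nat.card {s : Fin n → ℕ // _ ∧ _} : ℕ) : ℤ) + _
    haveI := fin_aux (n+1) 1 (d 0) (fun s => W s + (n+1) = d 1)
    haveI := fin_aux' n (d 0) (fun s => W s = d 1)
    rw [← Nat.cast_add, ← Nat.card_sum]
    congr 1
    symm
    let f : {s : Fin n → ℕ // ∑ k, s k = d 0 ∧ W s = d 1} ⊕
        {s : Fin (n+1) → ℕ // ∑ k, s k + 1 = d 0 ∧ W s + (n+1) = d 1} →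
        {s : Fin (n+1) → ℕ // ∑ k, s k = d 0 ∧ W s = d 1} :=
      Sum.elim (fun s => ⟨Fin.cons 0 s.1, by
          rw [W_cons, Fin.sum_univ_succ]; simpa using s.2⟩)
        (fun s => ⟨Fin.cons (s.1 0 + 1) (Fin.tail s.1), by
          have h := s.2
          rw [← Fin.cons_self_tail s.1, W_cons, Fin.sum_univ_succ] at h
          rw [W_cons, Fin.sum_univ_succ]
          simp only [Fin.cons_zero, Fin.cons_succ] at h ⊢
          constructor
          · omega
          · linarith [h.2]⟩)
    apply Nat.card_congr (Equiv.ofBijective f ?_)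
    constructor
    · rintro (⟨s, hs⟩ | ⟨s, hs⟩) (⟨s', hs'⟩ | ⟨s', hs'⟩) h
      · simp only [f, Sum.elim_inl, Subtype.mk.injEq, Fin.cons_inj] at h
        simp [h.2]
      · simp [f, Fin.cons_inj] at h
      · simp [f, Fin.cons_inj] at h
      · simp only [f, Sum.elim_inr, Subtype.mk.injEq, Fin.cons_inj] at h
        have : s = s' := by
          rw [← Fin.cons_self_tail s, ← Fin.cons_self_tail s', h.2]
          congr 1
          omega
        subst this
        rfl
    · rintro ⟨s, hs⟩
      have hs2 := hs
      rw [← Fin.cons_self_tail s, W_cons, Fin.sum_univ_succ] at hs2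
      simp only [Fin.cons_zero, Fin.cons_succ] at hs2
      rcases hx : s 0 with _ | x
      · refine ⟨Sum.inl ⟨Fin.tail s, ?_⟩, ?_⟩
        · simpa [hx] using hs2
        · apply Subtype.ext
          simp only [f, Sum.elim_inl]
          rw [← hx, Fin.cons_self_tail]
      · refine ⟨Sum.inr ⟨Fin.cons x (Fin.tail s), ?_⟩, ?_⟩
        · rw [W_cons, Fin.sum_univ_succ]
          simp only [Fin.cons_zero, Fin.cons_succ]
          rw [hx] at hs2
          constructor
          · omega
          · linarith [hs2.2]
        · apply Subtype.ext
          simp only [f, Sum.elim_inr, Fin.cons_zero, Fin.tail_cons]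
          rw [← hx, Fin.cons_self_tail]
  rw [pow_one] at h
  linear_combination h

lemma P_mul (n : ℕ) : P n * ∏ i ∈ Finset.range n,
        (1 - (X 0 : MvPowerSeries (Fin 2) ℤ) * X 1 ^ (i + 1)) = 1 := by
  induction n with
  | zero =>
    simp only [Finset.range_zero, Finset.prod_empty, mul_one]
    ext d
    rw [coeff_one]
    change ((Nat.card {s : Fin 0 → ℕ // _ ∧ _} : ℕ) : ℤ) = _
    have h0 : d = 0 ↔ d 0 = 0 ∧ d 1 = 0 := by
      rw [Finsupp.ext_iff, Fin.forall_fin_two]; rfl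
    split_ifs with h
    · rw [h0] at h
      have : Nat.card {s : Fin 0 → ℕ // ∑ k, s k = d 0 ∧ W s = d 1} = 1 := by
        rw [Nat.card_eq_one_iff_unique]
        exact ⟨⟨fun a b => Subtype.ext (Subsingleton.elim _ _)⟩, ⟨⟨fun _ => 0, by simp [W, h]⟩⟩⟩
      exact_mod_cast this
    · rw [h0] at h
      rw [Nat.cast_eq_zero, Nat.card_eq_zero]
      left
      constructor
      rintro ⟨s, h1, h2⟩
      apply h
      simp [W] at h1 h2
      omega
  | succ n ih =>
    rw [Finset.prod_range_succ, mul_comm (∏ i ∈ Finset.range n, _), ← mul_assoc, P_succ, ih]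

/-! Lehmer code -/

/-- Lehmer code -/
def code {n : ℕ} (π : Equiv.Perm (Fin n)) (p : Fin n) : ℕ :=
  (Finset.univ.filter fun k => p < k ∧ π k < π p).card

lemma code_le {n : ℕ} (π : Equiv.Perm (Fin n)) (p : Fin n) : code π p + p + 1 ≤ n := by
  have : code π p ≤ (Finset.Ioi p).card := by
    apply Finset.card_le_card
    intro k hk
    simp at hk ⊢
    exact hk.1
  rw [Fin.card_Ioi] at this
  have := p.2
  omega

lemma code_lt {m : ℕ} (π : Equiv.Perm (Fin (m+1))) (p : Fin m) :
    code π p.succ < code π p.castSucc ↔ π p.succ < π p.castSucc := by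
  constructor
  · intro h
    by_contra h2
    rw [not_lt] at h2
    apply absurd h
    rw [not_lt]
    apply Finset.card_le_card
    intro k hk
    simp only [Finset.mem_filter, Finset.mem_univ, true_and] at hk ⊢
    refine ⟨?_, lt_of_lt_of_le hk.2 h2⟩
    rcases eq_or_ne k p.succ with h3 | h3
    · subst h3
      exact absurd hk.2 (not_lt.2 h2)
    · have := hk.1
      rw [Fin.lt_def] at this ⊢
      rw [Ne, Fin.ext_iff] at h3
      simp at this h3 ⊢
      omega
  · intro h
    apply Finset.card_lt_card
    rw [Finset.ssubset_iff]
    refine ⟨p.succ, by simp, ?_⟩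
    intro k hk
    simp only [Finset.mem_insert, Finset.mem_filter, Finset.mem_univ, true_and] at hk ⊢
    rcases hk with rfl | hk
    · exact ⟨Fin.castSucc_lt_succ, h⟩
    · exact ⟨Fin.castSucc_lt_succ.trans hk.1, hk.2.trans h⟩

lemma code_lt_of {n : ℕ} (π σ : Equiv.Perm (Fin n)) (p : Fin n) (h : ∀ k < p, π k = σ k)
    (hlt : π p < σ p) : code π p < code σ p := by
  have hc : ∀ τ : Equiv.Perm (Fin n), code τ p =
      (Finset.univ.filter fun v => p < τ.symm v ∧ v < τ p).card := by
    intro τ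
    unfold code
    apply Finset.card_bij (fun k _ => τ k)
    · intro k hk; simpa using hk
    · intro a _ b _ h; exact τ.injective h
    · intro b hb
      exact ⟨τ.symm b, by simpa using hb, by simp⟩
  rw [hc, hc]
  have hσ : ∀ v, v ≠ σ p → (p < π.symm v ∨ p = π.symm v) → p < σ.symm v := by
    intro v hv h1
    by_contra h2
    rw [not_lt] at h2
    rcases lt_or_eq_of_le h2 with h3 | h3
    · have := h _ h3
      rw [Equiv.apply_symm_apply, ← Equiv.eq_symm_apply] at this
      rw [this] at h3
      rcases h1 with h1 | h1
      · exact absurd h3 (not_lt.2 h1.le)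
      · exact absurd h1 h3.ne'
    · exact hv (by rw [← h3]; simp)
  apply Finset.card_lt_card
  rw [Finset.ssubset_iff]
  refine ⟨π p, by simp, ?_⟩
  intro v hv
  simp only [Finset.mem_insert, Finset.mem_filter, Finset.mem_univ, true_and] at hv ⊢
  rcases hv with rfl | hv
  · exact ⟨hσ _ hlt.ne (Or.inr (by simp)), hlt⟩
  · have := hv.2.trans hlt
    exact ⟨hσ _ this.ne (Or.inl hv.1), this⟩

lemma code_inj {n : ℕ} (π σ : Equiv.Perm (Fin n)) (h : ∀ p, code π p = code σ p) : π = σ := by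
  ext1 p
  induction p using WellFoundedLT.induction with
  | ind p ih =>
    rcases lt_trichotomy (π p) (σ p) with h1 | h1 | h1
    · exact absurd (h p) (code_lt_of π σ p ih h1).ne
    · exact h1
    · exact absurd (h p) (code_lt_of σ π p (fun k hk => (ih k hk).symm) h1).ne'

/-- reversed code -/
def ec {n : ℕ} (π : Equiv.Perm (Fin n)) (i : Fin n) : ℕ := code π i.rev

lemma ec_le {n : ℕ} (π : Equiv.Perm (Fin n)) (i : Fin n) : ec π i ≤ i := by
  have := code_le π i.rev
  rw [Fin.val_rev] at this
  unfold ec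
  have := i.2
  omega

lemma ec_inj {n : ℕ} (π σ : Equiv.Perm (Fin n)) (h : ∀ p, ec π p = ec σ p) : π = σ := by
  apply code_inj
  intro p
  simpa [ec] using h p.rev

lemma ec_surj {n : ℕ} (e : Fin n → ℕ) (he : ∀ i, e i ≤ i) : ∃ π, ∀ i, ec π i = e i := by
  let f : Equiv.Perm (Fin n) → ((i : Fin n) → Fin (i + 1)) :=
    fun π i => ⟨ec π i, Nat.lt_succ_of_le (ec_le π i)⟩
  have hf : Function.Bijective f := by
    rw [Fintype.bijective_iff_injective_and_card]
    constructor
    · intro π σ h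
      apply ec_inj
      intro p
      have := congrFun h p
      simpa [f] using this
    · rw [Fintype.card_perm, Fintype.card_pi]
      simp only [Fintype.card_fin]
      rw [Fin.prod_univ_eq_prod_range (fun i => i + 1), Finset.prod_range_add_one_eq_factorial]
  obtain ⟨π, hπ⟩ := hf.2 (fun i => ⟨e i, Nat.lt_succ_of_le (he i)⟩)
  refine ⟨π, fun i => ?_⟩
  have := congrFun hπ i
  simpa [f] using this

/-- ascent indicator -/
def asc {m : ℕ} (e : Fin (m+1) → ℕ) : Fin (m+1) → ℕ :=
  Fin.cons 0 (fun i : Fin m => if e i.castSucc < e i.succ then 1 else 0)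

lemma asc_ec_sum {m : ℕ} (π : Equiv.Perm (Fin (m+1))) (w : ℕ → ℕ) :
    ∑ k : Fin (m+1), w (m + 1 - k) * asc (ec π) k = ∑ j ∈ descents π, w j := by
  unfold descents
  rw [Finset.sum_filter, Fin.sum_univ_succ, Fin.sum_univ_succ]
  simp only [asc, Fin.cons_zero, Fin.cons_succ, mul_zero, zero_add]
  rw [if_neg (by simp), zero_add]
  rw [← Equiv.sum_comp Fin.revPerm]
  apply Finset.sum_congr rfl
  intro p _
  have h1 : (∃ i : Fin (m+1), (i : ℕ) + 1 = (p.succ : ℕ) ∧ π p.succ < π i) ↔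
      π p.succ < π p.castSucc := by
    constructor
    · rintro ⟨i, h1, h2⟩
      have : i = p.castSucc := by ext; simpa using h1
      rwa [← this]
    · intro h
      exact ⟨p.castSucc, by simp, h⟩
  have h2 : ec π (Fin.castSucc (Fin.revPerm p)) < ec π (Fin.succ (Fin.revPerm p)) ↔
      π p.succ < π p.castSucc := by
    rw [← code_lt]
    simp [ec, Fin.rev_castSucc, Fin.rev_succ]
  simp only [h1, h2]
  have h3 : m + 1 - ((Fin.revPerm p).succ : ℕ) = (p.succ : ℕ) := by
    simp [Fin.val_rev]
    omega
  rw [h3]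
  split_ifs <;> simp

/-! The bijection -/

/-- partial sums -/
def aa {n : ℕ} (b : Fin n → ℕ) (i : Fin n) : ℕ := ∑ k ∈ Finset.Iic i, b k

lemma aa_zero {m : ℕ} (b : Fin (m+1) → ℕ) : aa b 0 = b 0 := by
  have : Finset.Iic (0 : Fin (m+1)) = {0} := by ext; simp
  simp [aa, this]

lemma aa_succ {m : ℕ} (b : Fin (m+1) → ℕ) (i : Fin m) :
    aa b i.succ = aa b i.castSucc + b i.succ := by
  have : Finset.Iic i.succ = insert i.succ (Finset.Iic i.castSucc) := by
    ext k
    simp only [Finset.mem_Iic, Finset.mem_insert, Fin.le_def, Fin.ext_iff]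
    simp
    omega
  rw [aa, this, Finset.sum_insert (by simp [Fin.le_def]), add_comm]; rfl

lemma aa_last {m : ℕ} (b : Fin (m+1) → ℕ) : aa b (Fin.last m) = ∑ k, b k := by
  have : Finset.Iic (Fin.last m) = Finset.univ := by ext k; simp [Fin.le_last]
  rw [aa, this]

lemma aa_sum {n : ℕ} (b : Fin n → ℕ) : ∑ i, aa b i = W b := by
  unfold aa W
  rw [Finset.sum_comm' (t' := Finset.univ) (s' := fun k => Finset.Ici k) (by simp)]
  simp

lemma aa_inj {m : ℕ} (b b' : Fin (m+1) → ℕ) (h : ∀ i, aa b i = aa b' i) : b = b' := by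
  funext i
  refine Fin.cases ?_ (fun i => ?_) i
  · simpa [aa_zero] using h 0
  · have h1 := h i.succ
    rw [aa_succ, aa_succ, h i.castSucc] at h1
    omega

lemma aa_surj {m : ℕ} (a : Fin (m+1) → ℕ) (h : ∀ i : Fin m, a i.castSucc ≤ a i.succ) :
    aa (Fin.cons (a 0) (fun i : Fin m => a i.succ - a i.castSucc) : Fin (m+1) → ℕ) = a := by
  funext i
  induction i using Fin.induction with
  | zero => simp [aa_zero]
  | succ i ih => 
    rw [aa_succ, ih, Fin.cons_succ]
    have := h i
    omega

lemma lh_iff {m : ℕ} (lam : Fin (m+1) → ℕ) : IsLectureHall (m+1) lam ↔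
    ∀ i : Fin m, lam i.castSucc * ((i : ℕ) + 2) ≤ lam i.succ * ((i : ℕ) + 1) := by
  constructor
  · intro h i
    have := h i.castSucc i.succ (by simp)
    simpa [add_assoc] using this
  · intro h i j hij
    have hi : (i : ℕ) < m := by have := j.2; omega
    have h1 : i = (⟨i, hi⟩ : Fin m).castSucc := by ext; simp
    have h2 : j = (⟨i, hi⟩ : Fin m).succ := by ext; simp [hij]
    have := h ⟨i, hi⟩
    rw [← h1, ← h2] at this
    simpa [hij, add_assoc] using this

lemma step (i a a' e e' l l' : ℕ) (he : e ≤ i) (he' : e' ≤ i + 1) (h : l + e = (i+1) * a)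
    (h' : l' + e' = (i+2) * a') :
    l * (i+2) ≤ l' * (i+1) ↔ a + (if e < e' then 1 else 0) ≤ a' := by
  zify at *
  have hl : (l : ℤ) = (i+1) * a - e := by linarith
  have hl' : (l' : ℤ) = (i+2) * a' - e' := by linarith
  rw [hl, hl']
  rcases lt_trichotomy a a' with h1 | h1 | h1
  · have : (a : ℤ) + 1 ≤ a' := by exact_mod_cast h1
    refine iff_of_true ?_ ?_
    · nlinarith [mul_nonneg (mul_nonneg (by positivity : (0:ℤ) ≤ i + 1) (by positivity : (0:ℤ) ≤ i + 2)) (sub_nonneg.2 this), mul_nonneg (by positivity : (0:ℤ) ≤ e) (by positivity : (0:ℤ) ≤ i + 2), mul_nonneg (sub_nonneg.2 he') (by positivity : (0:ℤ) ≤ i + 1)]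
    · split_ifs <;> push_cast <;> linarith
  · subst h1
    split_ifs with h2
    · refine iff_of_false ?_ (by push_cast; linarith)
      have : (e : ℤ) + 1 ≤ e' := by exact_mod_cast h2
      rw [not_le]
      nlinarith [mul_nonneg (sub_nonneg.2 this) (by positivity : (0:ℤ) ≤ i + 1)]
    · refine iff_of_true ?_ (by push_cast; linarith)
      have : (e' : ℤ) ≤ e := by exact_mod_cast not_lt.1 h2
      nlinarith [mul_nonneg (sub_nonneg.2 this) (by positivity : (0:ℤ) ≤ i + 1)]
  · have : (a' : ℤ) + 1 ≤ a := by exact_mod_cast h1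
    refine iff_of_false ?_ ?_
    · rw [not_le]
      nlinarith [mul_nonneg (mul_nonneg (by positivity : (0:ℤ) ≤ i + 1) (by positivity : (0:ℤ) ≤ i + 2)) (sub_nonneg.2 this), mul_nonneg (by positivity : (0:ℤ) ≤ e') (by positivity : (0:ℤ) ≤ i + 1), mul_nonneg (sub_nonneg.2 he) (by positivity : (0:ℤ) ≤ i + 2)]
    · split_ifs <;> push_cast <;> linarith

lemma cdiv_eq (i a e l : ℕ) (he : e ≤ i) (h : l + e = (i+1) * a) : cdiv l (i+1) = a := by
  unfold cdiv
  apply Nat.div_eq_of_lt_le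
  · rw [mul_comm]; omega
  · have : (a + 1) * (i+1) = (i+1) * a + (i + 1) := by ring
    rw [this]; omega

lemma cdiv_spec (i l : ℕ) : ∃ e, e ≤ i ∧ l + e = (i+1) * cdiv l (i+1) := by
  unfold cdiv
  have h1 := Nat.div_add_mod (l + (i+1) - 1) (i+1)
  have h2 : (l + (i+1) - 1) % (i+1) < i + 1 := Nat.mod_lt _ (Nat.succ_pos i)
  refine ⟨i - (l + (i+1) - 1) % (i+1), by omega, by omega⟩

/-- the parts -/
def lamOf {m : ℕ} (π : Equiv.Perm (Fin (m+1))) (s : Fin (m+1) → ℕ) (i : Fin (m+1)) : ℕ :=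
  ((i : ℕ) + 1) * aa (s + asc (ec π)) i - ec π i

lemma lamOf_spec {m : ℕ} (π : Equiv.Perm (Fin (m+1))) (s : Fin (m+1) → ℕ) (i : Fin (m+1)) :
    lamOf π s i + ec π i = ((i : ℕ) + 1) * aa (s + asc (ec π)) i := by
  have key : aa (s + asc (ec π)) i = 0 → ec π i = 0 := by
    induction i using Fin.induction with
    | zero => intro _; simpa using ec_le π 0
    | succ i ih =>
      intro h
      rw [aa_succ] at h
      have h1 := ih (by omega)
      have h2 : asc (ec π) i.succ = 0 := by
        have : (s + asc (ec π)) i.succ = 0 := by omega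
        simp only [Pi.add_apply] at this
        omega
      simp only [asc, Fin.cons_succ] at h2
      split_ifs at h2 with h3
      omega
  unfold lamOf
  apply Nat.sub_add_cancel
  rcases Nat.eq_zero_or_pos (aa (s + asc (ec π)) i) with h | h
  · rw [key h]; exact Nat.zero_le _
  · have := ec_le π i
    nlinarith

lemma lamOf_cdiv {m : ℕ} (π : Equiv.Perm (Fin (m+1))) (s : Fin (m+1) → ℕ) (i : Fin (m+1)) :
    cdiv (lamOf π s i) (i + 1) = aa (s + asc (ec π)) i :=
  cdiv_eq _ _ _ _ (ec_le π i) (lamOf_spec π s i)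

lemma lamOf_lh {m : ℕ} (π : Equiv.Perm (Fin (m+1))) (s : Fin (m+1) → ℕ) :
    IsLectureHall (m+1) (lamOf π s) := by
  rw [lh_iff]
  intro i
  have h1 := ec_le π i.castSucc
  have h2 := ec_le π i.succ
  have h3 := lamOf_spec π s i.castSucc
  have h4 := lamOf_spec π s i.succ
  simp only [Fin.val_castSucc, Fin.val_succ] at h1 h2 h3 h4
  rw [step i _ _ _ _ _ _ h1 h2 h3 h4, aa_succ]
  simp [asc]

lemma lamOf_inj {m : ℕ} (π π' : Equiv.Perm (Fin (m+1))) (s s' : Fin (m+1) → ℕ)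
    (h : lamOf π s = lamOf π' s') : π = π' ∧ s = s' := by
  have ha : ∀ i, aa (s + asc (ec π)) i = aa (s' + asc (ec π')) i := by
    intro i
    rw [← lamOf_cdiv, ← lamOf_cdiv, h]
  have he : π = π' := by
    apply ec_inj
    intro i
    have h1 := lamOf_spec π s i
    have h2 := lamOf_spec π' s' i
    rw [h, ha i] at h1
    omega
  subst he
  exact ⟨rfl, add_right_cancel (aa_inj _ _ ha)⟩

lemma lamOf_surj {m : ℕ} (lam : Fin (m+1) → ℕ) (h : IsLectureHall (m+1) lam) :
    ∃ π s, lamOf π s = lam := by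
  choose e he1 he2 using fun i : Fin (m+1) => cdiv_spec i (lam i)
  obtain ⟨π, hπ⟩ := ec_surj e he1
  have hπ' : ec π = e := funext hπ
  rw [lh_iff] at h
  set a : Fin (m+1) → ℕ := fun i => cdiv (lam i) (i+1) with ha
  have hst : ∀ i : Fin m, a i.castSucc + (if e i.castSucc < e i.succ then 1 else 0) ≤ a i.succ := by
    intro i
    have h1 := he1 i.castSucc
    have h2 := he1 i.succ
    have h3 := he2 i.castSucc
    have h4 := he2 i.succ
    simp only [Fin.val_castSucc, Fin.val_succ] at h1 h2 h3 h4
    have := (step i _ _ _ _ _ _ h1 h2 h3 h4).1 (h i)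
    simpa [ha] using this
  have hs := aa_surj a (fun i => by have := hst i; omega)
  refine ⟨π, (Fin.cons (a 0) (fun i : Fin m => a i.succ - a i.castSucc) : Fin (m+1) → ℕ) - asc e, ?_⟩
  funext i
  have h1 := lamOf_spec π ((Fin.cons (a 0) (fun i : Fin m => a i.succ - a i.castSucc) : Fin (m+1) → ℕ) - asc e) i
  rw [hπ', tsub_add_cancel_of_le, hs] at h1
  · have := he2 i
    have h5 : a i = cdiv (lam i) (i+1) := rfl
    rw [h5] at h1
    omega
  · intro i
    refine Fin.cases ?_ (fun i => ?_) i
    · simp [asc]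
    · simp only [asc, Fin.cons_succ]
      have := hst i
      omega

lemma stat0 {m : ℕ} (π : Equiv.Perm (Fin (m+1))) (s : Fin (m+1) → ℕ) :
    aa (s + asc (ec π)) (Fin.last m) = ∑ k, s k + (descents π).card := by
  have := asc_ec_sum π (fun _ => 1)
  simp only [one_mul, Finset.sum_const, smul_eq_mul, mul_one] at this
  rw [aa_last, ← this]
  simp [Finset.sum_add_distrib]

lemma stat1 {m : ℕ} (π : Equiv.Perm (Fin (m+1))) (s : Fin (m+1) → ℕ) :
    ∑ i, aa (s + asc (ec π)) i = W s + maj π := by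
  have := asc_ec_sum π (fun j => j)
  rw [aa_sum, maj, ← this]
  simp [W, mul_add, Finset.sum_add_distrib]

lemma Lxu_eq (m : ℕ) : Lxu (m+1) = ∑ π : Equiv.Perm (Fin (m+1)),
      (X 0 : MvPowerSeries (Fin 2) ℤ) ^ (descents π).card * X 1 ^ maj π * P (m+1) := by
  ext d
  rw [map_sum]
  simp only [coeff_shift]
  change ((Nat.card {lam : Fin (m+1) → ℕ // _ ∧ _ ∧ _} : ℕ) : ℤ) = _
  rw [← Nat.cast_sum]
  congr 1
  haveI : ∀ π : Equiv.Perm (Fin (m+1)), Finite {s : Fin (m+1) → ℕ //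
    ∑ k, s k + (descents π).card = d 0 ∧ W s + maj π = d 1} := fun π =>
    fin_aux _ _ _ _
  rw [← Nat.card_sigma]
  symm
  have hst : ∀ (π : Equiv.Perm (Fin (m+1))) (s : Fin (m+1) → ℕ),
      ((∀ j : Fin (m+1), (j : ℕ) = m + 1 - 1 → cdiv (lamOf π s j) (m+1) = d 0) ∧
      (∑ i : Fin (m+1), cdiv (lamOf π s i) ((i : ℕ) + 1)) = d 1) ↔
      (∑ k, s k + (descents π).card = d 0 ∧ W s + maj π = d 1) := by
    intro π s
    simp only [lamOf_cdiv, stat1]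
    have : cdiv (lamOf π s (Fin.last m)) (m+1) = ∑ k, s k + (descents π).card := by
      rw [← stat0, ← lamOf_cdiv]; simp
    rw [← this]
    refine and_congr_left fun _ => ⟨fun h => h _ (by simp), fun h j hj => ?_⟩
    have : j = Fin.last m := by ext; simpa using hj
    rw [this, h]
  refine Nat.card_congr (Equiv.ofBijective (fun x => ⟨lamOf x.1 x.2.1, lamOf_lh _ _,
    (hst _ _).2 x.2.2⟩) ⟨?_, ?_⟩)
  · rintro ⟨π, s, hs⟩ ⟨π', s', hs'⟩ h
    simp only [Subtype.mk.injEq] at h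
    obtain ⟨rfl, rfl⟩ := lamOf_inj _ _ _ _ h
    rfl
  · rintro ⟨lam, h1, h2⟩
    obtain ⟨π, s, rfl⟩ := lamOf_surj lam h1
    exact ⟨⟨π, s, (hst _ _).1 h2⟩, rfl⟩

end LH

/-- **Savage–Schuster**: in `ℤ[[x, u]]`,
`(∑_{λ ∈ L_n} x^{⌈λ_n/n⌉} u^{|⌈λ⌉|}) ⬝ ∏_{i=1}^n (1 - x u^i)
  = ∑_{π ∈ S_n} x^{des π} u^{maj π}`. -/
theorem lecture_hall_permutation_statistics (n : ℕ) (hn : 0 < n) :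
    Lxu n * ∏ i ∈ Finset.range n,
        (1 - (X 0 : MvPowerSeries (Fin 2) ℤ) * X 1 ^ (i + 1)) =
    ∑ π : Equiv.Perm (Fin n),
      (X 0 : MvPowerSeries (Fin 2) ℤ) ^ (descents π).card * X 1 ^ maj π := by
  obtain ⟨m, rfl⟩ : ∃ m, n = m + 1 := ⟨n - 1, by omega⟩
  rw [LH.Lxu_eq, ← Finset.sum_mul, mul_assoc, LH.P_mul, mul_one]
end

section
/- For every positive integer n, the following identity holds in the polynomial ring ℤ[u,q]: ∑_{π ∈ S_n} u^{maj π} q^{sqin π} = ∏_{i=1}^{n} (1 + (uq^{i}) + (uq^{i})² + ⋯ + (uq^{i})^{i−1}), i.e. ∑_{π ∈ S_n} u^{maj π} q^{sqin π} = ∏_{i=1}^{n} [i]_{uq^{i}}. -/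
open MvPolynomial

/-- `inv π = #{(i,j) : i < j, π i > π j}`. -/
def invStat {n : ℕ} (π : Equiv.Perm (Fin n)) : ℕ :=
  ((Finset.univ : Finset (Fin n × Fin n)).filter
    fun p => p.1 < p.2 ∧ π p.2 < π p.1).card

/-- `sqin π = sq π + inv π`, where `sq π = ∑_{i ∈ Des π} i²`. -/
def sqin {n : ℕ} (π : Equiv.Perm (Fin n)) : ℕ :=
  (∑ j ∈ descents π, (j : ℕ) ^ 2) + invStat π

open Finset in
lemma aux_desc_sum {n : ℕ} (π : Equiv.Perm (Fin (n+1))) (f : ℕ → ℕ) :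
    ((∑ j ∈ descents π, f j : ℕ) : ℤ) =
      ∑ j : Fin n, if π j.succ < π j.castSucc then (f (j + 1) : ℤ) else 0 := by
  unfold descents
  rw [Finset.sum_filter, Fin.sum_univ_succ]
  rw [if_neg (by simp)]
  push_cast
  rw [zero_add]
  refine Finset.sum_congr rfl fun j _ => ?_
  have : (∃ i : Fin (n+1), (i : ℕ) + 1 = (j.succ : Fin (n+1)) ∧ π j.succ < π i) ↔
      π j.succ < π j.castSucc := by
    constructor
    · rintro ⟨i, h1, h2⟩
      have : i = j.castSucc := by ext; simpa using h1
      rwa [this] at h2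
    · intro h
      exact ⟨_, by simp, h⟩
  exact if_congr this rfl rfl

lemma aux_inv_sum {n : ℕ} (π : Equiv.Perm (Fin n)) :
    (invStat π : ℤ) = ∑ i : Fin n, ∑ j : Fin n,
      if i < j then (if π j < π i then (1 : ℤ) else 0) else 0 := by
  unfold invStat
  rw [Finset.card_filter, ← Finset.univ_product_univ, Finset.sum_product]
  push_cast
  simp only [ite_and]

def rotP {n : ℕ} (k : Fin (n+1)) (π : Equiv.Perm (Fin (n+1))) : Equiv.Perm (Fin (n+1)) :=
  π.trans (Equiv.subRight k)

lemma rotP_apply {n : ℕ} (k : Fin (n+1)) (π : Equiv.Perm (Fin (n+1))) (i) :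
    rotP k π i = π i - k := rfl

lemma aux_sub_val {n : ℕ} (a : Fin (n+2)) :
    ((a - 1 : Fin (n+2)) : ℕ) = if a = 0 then n + 1 else (a : ℕ) - 1 := by
  split_ifs with h
  · subst h; simp [Fin.ext_iff]
  · exact Fin.val_sub_one_of_ne_zero h

lemma aux_cmp {n : ℕ} (a b : Fin (n+2)) (hab : a ≠ b) :
    (if a - 1 < b - 1 then (1 : ℤ) else 0) =
      (if a < b then 1 else 0) + (if b = 0 then 1 else 0) - (if a = 0 then 1 else 0) := by
  have ha := a.isLt
  have hb := b.isLt
  rw [Ne, Fin.ext_iff] at hab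
  simp only [Fin.lt_def, aux_sub_val, Fin.ext_iff, Fin.val_zero]
  split_ifs <;> omega

lemma aux_desc_step {n : ℕ} (π : Equiv.Perm (Fin (n+2))) (f : ℕ → ℕ) (h0 : f 0 = 0)
    (p : Fin (n+2)) (hp : π p = 0) (hl : π (Fin.last _) ≠ 0) :
    ((∑ j ∈ descents (rotP 1 π), f j : ℕ) : ℤ) =
      ((∑ j ∈ descents π, f j : ℕ) : ℤ) + f (p + 1) - f p := by
  have key : ∀ i, π i = 0 ↔ i = p := by
    intro i; rw [← hp]; exact π.injective.eq_iff
  have hl' : Fin.last (n+1) ≠ p := fun h => hl ((key _).2 h)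
  have e1 : (f (p+1) : ℤ) = ∑ i : Fin (n+2), if i = p then (f (i+1) : ℤ) else 0 := by simp
  have e2 : (f p : ℤ) = ∑ i : Fin (n+2), if i = p then (f i : ℤ) else 0 := by simp
  rw [Fin.sum_univ_castSucc, if_neg hl', add_zero] at e1
  rw [Fin.sum_univ_succ, Fin.val_zero, h0, Nat.cast_zero, ite_self, zero_add] at e2
  rw [e1, e2, aux_desc_sum, aux_desc_sum, ← Finset.sum_add_distrib, ← Finset.sum_sub_distrib]
  refine Finset.sum_congr rfl fun j _ => ?_
  have : (if rotP 1 π j.succ < rotP 1 π j.castSucc then (1 : ℤ) else 0) = _ :=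
    aux_cmp (π j.succ) (π j.castSucc)
    (fun h => (Fin.castSucc_lt_succ (i := j)).ne' (π.injective h))
  simp only [key] at this
  simp only [Fin.val_succ, Fin.val_castSucc]
  have t : ∀ (P : Prop) [Decidable P], (if P then (f (j+1) : ℤ) else 0) =
    f (j+1) * (if P then 1 else 0) := by intro P _; simp
  simp only [t]
  rw [this]; ring

lemma aux_inv_step {n : ℕ} (π : Equiv.Perm (Fin (n+2)))
    (p : Fin (n+2)) (hp : π p = 0) :
    (invStat (rotP 1 π) : ℤ) = invStat π + (n + 1 - p) - p := by
  have key : ∀ i, π i = 0 ↔ i = p := by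
    intro i; rw [← hp]; exact π.injective.eq_iff
  have e1 : (n + 1 - p : ℤ) = ∑ i : Fin (n+2), ∑ j : Fin (n+2),
      if i < j then (if i = p then (1:ℤ) else 0) else 0 := by
    have : ∀ i : Fin (n+2), (∑ j : Fin (n+2), if i < j then (if i = p then (1:ℤ) else 0) else 0)
      = if i = p then ((n + 1 - p : ℕ) : ℤ) else 0 := by
      intro i
      split_ifs with h
      · subst h
        rw [← Finset.sum_filter]
        simp [Fin.card_Ioi, Finset.filter_lt_eq_Ioi]
      · simp
    rw [Finset.sum_congr rfl fun i _ => this i]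
    have := p.isLt
    simp
    omega
  have e2 : (p : ℤ) = ∑ i : Fin (n+2), ∑ j : Fin (n+2),
      if i < j then (if j = p then (1:ℤ) else 0) else 0 := by
    rw [Finset.sum_comm]
    have : ∀ j : Fin (n+2), (∑ i : Fin (n+2), if i < j then (if j = p then (1:ℤ) else 0) else 0)
      = if j = p then ((p : ℕ) : ℤ) else 0 := by
      intro i
      split_ifs with h
      · subst h
        rw [← Finset.sum_filter]
        simp [Fin.card_Iio, Finset.filter_gt_eq_Iio]
      · simp
    rw [Finset.sum_congr rfl fun i _ => this i]
    simp
  rw [e1]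
  conv_rhs => rw [e2]
  rw [aux_inv_sum, aux_inv_sum]
  simp only [← Finset.sum_add_distrib, ← Finset.sum_sub_distrib]
  refine Finset.sum_congr rfl fun i _ => Finset.sum_congr rfl fun j _ => ?_
  by_cases hij : i < j
  · simp only [if_pos hij]
    have := aux_cmp (π j) (π i) (fun h => hij.ne' (π.injective h))
    simp only [rotP_apply, key] at this ⊢
    exact this
  · simp [hij]

lemma aux_step {n : ℕ} (π : Equiv.Perm (Fin (n+2))) (hl : π (Fin.last _) ≠ 0) :
    maj (rotP 1 π) = maj π + 1 ∧ sqin (rotP 1 π) = sqin π + (n + 2) := by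
  obtain ⟨p, hp⟩ := π.surjective 0
  have h1 := aux_desc_step π (fun x => x) rfl p hp hl
  have h2 := aux_desc_step π (fun x => x ^ 2) rfl p hp hl
  have h3 := aux_inv_step π p hp
  unfold maj sqin
  constructor
  · zify at h1 ⊢; linarith
  · zify at h2 h3 ⊢
    rw [h2, h3]; ring

def embP {n : ℕ} (σ : Equiv.Perm (Fin n)) : Equiv.Perm (Fin (n+1)) :=
  finSuccEquivLast.symm.permCongr (Equiv.optionCongr σ)

lemma embP_castSucc {n : ℕ} (σ : Equiv.Perm (Fin n)) (i : Fin n) :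
    embP σ i.castSucc = (σ i).castSucc := by
  simp [embP, Equiv.permCongr_apply]

lemma embP_last {n : ℕ} (σ : Equiv.Perm (Fin n)) :
    embP σ (Fin.last n) = Fin.last n := by
  simp [embP, Equiv.permCongr_apply]

lemma aux_emb_desc {n : ℕ} (σ : Equiv.Perm (Fin n)) (f : ℕ → ℕ) :
    ∑ j ∈ descents (embP σ), f j = ∑ j ∈ descents σ, f j := by
  unfold descents
  rw [Finset.sum_filter, Finset.sum_filter, Fin.sum_univ_castSucc, if_neg, add_zero]
  · refine Finset.sum_congr rfl fun j _ => ?_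
    have : (∃ i : Fin (n+1), (i : ℕ) + 1 = (j.castSucc : Fin (n+1)) ∧
        embP σ j.castSucc < embP σ i) ↔ ∃ i : Fin n, (i : ℕ) + 1 = (j : ℕ) ∧ σ j < σ i := by
      constructor
      · rintro ⟨i, h1, h2⟩
        induction i using Fin.lastCases with
        | last => have := j.isLt; simp at h1; omega
        | cast i =>
          rw [embP_castSucc, embP_castSucc] at h2
          exact ⟨i, by simpa using h1, by simpa using h2⟩
      · rintro ⟨i, h1, h2⟩
        refine ⟨i.castSucc, by simpa using h1, ?_⟩
        rw [embP_castSucc, embP_castSucc]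
        simpa using h2
    exact if_congr this rfl rfl
  · rintro ⟨i, -, h⟩
    rw [embP_last] at h
    exact absurd (Fin.le_last _) (not_le.2 h)

lemma aux_emb_inv {n : ℕ} (σ : Equiv.Perm (Fin n)) : invStat (embP σ) = invStat σ := by
  zify
  rw [aux_inv_sum, aux_inv_sum]
  simp [Fin.sum_univ_castSucc, embP_castSucc, embP_last, not_lt.2 (Fin.le_last _), Fin.le_last]

lemma aux_rot_emb {n : ℕ} (σ : Equiv.Perm (Fin (n+1))) (k : ℕ) (hk : k < n + 2) :
    maj (rotP (⟨k, hk⟩ : Fin (n+2)) (embP σ)) = maj σ + k ∧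
    sqin (rotP (⟨k, hk⟩ : Fin (n+2)) (embP σ)) = sqin σ + (n + 2) * k := by
  induction k with
  | zero =>
    have : rotP (⟨0, hk⟩ : Fin (n+2)) (embP σ) = embP σ := by
      ext i; rw [rotP_apply]; congr 1; exact sub_zero _
    rw [this]
    unfold maj sqin
    rw [aux_emb_inv, aux_emb_desc σ (fun x => x), aux_emb_desc σ (fun x => x ^ 2)]
    simp
  | succ k ih =>
    obtain ⟨i1, i2⟩ := ih (by omega)
    have : rotP (⟨k+1, hk⟩ : Fin (n+2)) (embP σ) =
        rotP 1 (rotP (⟨k, by omega⟩ : Fin (n+2)) (embP σ)) := by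
      ext i; rw [rotP_apply, rotP_apply, rotP_apply, sub_sub]
      congr 2
      ext
      rw [Fin.val_add_one_of_lt']
      simpa using hk
    rw [this]
    have h := aux_step (rotP (⟨k, by omega⟩ : Fin (n+2)) (embP σ)) (by
      rw [rotP_apply, embP_last, sub_ne_zero, Ne, Fin.ext_iff]
      simp only [Fin.val_last]; omega)
    rw [h.1, h.2, i1, i2]
    constructor <;> ring

lemma aux_bij (n : ℕ) : Function.Bijective
    (fun x : Fin (n+1) × Equiv.Perm (Fin n) => rotP x.1 (embP x.2)) := by
  rw [Fintype.bijective_iff_injective_and_card]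
  constructor
  · rintro ⟨k, σ⟩ ⟨l, τ⟩ h
    have h' : ∀ i, embP σ i - k = embP τ i - l := fun i => DFunLike.congr_fun h i
    have hkl : k = l := by
      have := h' (Fin.last n)
      rw [embP_last, embP_last] at this
      exact sub_right_injective this
    subst hkl
    congr 1
    ext i
    have := sub_left_injective (h' i.castSucc)
    rw [embP_castSucc, embP_castSucc] at this
    exact congrArg Fin.val (Fin.castSucc_injective _ this)
  · simp [Fintype.card_perm, Nat.factorial_succ]

theorem maj_sqin_distribution (n : ℕ) (hn : 0 < n) :
    (∑ π : Equiv.Perm (Fin n),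
        (X 0 : MvPolynomial (Fin 2) ℤ) ^ maj π * X 1 ^ sqin π) =
    ∏ i ∈ Finset.range n, ∑ j ∈ Finset.range (i + 1),
        ((X 0 : MvPolynomial (Fin 2) ℤ) * X 1 ^ (i + 1)) ^ j := by
  induction n with
  | zero => omega
  | succ n ih =>
    rcases n with _ | n
    · have h1 : maj (1 : Equiv.Perm (Fin 1)) = 0 := by decide
      have h2 : sqin (1 : Equiv.Perm (Fin 1)) = 0 := by decide
      rw [Fintype.sum_subsingleton _ (1 : Equiv.Perm (Fin 1)), h1, h2]
      simp
    · rw [Finset.prod_range_succ, ← ih (by omega),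
        ← Function.Bijective.sum_comp (aux_bij (n+1)), Fintype.sum_prod_type,
        Finset.sum_comm, Finset.sum_mul]
      refine Finset.sum_congr rfl fun σ _ => ?_
      rw [Finset.mul_sum, Finset.sum_range]
      refine Finset.sum_congr rfl fun k _ => ?_
      have := aux_rot_emb σ k k.isLt
      simp only [Fin.eta] at this
      rw [this.1, this.2]
      ring
end

section
/- For every positive integer n, the following identity holds in the polynomial ring ℤ[u,q]: ∑_{π ∈ S_n} u^{maj π} q^{binv π} · ∏_{i=1}^{n} (1 − u² q^{i+1}) = ∏_{i=1}^{n} (1 − u^{i} q^{i(i+1)/2}) (1 + u q^{i}). -/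
open MvPolynomial

/-- `binv π = bin π + inv π`, where `bin π = ∑_{i ∈ Des π} C(i+1, 2)`. -/
def binv {n : ℕ} (π : Equiv.Perm (Fin n)) : ℕ :=
  (∑ j ∈ descents π, Nat.choose ((j : ℕ) + 1) 2) + invStat π

namespace MajBinv

open Finset

section comb

/-- Append the letter `v` at the end of `σ`, standardizing. -/
def extFun {n : ℕ} (v : Fin (n + 1)) (σ : Equiv.Perm (Fin n)) : Fin (n + 1) → Fin (n + 1) :=
  fun i => Fin.lastCases (motive := fun _ => Fin (n + 1)) v (fun i => v.succAbove (σ i)) i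

lemma extFun_last {n : ℕ} (v : Fin (n + 1)) (σ : Equiv.Perm (Fin n)) :
    extFun v σ (Fin.last n) = v := by simp [extFun]

lemma extFun_castSucc {n : ℕ} (v : Fin (n + 1)) (σ : Equiv.Perm (Fin n)) (i : Fin n) :
    extFun v σ i.castSucc = v.succAbove (σ i) := by simp [extFun]

lemma extFun_inj {n : ℕ} (v : Fin (n + 1)) (σ : Equiv.Perm (Fin n)) :
    Function.Injective (extFun v σ) := by
  intro i j
  refine Fin.lastCases ?_ (fun i => ?_) i <;> refine Fin.lastCases ?_ (fun j => ?_) j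
  · simp
  · intro h
    rw [extFun_last, extFun_castSucc] at h
    exact absurd h.symm (Fin.succAbove_ne _ _)
  · intro h
    rw [extFun_last, extFun_castSucc] at h
    exact absurd h (Fin.succAbove_ne _ _)
  · intro h
    rw [extFun_castSucc, extFun_castSucc] at h
    rw [σ.injective (Fin.succAbove_right_injective h)]

noncomputable def ext {n : ℕ} (v : Fin (n + 1)) (σ : Equiv.Perm (Fin n)) :
    Equiv.Perm (Fin (n + 1)) :=
  Equiv.ofBijective (extFun v σ) (Finite.injective_iff_bijective.mp (extFun_inj v σ))

lemma ext_last {n : ℕ} (v : Fin (n + 1)) (σ : Equiv.Perm (Fin n)) :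
    ext v σ (Fin.last n) = v := extFun_last v σ

lemma ext_castSucc {n : ℕ} (v : Fin (n + 1)) (σ : Equiv.Perm (Fin n)) (i : Fin n) :
    ext v σ i.castSucc = v.succAbove (σ i) := extFun_castSucc v σ i

lemma ext_bij (n : ℕ) : Function.Bijective
    (fun p : Fin (n + 1) × Equiv.Perm (Fin n) => ext p.1 p.2) := by
  rw [Fintype.bijective_iff_injective_and_card]
  constructor
  · rintro ⟨v, σ⟩ ⟨w, τ⟩ h
    simp only at h
    have h1 : v = w := by rw [← ext_last v σ, h, ext_last]
    subst h1
    have : σ = τ := by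
      ext1 i
      have := congrArg (fun e => e i.castSucc) h
      simp only [ext_castSucc] at this
      exact Fin.succAbove_right_injective this
    rw [this]
  · simp [Fintype.card_perm, Nat.factorial_succ]

lemma sum_ext {M : Type*} [AddCommMonoid M] (n : ℕ) (f : Equiv.Perm (Fin (n + 1)) → M) :
    ∑ π, f π = ∑ v : Fin (n + 1), ∑ σ : Equiv.Perm (Fin n), f (ext v σ) := by
  rw [← Fintype.sum_prod_type' (f := fun v σ => f (ext v σ))]
  exact ((ext_bij n).sum_comp f).symm

lemma lt_succAbove' {n : ℕ} (v : Fin (n + 1)) (i : Fin n) :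
    v < v.succAbove i ↔ (v : ℕ) ≤ i := by
  rw [Fin.lt_succAbove_iff_le_castSucc]; rfl

lemma count_ge (n v : ℕ) : (∑ k : Fin n, if v ≤ (k : ℕ) then 1 else 0) = n - v := by
  rw [Fin.sum_univ_eq_sum_range (fun k => if v ≤ k then 1 else 0) n]
  induction n with
  | zero => simp
  | succ n ih => rw [Finset.sum_range_succ, ih]; split_ifs <;> omega

lemma invStat_eq {n : ℕ} (π : Equiv.Perm (Fin n)) :
    invStat π = ∑ i, ∑ j, if i < j ∧ π j < π i then 1 else 0 := by
  rw [invStat, Finset.card_filter, Fintype.sum_prod_type]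

lemma invStat_ext {n : ℕ} (v : Fin (n + 1)) (σ : Equiv.Perm (Fin n)) :
    invStat (ext v σ) = invStat σ + (n - v) := by
  have key : ∑ i : Fin n, (if (v : ℕ) ≤ σ i then 1 else 0) = n - v := by
    rw [Equiv.sum_comp σ (fun k : Fin n => if (v : ℕ) ≤ k then 1 else 0), count_ge]
  rw [invStat_eq, invStat_eq, Fin.sum_univ_castSucc]
  simp only [Fin.sum_univ_castSucc (n := n), ext_last, ext_castSucc, lt_succAbove',
    Finset.sum_add_distrib, Fin.castSucc_lt_castSucc_iff, Fin.succAbove_lt_succAbove_iff,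
    Fin.castSucc_lt_last, true_and, key]
  have h2 : ∀ i : Fin n, ¬ (Fin.last n < i.castSucc) := fun i => not_lt.mpr (Fin.le_last _)
  simp [h2]

/-- all entries in the last position are less than `v`. -/
def LastLt {n : ℕ} (π : Equiv.Perm (Fin n)) (v : ℕ) : Prop :=
  ∀ i : Fin n, (i : ℕ) + 1 = n → (π i : ℕ) < v

lemma lastLt_ext {n : ℕ} (w : Fin (n + 1)) (σ : Equiv.Perm (Fin n)) (v : ℕ) :
    LastLt (ext w σ) v ↔ (w : ℕ) < v := by
  constructor
  · intro h
    have := h (Fin.last n) (by simp)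
    rwa [ext_last] at this
  · intro h i hi
    have : i = Fin.last n := by ext; simp; omega
    rw [this, ext_last]; exact h

variable {R : Type*} [CommRing R]

/-- weight -/
def wt (q : R) (x : ℕ → R) {n : ℕ} (π : Equiv.Perm (Fin n)) : R :=
  q ^ invStat π * ∏ j ∈ descents π, x j

open Classical in
lemma prod_ext (x : ℕ → R) {n : ℕ} (v : Fin (n + 1)) (σ : Equiv.Perm (Fin n)) :
    ∏ j ∈ descents (ext v σ), x j =
      (∏ j ∈ descents σ, x j) * (if LastLt σ v then 1 else x n) := by
  rw [descents, descents, Finset.prod_filter, Finset.prod_filter, Fin.prod_univ_castSucc]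
  congr 1
  · refine Finset.prod_congr rfl fun j _ => ?_
    have : (∃ i : Fin (n + 1), (i : ℕ) + 1 = (j.castSucc : ℕ) ∧ ext v σ j.castSucc < ext v σ i) ↔
        (∃ i : Fin n, (i : ℕ) + 1 = (j : ℕ) ∧ σ j < σ i) := by
      constructor
      · rintro ⟨i, hi, h⟩
        have hin : (i : ℕ) < n := by have := j.2; simp at hi; omega
        refine ⟨⟨i, hin⟩, by simpa using hi, ?_⟩
        have e : i = (⟨i, hin⟩ : Fin n).castSucc := rfl
        rw [e, ext_castSucc, ext_castSucc, Fin.succAbove_lt_succAbove_iff] at h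
        exact h
      · rintro ⟨i, hi, h⟩
        refine ⟨i.castSucc, by simpa using hi, ?_⟩
        rw [ext_castSucc, ext_castSucc, Fin.succAbove_lt_succAbove_iff]
        exact h
    simp only [Fin.val_castSucc] at this ⊢
    simp only [this]
  · have : (∃ i : Fin (n + 1), (i : ℕ) + 1 = (Fin.last n : ℕ) ∧
        ext v σ (Fin.last n) < ext v σ i) ↔ ¬ LastLt σ v := by
      unfold LastLt
      push Not
      constructor
      · rintro ⟨i, hi, h⟩
        have hin : (i : ℕ) < n := by simp at hi; omega
        refine ⟨⟨i, hin⟩, by simpa using hi, ?_⟩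
        have e : i = (⟨i, hin⟩ : Fin n).castSucc := rfl
        rw [e, ext_castSucc, ext_last, lt_succAbove'] at h
        exact h
      · rintro ⟨i, hi, h⟩
        refine ⟨i.castSucc, by simpa using hi, ?_⟩
        rw [ext_castSucc, ext_last, lt_succAbove']
        exact h
    simp only [Fin.val_last] at this ⊢
    simp only [this, ite_not]

/-- recursive model -/
def T (q : R) (x : ℕ → R) : ℕ → ℕ → R
  | 0, _ => 1
  | n + 1, v => ∑ w ∈ range v, q ^ (n - w) * (T q x n w + x n * (T q x n n - T q x n w))

open Classical in
lemma sum_eq_T (q : R) (x : ℕ → R) (n : ℕ) : ∀ v ≤ n,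
    ∑ π : Equiv.Perm (Fin n), (if LastLt π v then wt q x π else 0) = T q x n v := by
  induction n with
  | zero =>
    intro v _
    simp [LastLt, wt, invStat, descents, T]
  | succ n ih =>
    intro v hv
    rw [sum_ext]
    have h1 : ∀ w : Fin (n + 1), ∑ σ : Equiv.Perm (Fin n),
        (if LastLt (ext w σ) v then wt q x (ext w σ) else 0) =
        if (w : ℕ) < v then
          q ^ (n - (w : ℕ)) * (T q x n w + x n * (T q x n n - T q x n w)) else 0 := by
      intro w
      simp only [lastLt_ext]
      split_ifs with hw
      · rw [← ih n le_rfl, ← ih w (by omega), ← Finset.sum_sub_distrib, Finset.mul_sum,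
          ← Finset.sum_add_distrib, Finset.mul_sum]
        refine Finset.sum_congr rfl fun σ _ => ?_
        have hl : LastLt σ n := fun i _ => (σ i).2
        rw [wt, invStat_ext, prod_ext, pow_add, wt, if_pos hl]
        split_ifs <;> ring
      · simp
    rw [Finset.sum_congr rfl fun w _ => h1 w, Fin.sum_univ_eq_sum_range
      (fun w => if w < v then
          q ^ (n - w) * (T q x n w + x n * (T q x n n - T q x n w)) else 0) (n + 1),
      ← Finset.sum_filter, T]
    refine Finset.sum_congr ?_ fun _ _ => rfl
    ext w; simp; omega

lemma total_eq_T (q : R) (x : ℕ → R) (n : ℕ) :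
    ∑ π : Equiv.Perm (Fin n), wt q x π = T q x n n := by
  classical
  rw [← sum_eq_T q x n n le_rfl]
  refine Finset.sum_congr rfl fun σ _ => ?_
  have hl : LastLt σ n := fun i _ => (σ i).2
  rw [if_pos hl]

lemma T_congr (q : R) {x y : ℕ → R} (n : ℕ) (h : ∀ i < n, x i = y i) :
    ∀ v, T q x n v = T q y n v := by
  induction n with
  | zero => intro v; rfl
  | succ n ih =>
    intro v
    have ih' := ih fun i hi => h i (by omega)
    simp only [T, ih', h n (by omega)]

/-- truncation -/
def trunc (x : ℕ → R) (k : ℕ) : ℕ → R := fun i => if i < k then x i else 0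
/-- truncation with a free position -/
def free (x : ℕ → R) (k : ℕ) : ℕ → R := fun i => if i < k then x i else if i = k then 1 else 0

lemma T_lin (q : R) (x : ℕ → R) (k n : ℕ) : ∀ v,
    T q (trunc x (k + 1)) n v = (1 - x k) * T q (trunc x k) n v + x k * T q (free x k) n v := by
  induction n with
  | zero => intro v; simp [T]
  | succ n ih =>
    intro v
    simp only [T, Finset.mul_sum, ← Finset.sum_add_distrib]
    refine Finset.sum_congr rfl fun w _ => ?_
    rcases lt_trichotomy n k with h | h | h
    · have e1 : trunc x (k + 1) n = x n := by simp [trunc]; omega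
      have e2 : trunc x k n = x n := by simp [trunc]; omega
      have e3 : free x k n = x n := by simp [free]; omega
      rw [ih, ih, e1, e2, e3]; ring
    · subst h
      have f1 : ∀ v, T q (trunc x (n + 1)) n v = T q x n v :=
        T_congr q n fun i hi => by simp [trunc]; omega
      have f2 : ∀ v, T q (trunc x n) n v = T q x n v :=
        T_congr q n fun i hi => by simp [trunc]; omega
      have f3 : ∀ v, T q (free x n) n v = T q x n v :=
        T_congr q n fun i hi => by simp [free]; omega
      have e1 : trunc x (n + 1) n = x n := by simp [trunc]
      have e2 : trunc x n n = 0 := by simp [trunc]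
      have e3 : free x n n = 1 := by simp [free]
      rw [f1, f1, f2, f2, f3, f3, e1, e2, e3]; ring
    · have e1 : trunc x (k + 1) n = 0 := by simp [trunc]; omega
      have e2 : trunc x k n = 0 := by simp [trunc]; omega
      have e3 : free x k n = 0 := by
        simp only [free]; rw [if_neg (by omega), if_neg (by omega)]
      rw [ih, ih, e1, e2, e3]; ring

/-- q-binomials -/
def P (q : R) : ℕ → ℕ → R
  | _, 0 => 1
  | 0, _ + 1 => 0
  | v + 1, m + 1 => q ^ (m + 1) * P q v (m + 1) + P q v m

def Q (q : R) : ℕ → ℕ → R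
  | _, 0 => 1
  | 0, _ + 1 => 0
  | n + 1, k + 1 => Q q n (k + 1) + q ^ (n - k) * Q q n k

lemma P_zero (q : R) (n : ℕ) : P q n 0 = 1 := by cases n <;> rfl
lemma Q_zero (q : R) (n : ℕ) : Q q n 0 = 1 := by cases n <;> rfl

lemma P_lt (q : R) (n : ℕ) : ∀ m, n < m → P q n m = 0 := by
  induction n with
  | zero => intro m hm; obtain ⟨m, rfl⟩ : ∃ k, m = k + 1 := ⟨m - 1, by omega⟩; rfl
  | succ n ih =>
    intro m hm; obtain ⟨m, rfl⟩ : ∃ k, m = k + 1 := ⟨m - 1, by omega⟩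
    rw [P, ih _ (by omega), ih _ (by omega)]; simp

lemma Q_lt (q : R) (n : ℕ) : ∀ m, n < m → Q q n m = 0 := by
  induction n with
  | zero => intro m hm; obtain ⟨m, rfl⟩ : ∃ k, m = k + 1 := ⟨m - 1, by omega⟩; rfl
  | succ n ih =>
    intro m hm; obtain ⟨m, rfl⟩ : ∃ k, m = k + 1 := ⟨m - 1, by omega⟩
    rw [Q, ih _ (by omega), ih _ (by omega)]; simp

lemma Q_self (q : R) (n : ℕ) : Q q n n = 1 := by
  induction n with
  | zero => rfl
  | succ n ih => rw [Q, ih, Q_lt q n _ (by omega)]; simp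

lemma P_eq_Q (q : R) (n : ℕ) : ∀ k m, k + m = n → P q n m = Q q n k := by
  induction n with
  | zero =>
    intro k m h
    obtain ⟨rfl, rfl⟩ : k = 0 ∧ m = 0 := by omega
    rfl
  | succ n ih =>
    intro k m h
    rcases k with _ | k
    · obtain rfl : m = n + 1 := by omega
      rw [P, P_lt q n _ (by omega), ih 0 n (by omega), Q_zero, Q_zero]; simp
    · rcases m with _ | m
      · obtain rfl : k = n := by omega
        rw [Q_self, P_zero]
      · rw [P, Q, ih k (m + 1) (by omega), ih (k + 1) m (by omega)]
        rw [show n - k = m + 1 by omega]; ring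

lemma P_sum (q : R) (N m : ℕ) : ∀ w ≤ N + 1,
    ∑ w' ∈ range w, q ^ ((m + 1) * (N - w')) * P q w' m =
      q ^ ((m + 1) * (N + 1 - w)) * P q w (m + 1) := by
  intro w
  induction w with
  | zero => intro _; simp [P]
  | succ w ih =>
    intro hw
    rw [Finset.sum_range_succ, ih (by omega), P, show N + 1 - w = (N - w) + 1 by omega,
      show N + 1 - (w + 1) = N - w by omega]
    ring

lemma U_eq (q : R) (x : ℕ → R) (k m : ℕ) : ∀ w ≤ k + m,
    T q (free x k) (k + m) w + free x k (k + m) *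
      (T q (free x k) (k + m) (k + m) - T q (free x k) (k + m) w) =
    q ^ (m * (k + m - w)) * P q w m * T q x k k := by
  have f3 : ∀ v, T q (free x k) k v = T q x k v :=
    T_congr q k fun i hi => by simp [free]; omega
  induction m with
  | zero =>
    intro w hw
    have e3 : free x k k = 1 := by simp [free]
    simp [f3, e3, P_zero]
  | succ m ih =>
    intro w hw
    have e : free x k (k + (m + 1)) = 0 := by
      simp only [free]; rw [if_neg (by omega), if_neg (by omega)]
    rw [e, zero_mul, add_zero, ← add_assoc, T, ← P_sum q (k + m) m w (by omega),
      Finset.sum_mul]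
    refine Finset.sum_congr rfl fun w' hw' => ?_
    rw [ih w' (by have := Finset.mem_range.mp hw'; omega)]
    ring

lemma B_eq (q : R) (x : ℕ → R) (n k : ℕ) (hk : k ≤ n) :
    T q (free x k) n n = Q q n k * T q x k k := by
  obtain ⟨m, rfl⟩ := Nat.exists_eq_add_of_le hk
  have := U_eq q x k m (k + m) le_rfl
  rw [sub_self, mul_zero, add_zero, Nat.sub_self, mul_zero, pow_zero, one_mul] at this
  rw [this, P_eq_Q q (k + m) k m rfl]

lemma main_rec (q : R) (x : ℕ → R) (hx : x 0 = 1) (G : ℕ → R)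
    (hG : ∀ n, ∑ k ∈ range (n + 1), Q q n k * x k * G k = G n) (hG0 : G 0 = 1) (n : ℕ) :
    T q x n n = (∏ i ∈ range n, (1 - x (i + 1))) * G n := by
  induction n using Nat.strong_induction_on with
  | _ n ih =>
  rcases n with _ | n
  · simp [T, hG0]
  · have hS : ∀ k, k ≤ n → T q (trunc x (k + 1)) (n + 1) (n + 1) =
        (∏ i ∈ range k, (1 - x (i + 1))) * ∑ j ∈ range (k + 1), Q q (n + 1) j * x j * G j := by
      intro k
      induction k with
      | zero =>
        intro _
        rw [T_lin, B_eq _ _ _ _ (by omega), ih 0 (by omega), hx]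
        simp [hx]
      | succ k ihk =>
        intro hk
        rw [T_lin, B_eq _ _ _ _ (by omega), ih (k + 1) (by omega), ihk (by omega),
          Finset.sum_range_succ _ (k + 1), Finset.prod_range_succ _ k]
        ring
    have h1 := hS n le_rfl
    rw [T_congr q (n + 1) (y := x) (fun i hi => by simp [trunc]; omega)] at h1
    have h2 := hG (n + 1)
    rw [Finset.sum_range_succ, Q_self, one_mul] at h2
    rw [h1, Finset.prod_range_succ, eq_sub_of_add_eq h2]
    ring

end comb

lemma vandermonde {K : Type*} [Field K] (q a : K) (n : ℕ) : ∀ b : K,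
    (∀ i : ℕ, 1 - a * b * q ^ i ≠ 0) →
    ∑ k ∈ range (n + 1), Q q n k * q ^ (k.choose 2) * (-a) ^ k *
      ∏ i ∈ range k, ((1 - b * q ^ i) / (1 - a * b * q ^ i)) =
    ∏ i ∈ range n, ((1 - a * q ^ i) / (1 - a * b * q ^ i)) := by
  induction n with
  | zero => intro b _; simp [Q]
  | succ n ih =>
    intro b hb
    have hb' : ∀ i : ℕ, 1 - a * (b * q) * q ^ i ≠ 0 := by
      intro i h; apply hb (i + 1); rw [← h]; ring
    have h1 := ih b hb
    have h2 := ih (b * q) hb'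
    have e1 : ∑ k ∈ range (n + 1), Q q n k * q ^ (k.choose 2) * (-a) ^ k *
        ∏ i ∈ range k, ((1 - b * q ^ i) / (1 - a * b * q ^ i)) =
        (∑ k ∈ range (n + 1), Q q n (k + 1) * q ^ ((k + 1).choose 2) * (-a) ^ (k + 1) *
        ∏ i ∈ range (k + 1), ((1 - b * q ^ i) / (1 - a * b * q ^ i))) + 1 := by
      have := Finset.sum_range_succ' (fun k => Q q n k * q ^ (k.choose 2) * (-a) ^ k *
        ∏ i ∈ range k, ((1 - b * q ^ i) / (1 - a * b * q ^ i))) (n + 1)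
      rw [Finset.sum_range_succ, Q_lt q n (n + 1) (by omega)] at this
      simpa [Q_zero] using this
    have e2 : ∑ k ∈ range (n + 1), (q ^ (n - k) * Q q n k) * q ^ ((k + 1).choose 2) *
          (-a) ^ (k + 1) *
          ∏ i ∈ range (k + 1), ((1 - b * q ^ i) / (1 - a * b * q ^ i)) =
        -a * q ^ n * ((1 - b) / (1 - a * b)) *
          ∏ i ∈ range n, ((1 - a * q ^ i) / (1 - a * (b * q) * q ^ i)) := by
      rw [← h2, Finset.mul_sum]
      refine Finset.sum_congr rfl fun k hk => ?_
      have hk' : k ≤ n := by have := Finset.mem_range.mp hk; omega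
      rw [Finset.prod_range_succ', Nat.choose_succ_succ' k 1, Nat.choose_one_right,
        ← Nat.sub_add_cancel hk']
      have e3 : ∀ i : ℕ, (1 - b * q ^ (i + 1)) / (1 - a * b * q ^ (i + 1)) =
          (1 - b * q * q ^ i) / (1 - a * (b * q) * q ^ i) := by
        intro i; congr 1 <;> ring
      simp only [e3, Nat.add_sub_cancel, pow_zero, mul_one, Nat.sub_add_cancel hk']
      conv_rhs => rw [← Nat.sub_add_cancel hk', pow_add]
      simp only [Nat.sub_add_cancel hk']
      ring
    rw [Finset.sum_range_succ', Finset.prod_range_succ]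
    simp only [Q, add_mul, Finset.sum_add_distrib]
    rw [e2]
    rw [e1] at h1
    rw [Finset.prod_div_distrib] at h1 ⊢
    rw [Finset.prod_div_distrib (f := fun i => 1 - a * q ^ i) (g := fun i => 1 - a * b * q ^ i)]
    have h3 : (∏ i ∈ range n, (1 - a * (b * q) * q ^ i)) * (1 - a * b) =
        (∏ i ∈ range n, (1 - a * b * q ^ i)) * (1 - a * b * q ^ n) := by
      rw [← Finset.prod_range_succ (fun i => 1 - a * b * q ^ i), Finset.prod_range_succ']
      rw [pow_zero, mul_one]
      congr 1
      refine Finset.prod_congr rfl fun i _ => ?_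
      ring
    have hD : (∏ i ∈ range n, (1 - a * b * q ^ i)) ≠ 0 :=
      Finset.prod_ne_zero_iff.mpr fun i _ => hb i
    have hD' : (∏ i ∈ range n, (1 - a * (b * q) * q ^ i)) ≠ 0 :=
      Finset.prod_ne_zero_iff.mpr fun i _ => hb' i
    have hn := hb n
    have h0 : 1 - a * b ≠ 0 := by simpa using hb 0
    rw [eq_sub_of_add_eq h1]
    simp only [Nat.choose_zero_succ, pow_zero, Finset.prod_range_zero, mul_one]
    generalize (∏ i ∈ range n, (1 - a * b * q ^ i)) = D at *
    generalize (∏ i ∈ range n, (1 - a * (b * q) * q ^ i)) = D' at *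
    generalize (∏ i ∈ range n, (1 - a * q ^ i)) = N at *
    have h4 : -a * q ^ n * ((1 - b) / (1 - a * b)) * (N / D') =
        -a * q ^ n * (1 - b) * N / (D * (1 - a * b * q ^ n)) := by
      rw [← h3]; field_simp
    rw [h4]
    generalize hE : 1 - a * b * q ^ n = E at *
    field_simp
    rw [← hE]
    ring

lemma field_version {K : Type*} [Field K] (u q : K)
    (h : ∀ i : ℕ, 1 - u ^ 2 * q ^ (i + 2) ≠ 0) (n : ℕ) :
    (∑ π : Equiv.Perm (Fin n), u ^ maj π * q ^ binv π) *
      ∏ i ∈ range n, (1 - u ^ 2 * q ^ (i + 2)) =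
    ∏ i ∈ range n, ((1 - u ^ (i + 1) * q ^ ((i + 1) * (i + 2) / 2)) *
        (1 + u * q ^ (i + 1))) := by
  have hs : ∑ π : Equiv.Perm (Fin n), u ^ maj π * q ^ binv π =
      ∑ π : Equiv.Perm (Fin n), wt q (fun k => u ^ k * q ^ ((k + 1).choose 2)) π := by
    refine Finset.sum_congr rfl fun π _ => ?_
    rw [wt, maj, binv, Finset.prod_mul_distrib, Finset.prod_pow_eq_pow_sum,
      Finset.prod_pow_eq_pow_sum, pow_add]
    ring
  have hab : ∀ i : ℕ, (-(u * q)) * (-(u * q)) * q ^ i = u ^ 2 * q ^ (i + 2) := by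
    intro i; ring
  rw [hs, total_eq_T, main_rec q _ (by simp)
    (fun k => ∏ i ∈ range k, ((1 - (-(u * q)) * q ^ i) /
      (1 - (-(u * q)) * (-(u * q)) * q ^ i))) ?_ (by simp) n]
  · simp only [hab]
    rw [Finset.prod_div_distrib, mul_assoc, div_mul_cancel₀ _
      (Finset.prod_ne_zero_iff.mpr fun i _ => h i), ← Finset.prod_mul_distrib]
    refine Finset.prod_congr rfl fun i _ => ?_
    rw [Nat.choose_two_right, Nat.add_sub_cancel, mul_comm (i + 1 + 1) (i + 1)]
    ring
  · intro m
    rw [← vandermonde q (-(u * q)) m (-(u * q)) (fun i => by rw [hab]; exact h i)]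
    refine Finset.sum_congr rfl fun k _ => ?_
    rw [Nat.choose_succ_succ' k 1, Nat.choose_one_right]
    ring

end MajBinv

/-- **Bright–Savage**: in `ℤ[u, q]` (variables `0 = u`, `1 = q`),
`(∑_{π ∈ S_n} u^{maj π} q^{binv π}) ⬝ ∏_{i=1}^n (1 - u² q^{i+1})
  = ∏_{i=1}^n (1 - u^i q^{i(i+1)/2})(1 + u q^i)`. -/
theorem maj_binv_distribution (n : ℕ) (hn : 0 < n) :
    (∑ π : Equiv.Perm (Fin n),
        (X 0 : MvPolynomial (Fin 2) ℤ) ^ maj π * X 1 ^ binv π) *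
      ∏ i ∈ Finset.range n,
        (1 - (X 0 : MvPolynomial (Fin 2) ℤ) ^ 2 * X 1 ^ (i + 2)) =
    ∏ i ∈ Finset.range n,
      ((1 - (X 0 : MvPolynomial (Fin 2) ℤ) ^ (i + 1) * X 1 ^ ((i + 1) * (i + 2) / 2)) *
        (1 + (X 0 : MvPolynomial (Fin 2) ℤ) * X 1 ^ (i + 1))) := by
  apply IsFractionRing.injective (MvPolynomial (Fin 2) ℤ) (FractionRing (MvPolynomial (Fin 2) ℤ))
  have h := MajBinv.field_version
    (algebraMap (MvPolynomial (Fin 2) ℤ) (FractionRing (MvPolynomial (Fin 2) ℤ)) (X 0))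
    (algebraMap (MvPolynomial (Fin 2) ℤ) (FractionRing (MvPolynomial (Fin 2) ℤ)) (X 1))
    (fun i => by
      rw [← map_pow, ← map_pow, ← map_mul, ← map_one (algebraMap (MvPolynomial (Fin 2) ℤ)
        (FractionRing (MvPolynomial (Fin 2) ℤ))), ← map_sub]
      intro h0
      have h1 := (IsFractionRing.injective (MvPolynomial (Fin 2) ℤ)
        (FractionRing (MvPolynomial (Fin 2) ℤ))) (h0.trans (map_zero _).symm)
      have h2 := congrArg (MvPolynomial.eval (fun _ => (0 : ℤ))) h1
      simp at h2) n
  simpa only [map_mul, map_sum, map_prod, map_pow, map_sub, map_add, map_one] using h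
end

section
/- For every sequence s = (s_1,…,s_n) of positive integers, in the ring of formal power series ℤ[[x]] one has (1 − x)^{n} · ∑_{λ ∈ L_n^{(s)}} x^{⌈λ_n/s_n⌉} = ∑_{e ∈ I_n^{(s)}} x^{asc e}. -/
open PowerSeries

/-- The number of ascents of an `s`-inversion sequence `e ∈ I_n^{(s)}`
(modelled as `e : Π i, Fin (s i)`), with the convention `e₀ = 0`, `s₀ = 1`:
position `j` is an ascent iff `e_{j-1}/s_{j-1} < e_j/s_j` (cross-multiplied), the
boundary case `j = 0` meaning `0/1 < e₁/s₁`, i.e. `0 < e₁`.  (Positions here are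
0-based; the ascent `i` of the paper at the pair `(e_i, e_{i+1})` corresponds to
`j = i`.) -/
def ascCount (n : ℕ) (s : Fin n → ℕ) (e : ∀ i : Fin n, Fin (s i)) : ℕ :=
  (Finset.univ.filter fun j : Fin n =>
    ((j : ℕ) = 0 ∧ 0 < ((e j : ℕ))) ∨
    ∃ i : Fin n, (i : ℕ) + 1 = (j : ℕ) ∧ (e i : ℕ) * s j < (e j : ℕ) * s i).card

def ascPred (n : ℕ) (s : Fin n → ℕ) (e : ∀ i : Fin n, Fin (s i)) (j : Fin n) : Prop :=
  ((j : ℕ) = 0 ∧ 0 < ((e j : ℕ))) ∨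
    ∃ i : Fin n, (i : ℕ) + 1 = (j : ℕ) ∧ (e i : ℕ) * s j < (e j : ℕ) * s i

open Classical in
noncomputable def ascInd (n : ℕ) (s : Fin n → ℕ) (e : ∀ i : Fin n, Fin (s i)) (j : Fin n) : ℕ :=
  if ascPred n s e j then 1 else 0

lemma ascCount_eq (n : ℕ) (s : Fin n → ℕ) (e : ∀ i : Fin n, Fin (s i)) :
    ascCount n s e = ∑ j, ascInd n s e j := by
  classical
  unfold ascCount ascInd ascPred
  rw [Finset.card_filter]
  apply Finset.sum_congr rfl
  intro j _
  congr

lemma ascInd_zero (n : ℕ) (s : Fin n → ℕ) (e : ∀ i : Fin n, Fin (s i)) (j : Fin n)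
    (hj : (j : ℕ) = 0) : ascInd n s e j = if 0 < (e j : ℕ) then 1 else 0 := by
  unfold ascInd ascPred
  congr 1
  simp [hj]

lemma ascInd_succ (n : ℕ) (s : Fin n → ℕ) (e : ∀ i : Fin n, Fin (s i)) (i j : Fin n)
    (hj : (j : ℕ) = i + 1) :
    ascInd n s e j = if (e i : ℕ) * s j < (e j : ℕ) * s i then 1 else 0 := by
  unfold ascInd ascPred
  congr 1
  apply propext
  constructor
  · rintro (h | ⟨k, hk, h⟩)
    · omega
    · have : k = i := Fin.ext (by omega)
      subst this; exact h
  · intro h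
    exact Or.inr ⟨i, hj.symm, h⟩

noncomputable def psum (n : ℕ) (f : Fin n → ℕ) (i : Fin n) : ℕ := ∑ j ∈ Finset.Iic i, f j

lemma psum_zero (n : ℕ) (f : Fin n → ℕ) (j : Fin n) (hj : (j : ℕ) = 0) : psum n f j = f j := by
  unfold psum
  have : Finset.Iic j = {j} := by
    ext k; simp only [Finset.mem_Iic, Finset.mem_singleton, Fin.le_def, Fin.ext_iff]; omega
  rw [this, Finset.sum_singleton]

lemma psum_succ (n : ℕ) (f : Fin n → ℕ) (i j : Fin n) (hj : (j : ℕ) = i + 1) :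
    psum n f j = psum n f i + f j := by
  unfold psum
  have : Finset.Iic j = insert j (Finset.Iic i) := by
    ext k; simp only [Finset.mem_Iic, Finset.mem_insert, Fin.le_def, Fin.ext_iff]; omega
  rw [this, Finset.sum_insert (by simp only [Finset.mem_Iic, Fin.le_def]; omega), add_comm]

lemma psum_last (n : ℕ) (f : Fin n → ℕ) (j : Fin n) (hj : (j : ℕ) = n - 1) :
    psum n f j = ∑ k, f k := by
  unfold psum
  congr 1
  ext k; simp only [Finset.mem_Iic, Finset.mem_univ, Fin.le_def, iff_true]; omega

lemma psum_unique (n : ℕ) (f c : Fin n → ℕ) (h0 : ∀ j : Fin n, (j : ℕ) = 0 → c j = f j)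
    (h1 : ∀ i j : Fin n, (j : ℕ) = i + 1 → c j = c i + f j) : psum n f = c := by
  have : ∀ k : ℕ, ∀ j : Fin n, (j : ℕ) = k → psum n f j = c j := by
    intro k
    induction k with
    | zero => intro j hj; rw [psum_zero n f j hj, h0 j hj]
    | succ k ih =>
      intro j hj
      have hk : k < n := by omega
      rw [psum_succ n f ⟨k, hk⟩ j hj, h1 ⟨k, hk⟩ j hj, ih ⟨k, hk⟩ rfl]
  funext j
  exact this j j rfl

lemma psum_inj (n : ℕ) (f g : Fin n → ℕ) (h : psum n f = psum n g) : f = g := by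
  funext j
  rcases Nat.eq_zero_or_pos (j : ℕ) with hj | hj
  · rw [← psum_zero n f j hj, ← psum_zero n g j hj, h]
  · have h1 := psum_succ n f ⟨j - 1, by omega⟩ j (by simp only; omega)
    have h2 := psum_succ n g ⟨j - 1, by omega⟩ j (by simp only; omega)
    rw [h] at h1
    omega

lemma cdiv_unique (s c e : ℕ) (he : e < s) (hc : e ≤ s * c) : cdiv (s * c - e) s = c := by
  unfold cdiv
  rw [Nat.div_eq_iff (by omega)]
  rw [mul_comm s c] at *
  omega

lemma cdiv_bounds (a s : ℕ) (hs : 0 < s) : a ≤ s * cdiv a s ∧ s * cdiv a s < a + s := by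
  unfold cdiv
  have h1 := Nat.div_add_mod (a + s - 1) s
  have h2 := Nat.mod_lt (a + s - 1) hs
  omega

/-- comparison of consecutive entries -/
lemma step_iff (s t c d e f : ℕ) (he : e < s) (hf : f < t) (hc : e ≤ s * c) (hd : f ≤ t * d) :
    (s * c - e) * t ≤ (t * d - f) * s ↔ c + (if e * t < f * s then 1 else 0) ≤ d := by
  zify [hc, hd]
  have h1 : (e : ℤ) < s := by exact_mod_cast he
  have h2 : (f : ℤ) < t := by exact_mod_cast hf
  have h3 : (0 : ℤ) ≤ e := by positivity
  have h4 : (0 : ℤ) ≤ f := by positivity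
  have hst : (0 : ℤ) < s * t := by apply mul_pos <;> linarith
  have het : (e : ℤ) * t < s * t := by apply mul_lt_mul_of_pos_right h1; linarith
  have hfs : (f : ℤ) * s < s * t := by
    rw [mul_comm (s : ℤ)]; apply mul_lt_mul_of_pos_right h2; linarith
  have het0 : (0 : ℤ) ≤ e * t := by positivity
  have hfs0 : (0 : ℤ) ≤ f * s := by positivity
  have key : ((s : ℤ) * c - e) * t ≤ (t * d - f) * s ↔ (f : ℤ) * s - e * t ≤ (s * t) * (d - c) := by
    constructor <;> intro h <;> nlinarith
  rw [key]
  generalize (e : ℤ) * t = E at *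
  generalize (f : ℤ) * s = F at *
  generalize (s : ℤ) * t = S at *
  constructor
  · intro h
    split_ifs with hh
    · by_contra hcon
      have : (d : ℤ) - c ≤ 0 := by omega
      nlinarith
    · by_contra hcon
      have : (d : ℤ) - c ≤ -1 := by omega
      nlinarith
  · intro h
    split_ifs at h with hh
    · have : 1 ≤ (d : ℤ) - c := by omega
      nlinarith
    · have : 0 ≤ (d : ℤ) - c := by omega
      nlinarith

noncomputable def cvec (n : ℕ) (s : Fin n → ℕ) (e : ∀ i : Fin n, Fin (s i)) (d : Fin n → ℕ) :
    Fin n → ℕ := psum n (fun j => d j + ascInd n s e j)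

lemma cvec_ge (n : ℕ) (s : Fin n → ℕ) (e : ∀ i : Fin n, Fin (s i)) (d : Fin n → ℕ) :
    ∀ k : ℕ, ∀ j : Fin n, (j : ℕ) = k → (e j : ℕ) ≤ s j * cvec n s e d j := by
  intro k
  induction k with
  | zero =>
    intro j hj
    unfold cvec
    rw [psum_zero n _ j hj, ascInd_zero n s e j hj]
    split_ifs with h
    · have := (e j).2
      nlinarith
    · omega
  | succ k ih =>
    intro j hj
    have hi := ih ⟨k, by omega⟩ rfl
    have hj' := (e j).2
    rcases Nat.eq_zero_or_pos (cvec n s e d j) with h0 | h0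
    · unfold cvec at h0 hi
      rw [psum_succ n _ ⟨k, by omega⟩ j hj, ascInd_succ n s e ⟨k, by omega⟩ j hj] at h0
      have hz : psum n (fun j => d j + ascInd n s e j) ⟨k, by omega⟩ = 0 := by omega
      rw [hz] at hi
      have hp := (e ⟨k, by omega⟩).2
      by_cases h : (e ⟨k, by omega⟩ : ℕ) * s j < (e j : ℕ) * s ⟨k, by omega⟩
      · rw [if_pos h] at h0; omega
      · have he0 : (e ⟨k, by omega⟩ : ℕ) = 0 := by omega
        rw [he0] at h hp
        have : (e j : ℕ) = 0 := by
          by_contra hne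
          exact h (by rw [zero_mul]; exact Nat.mul_pos (by omega) hp)
        omega
    · nlinarith

noncomputable def bij (n : ℕ) (hn : 0 < n) (s : Fin n → ℕ) (t : ℕ) :
    (Σ e : (∀ i : Fin n, Fin (s i)), {d : Fin n → ℕ // ∑ i, d i + ascCount n s e = t}) →
    {lam : Fin n → ℕ // IsSLectureHall n s lam ∧
            ∀ j : Fin n, (j : ℕ) = n - 1 → cdiv (lam j) (s j) = t} := fun p =>
  ⟨fun j => s j * cvec n s p.1 p.2.1 j - p.1 j, by
    obtain ⟨e, d, hd⟩ := p
    have hge := fun j : Fin n => cvec_ge n s e d j j rfl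
    constructor
    · intro i j hij
      simp only
      rw [step_iff _ _ _ _ _ _ (e i).2 (e j).2 (hge i) (hge j)]
      rw [← ascInd_succ n s e i j hij]
      unfold cvec
      rw [psum_succ n _ i j hij]
      omega
    · intro j hj
      simp only
      rw [cdiv_unique _ _ _ (e j).2 (hge j)]
      unfold cvec
      rw [psum_last n _ j hj, Finset.sum_add_distrib, ← ascCount_eq, hd]⟩

lemma bij_inj (n : ℕ) (hn : 0 < n) (s : Fin n → ℕ) (t : ℕ) :
    Function.Injective (bij n hn s t) := by
  rintro ⟨e, d, hd⟩ ⟨e', d', hd'⟩ h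
  have hge := fun j : Fin n => cvec_ge n s e d j j rfl
  have hge' := fun j : Fin n => cvec_ge n s e' d' j j rfl
  have h1 : ∀ j, s j * cvec n s e d j - e j = s j * cvec n s e' d' j - e' j := fun j =>
    congrFun (congrArg Subtype.val h) j
  have hc : cvec n s e d = cvec n s e' d' := by
    funext j
    rw [← cdiv_unique _ _ _ (e j).2 (hge j), h1, cdiv_unique _ _ _ (e' j).2 (hge' j)]
  have he : e = e' := by
    funext j
    apply Fin.ext
    have a1 := h1 j
    have a2 := hge j
    have a3 := hge' j
    rw [hc] at a1 a2
    omega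
  subst he
  have hdd : d = d' := by
    have := psum_inj n _ _ hc
    funext j
    have := congrFun this j
    simpa using this
  subst hdd
  rfl

lemma bij_surj (n : ℕ) (hn : 0 < n) (s : Fin n → ℕ) (hs : ∀ i, 0 < s i) (t : ℕ) :
    Function.Surjective (bij n hn s t) := by
  rintro ⟨lam, hl, hlast⟩
  have hb := fun j => cdiv_bounds (lam j) (s j) (hs j)
  obtain ⟨c, hc⟩ : ∃ c : Fin n → ℕ, c = fun j => cdiv (lam j) (s j) := ⟨_, rfl⟩
  have hb' : ∀ j, lam j ≤ s j * c j ∧ s j * c j < lam j + s j := by rw [hc]; exact hb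
  obtain ⟨e, he⟩ : ∃ e : ∀ i : Fin n, Fin (s i), ∀ i, (e i : ℕ) = s i * c i - lam i :=
    ⟨fun i => ⟨s i * c i - lam i, by have := hb' i; have := hs i; omega⟩, fun i => rfl⟩
  have hel : ∀ i, lam i = s i * c i - e i := fun i => by
    have := he i; have := hb' i; omega
  have hec : ∀ i, (e i : ℕ) ≤ s i * c i := fun i => by
    have := he i; omega
  have h0 : ∀ j : Fin n, (j : ℕ) = 0 → ascInd n s e j ≤ c j := by
    intro j hj
    rw [ascInd_zero n s e j hj]
    split_ifs with h
    · have := hec j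
      by_contra hcon
      have hz : c j = 0 := by omega
      rw [hz] at this
      omega
    · omega
  have h1 : ∀ i j : Fin n, (j : ℕ) = i + 1 → c i + ascInd n s e j ≤ c j := by
    intro i j hij
    rw [ascInd_succ n s e i j hij, ← step_iff _ _ _ _ _ _ (e i).2 (e j).2 (hec i) (hec j),
      ← hel, ← hel]
    exact hl i j hij
  obtain ⟨d, hd⟩ : ∃ d : Fin n → ℕ, psum n (fun j => d j + ascInd n s e j) = c := by
    refine ⟨fun j => if h : (j : ℕ) = 0 then c j - ascInd n s e j else
      c j - (c ⟨j - 1, by omega⟩ + ascInd n s e j), psum_unique n _ c ?_ ?_⟩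
    · intro j hj
      have := h0 j hj
      simp only [hj, dif_pos]
      omega
    · intro i j hij
      have := h1 i j hij
      have hi : (⟨(j : ℕ) - 1, by omega⟩ : Fin n) = i := Fin.ext (by simp only; omega)
      have hj0 : ¬ (j : ℕ) = 0 := by omega
      simp only [dif_neg hj0, hi]
      omega
  refine ⟨⟨e, d, ?_⟩, ?_⟩
  · have hl' := hlast ⟨n - 1, by omega⟩ rfl
    have h2 := psum_last n (fun j => d j + ascInd n s e j) ⟨n - 1, by omega⟩ rfl
    rw [hd, Finset.sum_add_distrib, ← ascCount_eq, hc] at h2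
    rw [← h2]
    exact hl'
  · apply Subtype.ext
    funext j
    change s j * cvec n s e d j - e j = lam j
    unfold cvec
    rw [hd, hel]

lemma card_fiber (n a t : ℕ) :
    Finite {d : Fin n → ℕ // ∑ i, d i + a = t} ∧
    (Nat.card {d : Fin n → ℕ // ∑ i, d i + a = t} : ℤ) =
      coeff t ((X : PowerSeries ℤ) ^ a * (PowerSeries.mk 1) ^ n) := by
  by_cases hat : a ≤ t
  · have E : (Finset.finsuppAntidiag (Finset.univ : Finset (Fin n)) (t - a)) ≃
        {d : Fin n → ℕ // ∑ i, d i + a = t} := by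
      refine Equiv.subtypeEquiv Finsupp.equivFunOnFinite ?_
      intro d
      rw [Finset.mem_finsuppAntidiag]
      simp only [Finset.subset_univ, and_true, Finsupp.equivFunOnFinite_apply]
      constructor
      · intro h; rw [h]; omega
      · intro h; have h2 : Finset.univ.sum d + a = t := h; omega
    refine ⟨Finite.of_equiv _ E, ?_⟩
    rw [← Nat.card_congr E, Nat.card_eq_fintype_card, Fintype.card_coe, coeff_X_pow_mul',
      if_pos hat]
    have h := PowerSeries.coeff_prod (R := ℤ) (fun _ : Fin n => PowerSeries.mk 1) (t - a)
      Finset.univ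
    rw [Finset.prod_const, Finset.card_univ, Fintype.card_fin] at h
    rw [h]
    simp
  · have : IsEmpty {d : Fin n → ℕ // ∑ i, d i + a = t} := ⟨fun d => by have := d.2; omega⟩
    refine ⟨inferInstance, ?_⟩
    rw [coeff_X_pow_mul', if_neg hat]
    simp

/-- **Savage–Schuster**: in `ℤ[[x]]`, for any sequence `s` of positive integers,
`(1 - x)^n ⬝ ∑_{λ ∈ L_n^{(s)}} x^{⌈λ_n/s_n⌉} = ∑_{e ∈ I_n^{(s)}} x^{asc e}`. -/
theorem s_lecture_hall_inversion_sequences (n : ℕ) (hn : 0 < n)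
    (s : Fin n → ℕ) (hs : ∀ i, 0 < s i) :
    (1 - (X : PowerSeries ℤ)) ^ n *
      (PowerSeries.mk fun t =>
        (Nat.card {lam : Fin n → ℕ // IsSLectureHall n s lam ∧
            ∀ j : Fin n, (j : ℕ) = n - 1 → cdiv (lam j) (s j) = t} : ℤ)) =
    ∑ e : (∀ i : Fin n, Fin (s i)), (X : PowerSeries ℤ) ^ ascCount n s e := by
  have hmk : (PowerSeries.mk fun t =>
        (Nat.card {lam : Fin n → ℕ // IsSLectureHall n s lam ∧
            ∀ j : Fin n, (j : ℕ) = n - 1 → cdiv (lam j) (s j) = t} : ℤ)) =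
      ∑ e : (∀ i : Fin n, Fin (s i)),
        (X : PowerSeries ℤ) ^ ascCount n s e * (PowerSeries.mk 1) ^ n := by
    ext t
    rw [coeff_mk, ← Nat.card_congr (Equiv.ofBijective _ ⟨bij_inj n hn s t, bij_surj n hn s hs t⟩)]
    have := fun e : (∀ i : Fin n, Fin (s i)) => (card_fiber n (ascCount n s e) t).1
    rw [Nat.card_sigma, map_sum]
    push_cast
    exact Finset.sum_congr rfl fun e _ => (card_fiber n (ascCount n s e) t).2
  rw [hmk, ← Finset.sum_mul, mul_comm, mul_assoc, ← mul_pow, PowerSeries.mk_one_mul_one_sub_eq_one,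
    one_pow, mul_one]
end

section
/- For every sequence s = (s_1,…,s_n) of positive integers, the s-Eulerian polynomial E_n^{(s)}(x) = ∑_{e ∈ I_n^{(s)}} x^{asc e}, viewed as a polynomial with real coefficients, has only real roots (every complex root of E_n^{(s)} is real). -/
open Polynomial

open ComplexConjugate

def GoodSeq (z : ℂ) {m : ℕ} (w : Fin m → ℂ) : Prop :=
  (∀ i j, i ≤ j → 0 ≤ (w j * conj (w i)).im ∧ 0 ≤ (z * w i * conj (w j)).im) ∧ ∀ i, w i ≠ 0

lemma im_sum_nonneg {ι κ : Type*} (S : Finset ι) (T : Finset κ) (a : ι → ℂ) (b : κ → ℂ) (y : ℂ)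
    (h : ∀ i ∈ S, ∀ j ∈ T, 0 ≤ (y * a i * conj (b j)).im) :
    0 ≤ (y * (∑ i ∈ S, a i) * conj (∑ j ∈ T, b j)).im := by
  rw [map_sum, Finset.mul_sum S, Finset.sum_mul_sum, Complex.im_sum]
  refine Finset.sum_nonneg fun i hi => ?_
  rw [Complex.im_sum]
  exact Finset.sum_nonneg fun j hj => h i hi j hj

lemma sum_ne_zero_aux {ι : Type*} (S : Finset ι) (u : ι → ℂ) (z : ℂ) (hz : 0 < z.im) (b : ι)
    (hb : b ∈ S) (hb0 : u b ≠ 0)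
    (h : ∀ j ∈ S, 0 ≤ (u j * conj (u b)).im ∧ 0 ≤ (z * u b * conj (u j)).im) :
    ∑ j ∈ S, u j ≠ 0 := by
  intro h0
  have h1 : ∑ j ∈ S, (u j * conj (u b)) = 0 := by rw [← Finset.sum_mul, h0, zero_mul]
  have h2 : ∑ j ∈ S, (u j * conj (u b)).im = 0 := by rw [← Complex.im_sum, h1]; rfl
  have h3 : ∑ j ∈ S, (u j * conj (u b)).re = 0 := by rw [← Complex.re_sum, h1]; rfl
  have h4 := (Finset.sum_eq_zero_iff_of_nonneg (fun j hj => (h j hj).1)).1 h2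
  have h5 : ∀ j ∈ S, 0 ≤ (u j * conj (u b)).re := by
    intro j hj
    have e1 := h4 j hj
    have e2 := (h j hj).2
    simp only [Complex.mul_im, Complex.mul_re, Complex.conj_re, Complex.conj_im] at e1 e2 ⊢
    by_contra hneg
    push Not at hneg
    have e3 := mul_neg_of_pos_of_neg hz hneg
    have e4 := congrArg (fun t => z.re * t) e1
    simp only [mul_zero] at e4
    linarith
  have h6 := (Finset.sum_eq_zero_iff_of_nonneg h5).1 h3 b hb
  rw [Complex.mul_conj, Complex.ofReal_re] at h6
  exact hb0 (Complex.normSq_eq_zero.1 h6)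

lemma key_ineq (z A B C : ℂ) (hz : 0 < z.im)
    (h1 : 0 ≤ (B * conj A).im) (h2 : 0 ≤ (z * A * conj B).im)
    (h3 : 0 ≤ (C * conj B).im) (h4 : 0 ≤ (z * B * conj C).im) :
    0 ≤ ((z * A + z * B + C) * conj (z * A + B + C)).im ∧
    0 ≤ (z * (z * A + B + C) * conj (z * A + z * B + C)).im := by
  have e1 : ((z * A + z * B + C) * conj (z * A + B + C)).im =
      Complex.normSq z * (B * conj A).im + (z * A * conj B).im + (C * conj B).im
      + (z * B * conj C).im + z.im * Complex.normSq B := by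
    simp [Complex.mul_im, Complex.mul_re, Complex.normSq_apply]; ring
  have e2 : (z * (z * A + B + C) * conj (z * A + z * B + C)).im =
      Complex.normSq z * (B * conj A).im + Complex.normSq z * (z * A * conj B).im
      + Complex.normSq z * (C * conj B).im
      + (z * B * conj C).im + z.im * Complex.normSq (z * A + C) := by
    simp [Complex.mul_im, Complex.mul_re, Complex.normSq_apply]; ring
  have hN := Complex.normSq_nonneg z
  have hB := Complex.normSq_nonneg B
  have hD := Complex.normSq_nonneg (z * A + C)
  rw [e1, e2]
  constructor <;> positivity

lemma good_step (z : ℂ) (hz : 0 < z.im) {m m' : ℕ} (hm : 0 < m) (w : Fin m → ℂ)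
    (hw : GoodSeq z w) (c : Fin m' → Fin m → Prop) [∀ v u, Decidable (c v u)]
    (hc1 : ∀ v u u', u' ≤ u → c v u → c v u') (hc2 : ∀ v v' u, v ≤ v' → c v u → c v' u) :
    GoodSeq z (fun v => ∑ u, (if c v u then z else 1) * w u) := by
  have hlt : ∀ v u u', c v u → ¬ c v u' → u ≤ u' := by
    intro v u u' h h'
    by_contra hh
    exact h' (hc1 v u u' (le_of_not_ge hh) h)
  constructor
  · intro v v' hvv
    set A := ∑ u with c v u, w u with hA
    set B := ∑ u with (¬ c v u ∧ c v' u), w u with hB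
    set C := ∑ u with ¬ c v' u, w u with hC
    have e1 : ∑ u, (if c v u then z else 1) * w u = z * A + B + C := by
      rw [hA, hB, hC, Finset.sum_filter, Finset.sum_filter, Finset.sum_filter, Finset.mul_sum,
        ← Finset.sum_add_distrib, ← Finset.sum_add_distrib]
      refine Finset.sum_congr rfl fun u _ => ?_
      have := hc2 v v' u hvv
      by_cases h : c v u <;> by_cases h' : c v' u <;> simp_all
    have e2 : ∑ u, (if c v' u then z else 1) * w u = z * A + z * B + C := by
      rw [hA, hB, hC, Finset.sum_filter, Finset.sum_filter, Finset.sum_filter, Finset.mul_sum,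
        Finset.mul_sum, ← Finset.sum_add_distrib, ← Finset.sum_add_distrib]
      refine Finset.sum_congr rfl fun u _ => ?_
      have := hc2 v v' u hvv
      by_cases h : c v u <;> by_cases h' : c v' u <;> simp_all
    simp only [e1, e2]
    apply key_ineq z A B C hz
    · rw [← one_mul B]
      apply im_sum_nonneg
      intro i hi j hj
      simp only [Finset.mem_filter, Finset.mem_univ, true_and] at hi hj
      rw [one_mul]
      exact (hw.1 j i (hlt v _ _ hj hi.1)).1
    · apply im_sum_nonneg
      intro i hi j hj
      simp only [Finset.mem_filter, Finset.mem_univ, true_and] at hi hj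
      exact (hw.1 i j (hlt v _ _ hi hj.1)).2
    · rw [← one_mul C]
      apply im_sum_nonneg
      intro i hi j hj
      simp only [Finset.mem_filter, Finset.mem_univ, true_and] at hi hj
      rw [one_mul]
      exact (hw.1 j i (hlt v' _ _ hj.2 hi)).1
    · apply im_sum_nonneg
      intro i hi j hj
      simp only [Finset.mem_filter, Finset.mem_univ, true_and] at hi hj
      exact (hw.1 i j (hlt v' _ _ hi.2 hj)).2
  · intro v
    have hz0 : z ≠ 0 := by rintro rfl; simp at hz
    have hzz : ∀ a b : ℂ, (z * a * conj (z * b)).im = Complex.normSq z * (a * conj b).im := by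
      intro a b
      simp [Complex.mul_im, Complex.mul_re, Complex.normSq_apply]; ring
    by_cases hall : ∀ u, c v u
    · simp only [hall, if_true]
      rw [← Finset.mul_sum]
      refine mul_ne_zero hz0 ?_
      exact sum_ne_zero_aux Finset.univ w z hz ⟨0, hm⟩ (Finset.mem_univ _) (hw.2 _)
        (fun j _ => hw.1 _ _ (Fin.mk_le_of_le_val (Nat.zero_le _)))
    · push Not at hall
      obtain ⟨b, hb, hmin⟩ := (Finset.univ.filter fun u => ¬ c v u).exists_min_image id
        (by obtain ⟨u, hu⟩ := hall; exact ⟨u, by simpa using hu⟩)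
      simp only [Finset.mem_filter, Finset.mem_univ, true_and, id] at hb hmin
      refine sum_ne_zero_aux Finset.univ _ z hz b (Finset.mem_univ _) ?_ ?_
      · simpa [hb] using hw.2 b
      · intro j _
        by_cases hj : c v j
        · have := hw.1 j b (hlt v _ _ hj hb)
          simp only [hj, hb, if_true, if_false, one_mul]
          refine ⟨this.2, ?_⟩
          rw [hzz]
          exact mul_nonneg (Complex.normSq_nonneg _) this.1
        · have := hw.1 b j (hmin j hj)
          simpa only [hj, hb, if_true, if_false, one_mul] using this

noncomputable def lastPoly (z : ℂ) (n : ℕ) (s : Fin (n + 1) → ℕ) (v : Fin (s (Fin.last n))) : ℂ :=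
  ∑ e : (∀ i : Fin n, Fin (s i.castSucc)),
    z ^ ascCount (n + 1) s (Fin.snoc (α := fun i => Fin (s i)) e v)

lemma ascCount_snoc (n : ℕ) (s : Fin (n + 2) → ℕ)
    (e : ∀ i : Fin (n + 1), Fin (s i.castSucc)) (v : Fin (s (Fin.last (n + 1)))) :
    ascCount (n + 2) s (Fin.snoc (α := fun i => Fin (s i)) e v) =
      ascCount (n + 1) (fun i => s i.castSucc) e +
      if (e (Fin.last n) : ℕ) * s (Fin.last (n + 1)) < (v : ℕ) * s (Fin.last n).castSucc
        then 1 else 0 := by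
  unfold ascCount
  rw [Finset.card_filter, Finset.card_filter, Fin.sum_univ_castSucc]
  congr 1
  · refine Finset.sum_congr rfl fun j _ => ?_
    refine if_congr ?_ rfl rfl
    simp only [Fin.snoc_castSucc, Fin.val_castSucc]
    refine or_congr Iff.rfl ?_
    constructor
    · rintro ⟨i, hi, h⟩
      induction i using Fin.lastCases with
      | last => simp at hi; omega
      | cast i =>
        simp only [Fin.snoc_castSucc] at h
        exact ⟨i, by simpa using hi, h⟩
    · rintro ⟨i, hi, h⟩
      exact ⟨i.castSucc, by simpa using hi, by simpa only [Fin.snoc_castSucc] using h⟩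
  · refine if_congr ?_ rfl rfl
    simp only [Fin.snoc_last, Fin.val_last]
    constructor
    · rintro (⟨h, _⟩ | ⟨i, hi, h⟩)
      · omega
      · have : i = (Fin.last n).castSucc := by ext; simp; omega
        subst this
        simpa only [Fin.snoc_castSucc] using h
    · intro h
      exact Or.inr ⟨(Fin.last n).castSucc, by simp, by simpa only [Fin.snoc_castSucc] using h⟩

lemma sum_snoc (n : ℕ) (s : Fin (n + 1) → ℕ) (f : (∀ i, Fin (s i)) → ℂ) :
    ∑ e, f e = ∑ v, ∑ e : (∀ i : Fin n, Fin (s i.castSucc)),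
      f (Fin.snoc (α := fun i => Fin (s i)) e v) := by
  rw [← (Fin.snocEquiv (fun i => Fin (s i))).sum_comp, Fintype.sum_prod_type]
  rfl

lemma lastPoly_succ (z : ℂ) (n : ℕ) (s : Fin (n + 2) → ℕ) (v : Fin (s (Fin.last (n + 1)))) :
    lastPoly z (n + 1) s v = ∑ u : Fin (s (Fin.last n).castSucc),
      (if (u : ℕ) * s (Fin.last (n + 1)) < (v : ℕ) * s (Fin.last n).castSucc then z else 1) *
        lastPoly z n (fun i => s i.castSucc) u := by
  unfold lastPoly
  rw [sum_snoc n (fun i => s i.castSucc)]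
  refine Finset.sum_congr rfl fun u _ => ?_
  rw [Finset.mul_sum]
  refine Finset.sum_congr rfl fun e _ => ?_
  rw [ascCount_snoc, pow_add, mul_comm, Fin.snoc_last]
  congr 1
  split_ifs <;> simp

lemma lastPoly_zero (z : ℂ) (s : Fin 1 → ℕ) (v : Fin (s (Fin.last 0))) :
    lastPoly z 0 s v = if 0 < (v : ℕ) then z else 1 := by
  unfold lastPoly
  rw [Fintype.sum_unique]
  unfold ascCount
  rw [Finset.card_filter, Fin.sum_univ_castSucc]
  simp only [Fin.snoc_last]
  by_cases h : 0 < (v : ℕ) <;> simp [h]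

lemma good_lastPoly (z : ℂ) (hz : 0 < z.im) (n : ℕ) (s : Fin (n + 1) → ℕ) (hs : ∀ i, 0 < s i) :
    GoodSeq z (lastPoly z n s) := by
  induction n with
  | zero =>
    have h1 : GoodSeq z (fun _ : Fin 1 => (1 : ℂ)) := ⟨by simp [hz.le], by simp⟩
    have := good_step z hz (m' := s (Fin.last 0)) one_pos _ h1 (fun v _ => 0 < (v : ℕ))
      (fun _ _ _ _ h => h) (fun v v' _ h h' => lt_of_lt_of_le h' h)
    convert this using 1
    funext v
    rw [lastPoly_zero]; simp
  | succ n ih =>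
    have := good_step z hz (m' := s (Fin.last (n + 1))) (hs (Fin.last n).castSucc) _
      (ih (fun i => s i.castSucc) (fun i => hs _))
      (fun v u => (u : ℕ) * s (Fin.last (n + 1)) < (v : ℕ) * s (Fin.last n).castSucc)
      (fun v u u' h h' => lt_of_le_of_lt (Nat.mul_le_mul_right _ h) h')
      (fun v v' u h h' => lt_of_lt_of_le h' (Nat.mul_le_mul_right _ h))
    convert this using 1
    funext v
    rw [lastPoly_succ]

lemma no_root_upper (n : ℕ) (s : Fin n → ℕ) (hs : ∀ i, 0 < s i) (z : ℂ) (hz : 0 < z.im) :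
    (Polynomial.aeval z
        (∑ e : (∀ i : Fin n, Fin (s i)), (X : ℝ[X]) ^ ascCount n s e)) ≠ 0 := by
  simp only [map_sum, map_pow, aeval_X]
  cases n with
  | zero =>
    rw [Fintype.sum_unique]
    simp [ascCount]
  | succ n =>
    rw [sum_snoc]
    have hg := good_lastPoly z hz n s hs
    exact sum_ne_zero_aux Finset.univ (lastPoly z n s) z hz ⟨0, hs _⟩ (Finset.mem_univ _) (hg.2 _)
        (fun j _ => hg.1 _ _ (Fin.mk_le_of_le_val (Nat.zero_le _)))

/-- **Savage–Visontai**: for any sequence `s` of positive integers, the `s`-Eulerian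
polynomial `E_n^{(s)}(x) = ∑_{e ∈ I_n^{(s)}} x^{asc e}` (here with real
coefficients) has only real roots: every complex root has imaginary part zero. -/
theorem s_eulerian_real_rooted (n : ℕ) (s : Fin n → ℕ) (hs : ∀ i, 0 < s i) :
    ∀ z : ℂ,
      (Polynomial.aeval z
        (∑ e : (∀ i : Fin n, Fin (s i)), (X : ℝ[X]) ^ ascCount n s e)) = 0 →
      z.im = 0 := by
  intro z h
  rcases lt_trichotomy z.im 0 with hz | hz | hz
  · exfalso
    refine no_root_upper n s hs (conj z) (by simpa using hz) ?_
    rw [Polynomial.aeval_conj, h, map_zero]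
  · exact hz
  · exact absurd h (no_root_upper n s hs z hz)
end
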